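/- arXiv:1512.01933 — 5 statements merged into one kernel-verified Lean document; each statement's English description precedes it below -/
import Mathlib

section
/- For fixed integers m ≥ 2 and coprime r, s ≥ 2, and any polynomials q₁, q₂ ∈ k[x] with q₁(0) ≠ 0 and q₂(0) ≠ 0, the polynomial rings in one variable A(m,r,s,q₁)[w] and A(m,r,s,q₂)[w] are isomorphic as k-algebras; that is, all the cylinders X(m,r,s,q) × 𝔸¹ are isomorphic. -/
open MvPolynomial

/-- The defining relation `x^m z - y^r - t^s - x*q(x)` of the threefold `X(m,r,s,q)`,
in `k[x,y,z,t]` with `x = X 0`, `y = X 1`, `z = X 2`, `t = X 3`. -/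
noncomputable def krRel (k : Type) [Field k] (m r s : ℕ) (q : Polynomial k) :
    MvPolynomial (Fin 4) k :=
  X 0 ^ m * X 2 - X 1 ^ r - X 3 ^ s - X 0 * Polynomial.aeval (X 0 : MvPolynomial (Fin 4) k) q

/-- The coordinate ring `A(m,r,s,q) = k[x,y,z,t]/(x^m z - y^r - t^s - x*q(x))`. -/
abbrev krAlg (k : Type) [Field k] (m r s : ℕ) (q : Polynomial k) : Type :=
  MvPolynomial (Fin 4) k ⧸ Ideal.span {krRel k m r s q}


/-- The affine modification `S[Z] / (f * Z - p)` of a ring `S`. -/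
abbrev AffineModification {S : Type} [CommRing S] (f p : S) : Type :=
  Polynomial S ⧸ Ideal.span {Polynomial.C f * Polynomial.X - Polynomial.C p}

namespace AffineModification

variable {k S : Type} [Field k] [CommRing S] [Algebra k S]

lemma mk_relation (f p : S) :
    algebraMap S (AffineModification f p) f * Ideal.Quotient.mk _ Polynomial.X =
      algebraMap S (AffineModification f p) p := by
  have h := Ideal.Quotient.eq_zero_iff_mem.mpr
    (Ideal.mem_span_singleton_self (Polynomial.C f * Polynomial.X - Polynomial.C p))
  rw [map_sub, map_mul, sub_eq_zero] at h
  exact h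

/-- The universal property of the affine modification. -/
noncomputable def lift {T : Type} [CommRing T] [Algebra k T] {f p : S} (φ : S →ₐ[k] T) (z : T)
    (h : φ f * z = φ p) : AffineModification f p →ₐ[k] T :=
  Ideal.Quotient.liftₐ _ (Polynomial.eval₂AlgHom φ z fun _ => Commute.all _ _) <| by
    intro a ha
    obtain ⟨b, rfl⟩ := Ideal.mem_span_singleton'.mp ha
    simp [h]

section lift

variable {T : Type} [CommRing T] [Algebra k T] {f p : S} (φ : S →ₐ[k] T) (z : T)
  (h : φ f * z = φ p)

@[simp]
lemma lift_mk_X : lift φ z h (Ideal.Quotient.mk _ Polynomial.X) = z := by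
  change Polynomial.eval₂ _ _ _ = _
  simp

@[simp]
lemma lift_algebraMap (a : S) : lift φ z h (algebraMap S (AffineModification f p) a) = φ a := by
  change Polynomial.eval₂ _ _ (Polynomial.C a) = _
  simp

end lift

lemma algHom_ext' {T : Type} [CommRing T] [Algebra k T] {f p : S}
    {α β : AffineModification f p →ₐ[k] T}
    (hS : ∀ a, α (algebraMap S _ a) = β (algebraMap S _ a))
    (hX : α (Ideal.Quotient.mk _ Polynomial.X) = β (Ideal.Quotient.mk _ Polynomial.X)) :
    α = β := by
  apply Ideal.Quotient.algHom_ext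
  apply AlgHom.coe_ringHom_injective
  apply Polynomial.ringHom_ext
  · exact hS
  · exact hX

/-- An automorphism of `S` that matches the centres `(f, p)` and `(f', p')` of two affine
modifications up to units modulo `f'` induces an isomorphism between them. -/
lemma nonempty_algEquiv {f p f' p' : S} (φ : S ≃ₐ[k] S) {c c' e e' g h : S}
    (hf : φ f = c * f') (hc : c * c' = 1) (hp : φ p = e * p' + f' * g)
    (he : e * e' = 1 + f' * h) :
    Nonempty (AffineModification f p ≃ₐ[k] AffineModification f' p') := by
  let ι := IsScalarTower.toAlgHom k S (AffineModification f p)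
  let ι' := IsScalarTower.toAlgHom k S (AffineModification f' p')
  have hZ : ι f * Ideal.Quotient.mk _ Polynomial.X = ι p := mk_relation f p
  have hZ' : ι' f' * Ideal.Quotient.mk _ Polynomial.X = ι' p' := mk_relation f' p'
  let ψ : S →ₐ[k] AffineModification f p := ι.comp φ.symm.toAlgHom
  have hψ (a : S) : ψ (φ a) = ι a := by simp [ψ]
  have hψf : ι f = ψ c * ψ f' := by rw [← hψ, hf, map_mul]
  have hψp : ι p = ψ e * ψ p' + ψ f' * ψ g := by rw [← hψ, hp, map_add, map_mul, map_mul]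
  have hψc : ψ c * ψ c' = 1 := by rw [← map_mul, hc, map_one]
  have hψe : ψ e * ψ e' = 1 + ψ f' * ψ h := by rw [← map_mul, he]; simp
  have hιc : ι' c * ι' c' = 1 := by rw [← map_mul, hc, map_one]
  have hιe : ι' e * ι' e' = 1 + ι' f' * ι' h := by rw [← map_mul, he]; simp
  rw [hψf, hψp] at hZ
  let F : AffineModification f p →ₐ[k] AffineModification f' p' :=
    lift (ι'.comp φ.toAlgHom) (ι' c' * (ι' e * Ideal.Quotient.mk _ Polynomial.X + ι' g)) <| by
      change ι' (φ f) * _ = ι' (φ p)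
      rw [hf, hp]
      simp only [map_add, map_mul]
      linear_combination (ι' f' * (ι' e * Ideal.Quotient.mk _ Polynomial.X + ι' g)) * hιc
        + ι' e * hZ'
  let G : AffineModification f' p' →ₐ[k] AffineModification f p :=
    lift ψ (ψ c * ψ e' * Ideal.Quotient.mk _ Polynomial.X - ψ h * ψ p' - ψ e' * ψ g) <| by
      linear_combination ψ e' * hZ + ψ p' * hψe
  have hFS (a : S) : F (ι a) = ι' (φ a) := lift_algebraMap _ _ _ a
  have hGS (a : S) : G (ι' a) = ψ a := lift_algebraMap _ _ _ a
  have hFψ (a : S) : F (ψ a) = ι' a := by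
    change F (ι (φ.symm a)) = _
    rw [hFS, AlgEquiv.apply_symm_apply]
  have hFX : F (Ideal.Quotient.mk _ Polynomial.X) = _ := lift_mk_X _ _ _
  have hGX : G (Ideal.Quotient.mk _ Polynomial.X) = _ := lift_mk_X _ _ _
  refine ⟨AlgEquiv.ofAlgHom F G (algHom_ext' (fun a => ?_) ?_) (algHom_ext' (fun a => ?_) ?_)⟩
  · change F (G (ι' a)) = ι' a
    rw [hGS, hFψ]
  · change F (G _) = Ideal.Quotient.mk _ Polynomial.X
    rw [hGX]
    simp only [map_sub, map_mul, hFψ, hFX]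
    linear_combination (ι' e' * (ι' e * Ideal.Quotient.mk _ Polynomial.X + ι' g)) * hιc
      + Ideal.Quotient.mk _ Polynomial.X * hιe + ι' h * hZ'
  · change G (F (ι a)) = ι a
    rw [hFS, hGS, hψ]
  · change G (F _) = Ideal.Quotient.mk _ Polynomial.X
    rw [hFX]
    simp only [map_add, map_mul, hGS, hGX]
    linear_combination (ψ e * ψ e' * Ideal.Quotient.mk _ Polynomial.X) * hψc
      + (Ideal.Quotient.mk _ Polynomial.X - ψ c' * ψ g) * hψe + ψ c' * ψ h * hZ
      - ψ f' * ψ h * Ideal.Quotient.mk _ Polynomial.X * hψc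

end AffineModification

/-- The cylinder over `X(m,r,s,q)` as an affine modification of `𝔸⁴`, the coordinate `X 2`
being the cylinder variable. -/
lemma nonempty_cylinder_algEquiv (k : Type) [Field k] (m r s : ℕ) (q : Polynomial k) :
    Nonempty (Polynomial (krAlg k m r s q) ≃ₐ[k]
      AffineModification (X 0 ^ m : MvPolynomial (Fin 4) k)
        (X 1 ^ r + X 3 ^ s + X 0 * Polynomial.aeval (X 0) q)) := by
  set f : MvPolynomial (Fin 4) k := X 0 ^ m with hf
  set p : MvPolynomial (Fin 4) k := X 1 ^ r + X 3 ^ s + X 0 * Polynomial.aeval (X 0) q with hp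
  let π : MvPolynomial (Fin 4) k →ₐ[k] krAlg k m r s q := Ideal.Quotient.mkₐ k _
  let ι := IsScalarTower.toAlgHom k (MvPolynomial (Fin 4) k) (AffineModification f p)
  let Z : AffineModification f p := Ideal.Quotient.mk _ Polynomial.X
  have hZ : ι f * Z = ι p := AffineModification.mk_relation f p
  have hπ : π (X 0) ^ m * π (X 2) =
      π (X 1) ^ r + π (X 3) ^ s + π (X 0) * Polynomial.aeval (π (X 0)) q := by
    have h : π (krRel k m r s q) = 0 :=
      Ideal.Quotient.eq_zero_iff_mem.mpr (Ideal.mem_span_singleton_self _)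
    simp only [krRel, map_sub, map_mul, map_pow, ← Polynomial.aeval_algHom_apply] at h
    linear_combination h
  let α₀ : MvPolynomial (Fin 4) k →ₐ[k] AffineModification f p :=
    aeval ![ι (X 0), ι (X 1), Z, ι (X 3)]
  have hα₀ : α₀ (krRel k m r s q) = 0 := by
    simp only [hf, hp, map_add, map_mul, map_pow, ← Polynomial.aeval_algHom_apply] at hZ
    simp only [krRel, map_sub, map_mul, map_pow, ← Polynomial.aeval_algHom_apply]
    simp only [α₀, aeval_X]
    simp
    linear_combination hZ
  let α : krAlg k m r s q →ₐ[k] AffineModification f p := Ideal.Quotient.liftₐ _ α₀ <| by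
    intro a ha
    obtain ⟨b, rfl⟩ := Ideal.mem_span_singleton'.mp ha
    rw [map_mul, hα₀, mul_zero]
  have hα (a : MvPolynomial (Fin 4) k) : α (π a) = α₀ a := rfl
  let F : Polynomial (krAlg k m r s q) →ₐ[k] AffineModification f p :=
    Polynomial.eval₂AlgHom α (ι (X 2)) fun _ => Commute.all _ _
  have hFC (a) : F (Polynomial.C a) = α a := by simp [F]
  have hFX : F Polynomial.X = ι (X 2) := by simp [F]
  let β : MvPolynomial (Fin 4) k →ₐ[k] Polynomial (krAlg k m r s q) :=
    aeval ![Polynomial.C (π (X 0)), Polynomial.C (π (X 1)), Polynomial.X,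
      Polynomial.C (π (X 3))]
  let G : AffineModification f p →ₐ[k] Polynomial (krAlg k m r s q) :=
    AffineModification.lift β (Polynomial.C (π (X 2))) <| by
      have h := congrArg (Polynomial.CAlgHom (R := k)) hπ
      simp only [map_add, map_mul, map_pow, ← Polynomial.aeval_algHom_apply] at h
      simp only [hf, hp, map_add, map_mul, map_pow, ← Polynomial.aeval_algHom_apply]
      simp only [β, aeval_X]
      simpa using h
  have hGS (a) : G (ι a) = β a := AffineModification.lift_algebraMap _ _ _ a
  have hGX : G Z = Polynomial.C (π (X 2)) := AffineModification.lift_mk_X _ _ _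
  refine ⟨AlgEquiv.ofAlgHom F G (AffineModification.algHom_ext' (fun a => ?_) ?_) ?_⟩
  · change F (G (ι a)) = ι a
    rw [hGS]
    change (F.comp β) a = ι a
    congr 1
    ext i
    fin_cases i <;> simp [β, hFC, hFX, hα, α₀]
  · change F (G Z) = Z
    rw [hGX, hFC, hα]
    simp [α₀]
  · have hC : (G.comp α) = Polynomial.CAlgHom := by
      apply Ideal.Quotient.algHom_ext
      apply MvPolynomial.algHom_ext
      intro i
      change G (α (π (X i))) = Polynomial.C (π (X i))
      rw [hα]
      fin_cases i <;> simp [α₀, hGS, hGX, β]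
    apply AlgHom.coe_ringHom_injective
    apply Polynomial.ringHom_ext
    · intro a
      change G (F (Polynomial.C a)) = Polynomial.C a
      rw [hFC]
      exact DFunLike.congr_fun hC a
    · change G (F Polynomial.X) = Polynomial.X
      rw [hFX, hGS]
      simp [β]

/-- If `u` is a unit modulo `d`, then `diag(u, u⁻¹)` modulo `d` lifts to an automorphism
acting on the variables `X i` and `X j`. -/
lemma exists_algEquiv_dvd_sub {k σ : Type} [Field k] [DecidableEq σ] {i j l : σ} (hij : i ≠ j)
    (hil : i ≠ l) (hjl : j ≠ l) {u v d h : Polynomial k} (huv : u * v = 1 + d * h) :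
    ∃ φ : MvPolynomial σ k ≃ₐ[k] MvPolynomial σ k,
      (∀ n, n ≠ i → n ≠ j → φ (X n) = X n) ∧
      Polynomial.aeval (X l) d ∣ φ (X i) - Polynomial.aeval (X l) u * X i := by
  let ev : Polynomial k →ₐ[k] MvPolynomial σ k := Polynomial.aeval (X l)
  have huv' : ev u * ev v = 1 + ev d * ev h := by
    rw [← map_mul, huv, map_add, map_one, map_mul]
  let φ : MvPolynomial σ k →ₐ[k] MvPolynomial σ k := aeval fun n =>
    if n = i then ev u * X i + ev d * X j
    else if n = j then -(ev d * ev h ^ 2) * X i + ev v * (1 - ev d * ev h) * X j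
    else X n
  let ψ : MvPolynomial σ k →ₐ[k] MvPolynomial σ k := aeval fun n =>
    if n = i then ev v * (1 - ev d * ev h) * X i - ev d * X j
    else if n = j then ev d * ev h ^ 2 * X i + ev u * X j
    else X n
  have hφi : φ (X i) = ev u * X i + ev d * X j := by simp [φ]
  have hφj : φ (X j) = -(ev d * ev h ^ 2) * X i + ev v * (1 - ev d * ev h) * X j := by
    simp [φ, hij.symm]
  have hφ (n) (h₁ : n ≠ i) (h₂ : n ≠ j) : φ (X n) = X n := by simp [φ, h₁, h₂]
  have hψi : ψ (X i) = ev v * (1 - ev d * ev h) * X i - ev d * X j := by simp [ψ]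
  have hψj : ψ (X j) = ev d * ev h ^ 2 * X i + ev u * X j := by simp [ψ, hij.symm]
  have hψ (n) (h₁ : n ≠ i) (h₂ : n ≠ j) : ψ (X n) = X n := by simp [ψ, h₁, h₂]
  have hφev (w : Polynomial k) : φ (ev w) = ev w := by
    simp only [ev, ← Polynomial.aeval_algHom_apply, hφ l hil.symm hjl.symm]
  have hψev (w : Polynomial k) : ψ (ev w) = ev w := by
    simp only [ev, ← Polynomial.aeval_algHom_apply, hψ l hil.symm hjl.symm]
  refine ⟨AlgEquiv.ofAlgHom φ ψ ?_ ?_, hφ, X j, ?_⟩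
  · ext1 n
    change φ (ψ (X n)) = X n
    by_cases h₁ : n = i
    · subst h₁
      simp only [hψi, map_sub, map_mul, map_one, hφev, hφi, hφj]
      linear_combination (1 - ev d * ev h) * X n * huv'
    by_cases h₂ : n = j
    · subst h₂
      simp only [hψj, map_add, map_mul, map_pow, hφev, hφi, hφj]
      linear_combination (1 - ev d * ev h) * X n * huv'
    rw [hψ n h₁ h₂, hφ n h₁ h₂]
  · ext1 n
    change ψ (φ (X n)) = X n
    by_cases h₁ : n = i
    · subst h₁
      simp only [hφi, map_add, map_mul, hψev, hψi, hψj]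
      linear_combination (1 - ev d * ev h) * X n * huv'
    by_cases h₂ : n = j
    · subst h₂
      simp only [hφj, map_add, map_sub, map_neg, map_one, map_mul, map_pow, hψev, hψi, hψj]
      linear_combination (1 - ev d * ev h) * X n * huv'
    rw [hφ n h₁ h₂, hψ n h₁ h₂]
  · change φ (X i) - ev u * X i = ev d * X j
    rw [hφi]
    ring

/-- The quotient of two polynomials with the same nonzero constant term has an `n`-th root
modulo any power of `X`. -/
lemma exists_pow_mul_sub_dvd {k : Type} [Field k] [CharZero k] {n : ℕ} (hn : n ≠ 0)
    {p q : Polynomial k} (hpq : p.eval 0 = q.eval 0) (hp : p.eval 0 ≠ 0) (m : ℕ) :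
    ∃ a : Polynomial k, a.eval 0 = 1 ∧ Polynomial.X ^ m ∣ a ^ n * p - q := by
  suffices h : ∃ a : Polynomial k, a.eval 0 = 1 ∧ Polynomial.X ^ (m + 1) ∣ a ^ n * p - q by
    obtain ⟨a, ha, hd⟩ := h
    exact ⟨a, ha, (pow_dvd_pow _ m.le_succ).trans hd⟩
  induction m with
  | zero =>
    refine ⟨1, by simp, ?_⟩
    rw [zero_add, pow_one, Polynomial.X_dvd_iff, Polynomial.coeff_zero_eq_eval_zero]
    simp [hpq]
  | succ m ih =>
    obtain ⟨a, ha, d, hd⟩ := ih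
    let c : k := -d.eval 0 / (n * p.eval 0)
    obtain ⟨w, hw⟩ := Polynomial.powAddExpansion a (Polynomial.C c * Polynomial.X ^ (m + 1)) n
    refine ⟨a + Polynomial.C c * Polynomial.X ^ (m + 1), by simp [ha], ?_⟩
    have hX : Polynomial.X ∣ d + (n : Polynomial k) * a ^ (n - 1) * Polynomial.C c * p := by
      rw [Polynomial.X_dvd_iff, Polynomial.coeff_zero_eq_eval_zero]
      have : (n : k) ≠ 0 := Nat.cast_ne_zero.mpr hn
      simp [ha, c]
      field_simp
      ring
    obtain ⟨b, hb⟩ := hX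
    refine ⟨b + w * Polynomial.C c ^ 2 * Polynomial.X ^ m * p, ?_⟩
    rw [hw]
    linear_combination hd + Polynomial.X ^ (m + 1) * hb

/-- Dubouloz–Fasel, Theorem 2(b): all the cylinders `X(m,r,s,q) × 𝔸¹` are isomorphic,
i.e. the `k`-algebras `A(m,r,s,q)[w]` are pairwise isomorphic. -/
theorem cylinders_iso (k : Type) [Field k] [CharZero k] (m r s : ℕ)
    (hm : 2 ≤ m) (hr : 2 ≤ r) (hs : 2 ≤ s) (hrs : Nat.Coprime r s)
    (q₁ q₂ : Polynomial k) (hq₁ : q₁.eval 0 ≠ 0) (hq₂ : q₂.eval 0 ≠ 0) :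
    Nonempty (Polynomial (krAlg k m r s q₁) ≃ₐ[k] Polynomial (krAlg k m r s q₂)) := by
  let c : k := q₂.eval 0 / q₁.eval 0
  have hc : c ≠ 0 := div_ne_zero hq₂ hq₁
  let q : Polynomial k := Polynomial.C c * q₁.comp (Polynomial.C c * Polynomial.X)
  have hq : q₂.eval 0 = q.eval 0 := by simp [q, c, hq₁]
  obtain ⟨a, ha, g₃, hg₃⟩ := exists_pow_mul_sub_dvd (n := r * s) (by positivity) hq hq₂ m
  have hinv (n : ℕ) : ∃ v h : Polynomial k, a ^ n * v = 1 + Polynomial.X ^ m * h := by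
    have hcop : IsCoprime a Polynomial.X := by
      obtain ⟨b, hb⟩ : Polynomial.X ∣ a - 1 := by
        rw [Polynomial.X_dvd_iff, Polynomial.coeff_zero_eq_eval_zero]
        simp [ha]
      exact ⟨1, -b, by linear_combination hb⟩
    obtain ⟨v, h, hvh⟩ := hcop.pow (m := n) (n := m)
    exact ⟨v, -h, by linear_combination hvh⟩
  let ev : Polynomial k →ₐ[k] MvPolynomial (Fin 4) k := Polynomial.aeval (X 0)
  have hev (φ : MvPolynomial (Fin 4) k →ₐ[k] MvPolynomial (Fin 4) k) (hφ : φ (X 0) = X 0)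
      (w : Polynomial k) : φ (ev w) = ev w := by
    simp only [ev, ← Polynomial.aeval_algHom_apply, hφ]
  have hX : ev Polynomial.X = X 0 := Polynomial.aeval_X _
  obtain ⟨E₁⟩ := nonempty_cylinder_algEquiv k m r s q₁
  obtain ⟨E₂⟩ := nonempty_cylinder_algEquiv k m r s q₂
  have hscale : Nonempty (AffineModification (X 0 ^ m : MvPolynomial (Fin 4) k)
      (X 1 ^ r + X 3 ^ s + X 0 * ev q₁) ≃ₐ[k] AffineModification (X 0 ^ m)
      (X 1 ^ r + X 3 ^ s + X 0 * ev q)) := by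
    let σ (b : k) : MvPolynomial (Fin 4) k →ₐ[k] MvPolynomial (Fin 4) k :=
      aeval ![C b * X 0, X 1, X 2, X 3]
    have hσ (b b' : k) (h : b * b' = 1) : (σ b).comp (σ b') = AlgHom.id k _ := by
      ext1 i
      have h' : (C b * C b' : MvPolynomial (Fin 4) k) = 1 := by rw [← map_mul, h, map_one]
      fin_cases i <;> simp [σ]
      linear_combination X 0 * h'
    refine AffineModification.nonempty_algEquiv
      (AlgEquiv.ofAlgHom (σ c) (σ c⁻¹) (hσ _ _ (mul_inv_cancel₀ hc)) (hσ _ _ (inv_mul_cancel₀ hc)))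
      (c := C c ^ m) (c' := C c⁻¹ ^ m) (e := 1) (e' := 1) (g := 0) (h := 0) ?_ ?_ ?_ (by simp)
    · simp [σ, mul_pow]
    · rw [← mul_pow, ← map_mul, mul_inv_cancel₀ hc, map_one, one_pow]
    · have h₀ : σ c (X 0) = C c * X 0 := by simp [σ]
      have h₁ : σ c (ev q₁) = ev (q₁.comp (Polynomial.C c * Polynomial.X)) := by
        simp only [ev, ← Polynomial.aeval_algHom_apply, h₀, Polynomial.aeval_comp]
        simp [algebraMap_eq]
      have h₂ : ev (Polynomial.C c) = C c := by simp [ev, algebraMap_eq]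
      change σ c _ = _
      simp only [map_add, map_mul, map_pow, h₁, q, h₀, h₂]
      simp [σ]
      ring
  have hy : Nonempty (AffineModification (X 0 ^ m : MvPolynomial (Fin 4) k)
      (X 1 ^ r + X 3 ^ s + X 0 * ev q) ≃ₐ[k] AffineModification (X 0 ^ m)
      (ev a ^ (r * s) * X 1 ^ r + X 3 ^ s + X 0 * ev q)) := by
    obtain ⟨v, h, hv⟩ := hinv s
    obtain ⟨φ, hφ, hd⟩ := exists_algEquiv_dvd_sub (i := (1 : Fin 4)) (j := 2) (l := 0)
      (by decide) (by decide) (by decide) hv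
    obtain ⟨g, hg⟩ := hd.trans (sub_dvd_pow_sub_pow _ _ r)
    have h₀ : φ (X 0) = X 0 := hφ _ (by decide) (by decide)
    refine AffineModification.nonempty_algEquiv φ (c := 1) (c' := 1) (e := 1) (e' := 1)
      (g := g) (h := 0) (by simp [h₀]) (by simp) ?_ (by simp)
    have h₁ : φ (ev q) = ev q := hev φ.toAlgHom h₀ q
    change φ (X 1) ^ r - (ev (a ^ s) * X 1) ^ r = ev (Polynomial.X ^ m) * g at hg
    rw [map_pow, map_pow, hX] at hg
    simp only [map_add, map_mul, map_pow, h₀, h₁, hφ 3 (by decide) (by decide)]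
    linear_combination hg
  have ht : Nonempty (AffineModification (X 0 ^ m : MvPolynomial (Fin 4) k)
      (ev a ^ (r * s) * X 1 ^ r + X 3 ^ s + X 0 * ev q) ≃ₐ[k] AffineModification (X 0 ^ m)
      (ev a ^ (r * s) * X 1 ^ r + ev a ^ (r * s) * X 3 ^ s + X 0 * ev q)) := by
    obtain ⟨v, h, hv⟩ := hinv r
    obtain ⟨φ, hφ, hd⟩ := exists_algEquiv_dvd_sub (i := (3 : Fin 4)) (j := 2) (l := 0)
      (by decide) (by decide) (by decide) hv
    obtain ⟨g, hg⟩ := hd.trans (sub_dvd_pow_sub_pow _ _ s)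
    have h₀ : φ (X 0) = X 0 := hφ _ (by decide) (by decide)
    refine AffineModification.nonempty_algEquiv φ (c := 1) (c' := 1) (e := 1) (e' := 1)
      (g := g) (h := 0) (by simp [h₀]) (by simp) ?_ (by simp)
    have h₁ (w) : φ (ev w) = ev w := hev φ.toAlgHom h₀ w
    change φ (X 3) ^ s - (ev (a ^ r) * X 3) ^ s = ev (Polynomial.X ^ m) * g at hg
    rw [map_pow, map_pow, hX] at hg
    simp only [map_add, map_mul, map_pow, h₀, h₁, hφ 1 (by decide) (by decide)]
    linear_combination hg
  have hunit : Nonempty (AffineModification (X 0 ^ m : MvPolynomial (Fin 4) k)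
      (ev a ^ (r * s) * X 1 ^ r + ev a ^ (r * s) * X 3 ^ s + X 0 * ev q) ≃ₐ[k]
      AffineModification (X 0 ^ m) (X 1 ^ r + X 3 ^ s + X 0 * ev q₂)) := by
    obtain ⟨v, h, hv⟩ := hinv (r * s)
    have hv' := congrArg ev hv
    have hg := congrArg ev hg₃
    simp only [map_add, map_sub, map_mul, map_pow, map_one, hX] at hv' hg
    refine AffineModification.nonempty_algEquiv AlgEquiv.refl (c := 1) (c' := 1)
      (e := ev a ^ (r * s)) (e' := ev v) (g := -(X 0 * ev g₃)) (h := ev h) (by simp) (by simp)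
      ?_ hv'
    change ev a ^ (r * s) * X 1 ^ r + ev a ^ (r * s) * X 3 ^ s + X 0 * ev q = _
    linear_combination -X 0 * hg
  obtain ⟨e₁⟩ := hscale
  obtain ⟨e₂⟩ := hy
  obtain ⟨e₃⟩ := ht
  obtain ⟨e₄⟩ := hunit
  exact ⟨E₁.trans <| e₁.trans <| e₂.trans <| e₃.trans <| e₄.trans E₂.symm⟩
end

section
/- Let m ≥ 4 and let r, s ≥ 2 be coprime. For a tuple a = (a₂, …, a_{m−1}) ∈ k^{m−2} set q_a(x) = 1 + x + Σ_{i=2}^{m−1} a_i x^i. Then for two tuples a, a′ ∈ k^{m−2}, the k-algebras A(m,r,s,q_a) and A(m,r,s,q_{a′}) are isomorphic if and only if a_i = a′_i for all 2 ≤ i ≤ m−2. In particular the fibers of the family x^m z = y^r + t^s + x + x² + Σ_{i=2}^{m−1} a_i x^{i+1} over k-rational points with distinct truncated parameters are pairwise non-isomorphic. -/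
open MvPolynomial

/-- The polynomial `q_a(x) = 1 + x + ∑_{i=2}^{m-1} a_i x^i`. -/
noncomputable def qFam (k : Type) [Field k] (m : ℕ) (a : ℕ → k) : Polynomial k :=
  1 + Polynomial.X + ∑ i ∈ Finset.Icc 2 (m - 1), Polynomial.C (a i) * Polynomial.X ^ i

section LocallyNilpotent

variable {k R : Type*} [CommRing k] [CommRing R] [Algebra k R]

/-- The general Leibniz rule for iterates of a derivation. -/
theorem Derivation.iterate_mul (D : Derivation k R R) (n : ℕ) (a b : R) :
    D^[n] (a * b) =
      ∑ p ∈ Finset.HasAntidiagonal.antidiagonal n, n.choose p.1 • (D^[p.1] a * D^[p.2] b) := by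
  induction n generalizing a b with
  | zero => simp
  | succ n ih =>
    rw [Finset.sum_antidiagonal_choose_succ_nsmul (fun i j => D^[i] a * D^[j] b)]
    rw [Function.iterate_succ_apply, D.leibniz, iterate_map_add]
    simp only [smul_eq_mul, ih, mul_comm b]
    congr 1
    refine Finset.sum_congr rfl fun p hp => ?_
    rw [Finset.HasAntidiagonal.mem_antidiagonal] at hp
    rw [Function.iterate_succ_apply, Nat.choose_symm_of_eq_add hp.symm]

theorem Derivation.iterate_eq_zero_of_le {D : Derivation k R R} {a : R} {m n : ℕ} (h : D^[m] a = 0)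
    (hmn : m ≤ n) : D^[n] a = 0 := by
  obtain ⟨c, rfl⟩ := Nat.exists_eq_add_of_le' hmn
  rw [Function.iterate_add_apply, h, iterate_map_zero]

/-- The subalgebra of elements killed by some iterate of a derivation. -/
def Derivation.nilSubalgebra (D : Derivation k R R) : Subalgebra k R where
  carrier := {a | ∃ n, D^[n] a = 0}
  mul_mem' := by
    rintro a b ⟨m, hm⟩ ⟨n, hn⟩
    refine ⟨m + n, ?_⟩
    rw [D.iterate_mul]
    refine Finset.sum_eq_zero fun p hp => ?_
    rw [Finset.HasAntidiagonal.mem_antidiagonal] at hp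
    rcases le_or_gt m p.1 with h | h
    · rw [D.iterate_eq_zero_of_le hm h, zero_mul, smul_zero]
    · rw [D.iterate_eq_zero_of_le hn (by omega), mul_zero, smul_zero]
  add_mem' := by
    rintro a b ⟨m, hm⟩ ⟨n, hn⟩
    refine ⟨m + n, ?_⟩
    rw [iterate_map_add, D.iterate_eq_zero_of_le hm (by omega),
      D.iterate_eq_zero_of_le hn (by omega), add_zero]
  algebraMap_mem' c := ⟨1, by simp⟩

/-- `a` has degree exactly `n` with respect to the derivation `D`. -/
def Derivation.HasDeg (D : Derivation k R R) (a : R) (n : ℕ) : Prop :=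
  D^[n] a ≠ 0 ∧ D^[n + 1] a = 0

namespace Derivation

variable {D : Derivation k R R} {a b : R} {m n : ℕ}

theorem HasDeg.ne_zero (h : D.HasDeg a n) : a ≠ 0 := by
  rintro rfl
  exact h.1 (iterate_map_zero D n)

theorem HasDeg.unique (h : D.HasDeg a m) (h' : D.HasDeg a n) : m = n := by
  by_contra hne
  rcases lt_or_gt_of_ne hne with hlt | hlt
  · exact h'.1 (iterate_eq_zero_of_le h.2 hlt)
  · exact h.1 (iterate_eq_zero_of_le h'.2 hlt)

theorem exists_hasDeg (ha : a ∈ D.nilSubalgebra) (h0 : a ≠ 0) : ∃ n, D.HasDeg a n := by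
  classical
  have hex : ∃ n, D^[n] a = 0 := ha
  have hpos : Nat.find hex ≠ 0 := fun h => h0 (by simpa [h] using Nat.find_spec hex)
  obtain ⟨n, hn⟩ := Nat.exists_eq_succ_of_ne_zero hpos
  exact ⟨n, Nat.find_min hex (by omega), by simpa [hn] using Nat.find_spec hex⟩

theorem hasDeg_zero_iff : D.HasDeg a 0 ↔ a ≠ 0 ∧ D a = 0 := by simp [HasDeg]

theorem HasDeg.eq_zero_of_map_eq_zero (h : D.HasDeg a n) (h0 : D a = 0) : n = 0 :=
  h.unique (hasDeg_zero_iff.2 ⟨h.ne_zero, h0⟩)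

theorem HasDeg.map (h : D.HasDeg a (n + 1)) : D.HasDeg (D a) n := by
  simpa only [HasDeg, Function.iterate_succ_apply] using h

theorem HasDeg.mul [IsDomain R] [CharZero R] (ha : D.HasDeg a m) (hb : D.HasDeg b n) :
    D.HasDeg (a * b) (m + n) := by
  constructor
  · rw [D.iterate_mul, Finset.sum_eq_single (m, n)]
    · rw [nsmul_eq_mul]
      exact mul_ne_zero (Nat.cast_ne_zero.2 (Nat.choose_pos (by omega)).ne')
        (mul_ne_zero ha.1 hb.1)
    · rintro ⟨p, q⟩ hp hne
      rw [Finset.HasAntidiagonal.mem_antidiagonal] at hp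
      simp only at hp ⊢
      rcases lt_trichotomy p m with h | h | h
      · rw [iterate_eq_zero_of_le hb.2 (by omega), mul_zero, smul_zero]
      · exact absurd (Prod.ext h (by simp only; omega)) hne
      · rw [iterate_eq_zero_of_le ha.2 (by omega), zero_mul, smul_zero]
    · simp
  · rw [D.iterate_mul]
    refine Finset.sum_eq_zero fun p hp => ?_
    rw [Finset.HasAntidiagonal.mem_antidiagonal] at hp
    rcases le_or_gt (m + 1) p.1 with h | h
    · rw [iterate_eq_zero_of_le ha.2 h, zero_mul, smul_zero]
    · rw [iterate_eq_zero_of_le hb.2 (by omega), mul_zero, smul_zero]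

/-- The kernel of a derivation is factorially closed among locally nilpotent elements. -/
theorem map_eq_zero_of_mul [IsDomain R] [CharZero R] (ha : a ∈ D.nilSubalgebra)
    (hb : b ∈ D.nilSubalgebra) (hab : a * b ≠ 0) (h : D (a * b) = 0) : D a = 0 ∧ D b = 0 := by
  obtain ⟨m, hm⟩ := exists_hasDeg ha (left_ne_zero_of_mul hab)
  obtain ⟨n, hn⟩ := exists_hasDeg hb (right_ne_zero_of_mul hab)
  have := (hm.mul hn).eq_zero_of_map_eq_zero h
  obtain ⟨rfl, rfl⟩ : m = 0 ∧ n = 0 := by omega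
  exact ⟨(hasDeg_zero_iff.1 hm).2, (hasDeg_zero_iff.1 hn).2⟩

theorem map_eq_zero_of_pow [IsDomain R] [CharZero R] (ha : a ∈ D.nilSubalgebra) (hn : n ≠ 0)
    (h : D (a ^ n) = 0) : D a = 0 := by
  obtain ⟨n, rfl⟩ := Nat.exists_eq_succ_of_ne_zero hn
  by_cases h0 : a = 0
  · simp [h0]
  rw [pow_succ'] at h
  exact (map_eq_zero_of_mul ha (pow_mem ha n) (mul_ne_zero h0 (pow_ne_zero n h0)) h).1

/-- A Wronskian-type criterion: two elements satisfying such relations cannot both lie outside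
the kernel. -/
theorem map_eq_zero_or_of_wronskian [IsDomain R] [CharZero R] {p q c d w : R}
    (ha : a ∈ D.nilSubalgebra) (hb : b ∈ D.nilSubalgebra) (hp : p ∈ D.nilSubalgebra)
    (hq : q ∈ D.nilSubalgebra) (hw : w ∈ D.nilSubalgebra) (hc0 : c ≠ 0) (hc : D c = 0)
    (hd0 : d ≠ 0) (hd : D d = 0) (h₁ : a * p * w = c * D b) (h₂ : b * q * w = d * D a) :
    D a = 0 ∨ D b = 0 := by
  by_contra! hne
  have ha0 : a ≠ 0 := fun h => hne.1 (by simp [h])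
  have hb0 : b ≠ 0 := fun h => hne.2 (by simp [h])
  have e₁ : a * p * w ≠ 0 := h₁ ▸ mul_ne_zero hc0 hne.2
  have e₂ : b * q * w ≠ 0 := h₂ ▸ mul_ne_zero hd0 hne.1
  obtain ⟨α, hα⟩ := exists_hasDeg ha ha0
  obtain ⟨β, hβ⟩ := exists_hasDeg hb hb0
  obtain ⟨π, hπ⟩ := exists_hasDeg hp (right_ne_zero_of_mul (left_ne_zero_of_mul e₁))
  obtain ⟨κ, hκ⟩ := exists_hasDeg hq (right_ne_zero_of_mul (left_ne_zero_of_mul e₂))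
  obtain ⟨ω, hω⟩ := exists_hasDeg hw (right_ne_zero_of_mul e₁)
  have hc' : D.HasDeg c 0 := hasDeg_zero_iff.2 ⟨hc0, hc⟩
  have hd' : D.HasDeg d 0 := hasDeg_zero_iff.2 ⟨hd0, hd⟩
  obtain ⟨α, rfl⟩ : ∃ α', α = α' + 1 := Nat.exists_eq_succ_of_ne_zero fun h =>
    hne.1 (hasDeg_zero_iff.1 (h ▸ hα)).2
  obtain ⟨β, rfl⟩ : ∃ β', β = β' + 1 := Nat.exists_eq_succ_of_ne_zero fun h =>
    hne.2 (hasDeg_zero_iff.1 (h ▸ hβ)).2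
  have f₁ := ((hα.mul hπ).mul hω).unique (h₁ ▸ hc'.mul hβ.map)
  have f₂ := ((hβ.mul hκ).mul hω).unique (h₂ ▸ hd'.mul hα.map)
  omega

theorem map_mem_nilSubalgebra (ha : a ∈ D.nilSubalgebra) : D a ∈ D.nilSubalgebra := by
  obtain ⟨n, hn⟩ := ha
  exact ⟨n, by rw [← Function.iterate_succ_apply, Function.iterate_succ_apply', hn, map_zero]⟩

end Derivation

end LocallyNilpotent

set_option linter.unusedSectionVars false

namespace AddMonoidAlgebra

variable {k G Γ : Type*} [Field k] [AddCommGroup G] [AddCommGroup Γ]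

theorem single_mem_supported {s : Set G} {g : G} (hg : g ∈ s) (c : k) :
    single g c ∈ supported k k s := by
  rw [mem_supported']
  intro m hm
  rw [coeff_single, Finsupp.single_eq_of_ne]
  rintro rfl
  exact hm hg

theorem supported_induction {s : Set G} {p : AddMonoidAlgebra k G → Prop}
    (zero : p 0) (add : ∀ f g, p f → p g → p (f + g))
    (single : ∀ g ∈ s, ∀ c, p (single g c)) {f : AddMonoidAlgebra k G}
    (hf : f ∈ supported k k s) : p f := by
  rw [← sum_coeff_single f]
  refine Finset.sum_induction _ p add zero fun g hg => single g (hf hg) _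

theorem mul_mem_supported {s t u : Set G} (h : ∀ a ∈ s, ∀ b ∈ t, a + b ∈ u)
    {f g : AddMonoidAlgebra k G} (hf : f ∈ supported k k s) (hg : g ∈ supported k k t) :
    f * g ∈ supported k k u := by
  classical
  intro x hx
  obtain ⟨a, ha, b, hb, rfl⟩ := Finset.mem_add.1 (support_coeff_mul_subset f g hx)
  exact h a (hf ha) b (hg hb)

/-- The derivation of a group algebra with prescribed logarithmic values on the group. -/
noncomputable def logDer (θ : G →+ AddMonoidAlgebra k G) :
    Derivation k (AddMonoidAlgebra k G) (AddMonoidAlgebra k G) :=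
  Derivation.mk'
    ((Finsupp.lsum k fun g =>
      LinearMap.mulRight k (θ g) ∘ₗ lsingle (R := k) g).comp (coeffLinearEquiv k).toLinearMap)
    (by
      intro a b
      induction a using induction_linear with
      | zero => simp
      | add x y hx hy => rw [add_mul, map_add, hx, hy, map_add]; simp only [smul_eq_mul]; ring
      | single m r =>
        induction b using induction_linear with
        | zero => simp
        | add x y hx hy => rw [mul_add, map_add, hx, hy, map_add]; simp only [smul_eq_mul]; ring
        | single n s =>
          rw [single_mul_single]
          simp only [LinearMap.coe_comp, LinearEquiv.coe_coe, Function.comp_apply,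
            coeffLinearEquiv_apply, coeff_single, Finsupp.lsum_single, smul_eq_mul, map_add,
            LinearMap.mulRight_apply, lsingle_apply, mul_add]
          rw [show single (m + n) (r * s) = single m r * single n s from
            (single_mul_single ..).symm]
          ring)

@[simp]
theorem logDer_single (θ : G →+ AddMonoidAlgebra k G) (g : G) (c : k) :
    logDer θ (single g c) = single g c * θ g := by
  simp [logDer]

section Lead

variable [LinearOrder Γ] [IsOrderedAddMonoid Γ] {deg : G →+ Γ}

/-- `u` is the homogeneous component of `f` of degree `γ`, and `f` has no components of larger
degree. -/
def Lead (deg : G →+ Γ) (f : AddMonoidAlgebra k G) (γ : Γ) (u : AddMonoidAlgebra k G) : Prop :=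
  u ∈ supported k k {g | deg g = γ} ∧ f - u ∈ supported k k {g | deg g < γ}

variable {f g u v : AddMonoidAlgebra k G} {γ δ : Γ}

theorem Lead.self (hu : u ∈ supported k k {g | deg g = γ}) : Lead deg u γ u :=
  ⟨hu, by simp⟩

theorem Lead.of_lt (hu : u ∈ supported k k {g | deg g < γ}) : Lead deg u γ 0 :=
  ⟨zero_mem _, by simpa⟩

theorem Lead.add (hf : Lead deg f γ u) (hg : Lead deg g γ v) : Lead deg (f + g) γ (u + v) :=
  ⟨add_mem hf.1 hg.1, by rw [add_sub_add_comm]; exact add_mem hf.2 hg.2⟩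

theorem Lead.mem_le (hf : Lead deg f γ u) : f ∈ supported k k {g | deg g ≤ γ} := by
  rw [← sub_add_cancel f u]
  exact add_mem (supported_mono (fun _ h => le_of_lt h) hf.2)
    (supported_mono (fun _ h => le_of_eq h) hf.1)

theorem Lead.mul (hf : Lead deg f γ u) (hg : Lead deg g δ v) :
    Lead deg (f * g) (γ + δ) (u * v) := by
  refine ⟨mul_mem_supported ?_ hf.1 hg.1, ?_⟩
  · rintro a (rfl : _ = _) b (rfl : _ = _)
    exact map_add deg a b
  · rw [show f * g - u * v = (f - u) * g + u * (g - v) by ring]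
    refine add_mem (mul_mem_supported ?_ hf.2 hg.mem_le) (mul_mem_supported ?_ hf.1 hg.2)
    · intro a ha b hb
      simpa using add_lt_add_of_lt_of_le ha hb
    · intro a ha b hb
      simpa using add_lt_add_of_le_of_lt (le_of_eq ha) hb

theorem Lead.pow (hf : Lead deg f γ u) (n : ℕ) : Lead deg (f ^ n) (n • γ) (u ^ n) := by
  induction n with
  | zero =>
    simp only [pow_zero, zero_smul]
    exact Lead.self (single_mem_supported (by simp) 1)
  | succ n ih => simpa only [pow_succ, succ_nsmul] using ih.mul hf

theorem Lead.le_of_ne_zero (hf : Lead deg f γ u) (hg : Lead deg f δ v) (hu : u ≠ 0) : γ ≤ δ := by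
  by_contra! hlt
  refine hu ?_
  have h : u ∈ supported k k {g | deg g < γ} := by
    rw [← sub_sub_cancel f u]
    exact sub_mem (supported_mono (fun a ha => lt_of_le_of_lt ha hlt) hg.mem_le) hf.2
  ext a
  by_contra ha
  have ha : a ∈ u.coeff.support := Finsupp.mem_support_iff.2 ha
  exact (h ha).ne (hf.1 ha)

theorem Lead.eq_of_eq (hf : Lead deg f γ u) (hg : Lead deg f γ v) : u = v := by
  have h : u - v ∈ supported k k {g | deg g < γ} := by
    rw [← sub_sub_sub_cancel_left (c := f)]
    exact sub_mem hg.2 hf.2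
  have h' := sub_mem hf.1 hg.1
  rw [← sub_eq_zero]
  ext a
  by_contra ha
  have ha : a ∈ (u - v).coeff.support := Finsupp.mem_support_iff.2 ha
  exact (h ha).ne (h' ha)

theorem Lead.unique (hf : Lead deg f γ u) (hg : Lead deg f δ v) (hu : u ≠ 0) (hv : v ≠ 0) :
    γ = δ ∧ u = v := by
  obtain rfl := le_antisymm (hf.le_of_ne_zero hg hu) (hg.le_of_ne_zero hf hv)
  exact ⟨rfl, hf.eq_of_eq hg⟩

/-- The homogeneous component of degree `γ`. -/
noncomputable def comp (deg : G →+ Γ) (γ : Γ) : AddMonoidAlgebra k G →+ AddMonoidAlgebra k G :=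
  coeffAddEquiv.symm.toAddMonoidHom.comp
    ((Finsupp.filterAddHom fun g => deg g = γ).comp coeffAddEquiv.toAddMonoidHom)

theorem coeff_comp (f : AddMonoidAlgebra k G) (a : G) :
    (comp deg γ f).coeff a = if deg a = γ then f.coeff a else 0 := by
  exact Finsupp.filter_apply (fun g => deg g = γ) f.coeff a

theorem comp_mem_supported {s : Set G} (hf : f ∈ supported k k s) :
    comp deg γ f ∈ supported k k (s ∩ {a | deg a = γ}) := by
  rw [mem_supported'] at hf ⊢
  intro a ha
  rw [coeff_comp]
  split_ifs with h
  · exact hf a fun hs => ha ⟨hs, h⟩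
  · rfl

theorem lead_comp (hf : f ∈ supported k k {a | deg a ≤ γ}) : Lead deg f γ (comp deg γ f) := by
  refine ⟨supported_mono (Set.inter_subset_right) (comp_mem_supported hf), ?_⟩
  rw [mem_supported'] at hf ⊢
  intro a ha
  rw [coeff_sub, Finsupp.sub_apply, coeff_comp]
  split_ifs with h
  · exact sub_self _
  · rw [hf a fun hle => ha (lt_of_le_of_ne hle h), sub_zero]

theorem exists_lead (deg : G →+ Γ) (hf : f ≠ 0) :
    ∃ γ, f ∈ supported k k {a | deg a ≤ γ} ∧ comp deg γ f ≠ 0 := by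
  have hne : f.coeff.support.Nonempty := by
    rw [Finsupp.support_nonempty_iff]
    exact fun h => hf (coeff_injective h)
  obtain ⟨a, ha, hmax⟩ := f.coeff.support.exists_max_image deg hne
  refine ⟨deg a, hmax, fun h => Finsupp.mem_support_iff.1 ha ?_⟩
  have := coeff_comp (deg := deg) (γ := deg a) f a
  rw [h] at this
  simpa using this.symm

theorem Lead.logDer {θ θ' : G →+ AddMonoidAlgebra k G} {e : Γ}
    (hθ : ∀ a, Lead deg (θ a) e (θ' a)) (hf : Lead deg f γ u) :
    Lead deg (logDer θ f) (γ + e) (logDer θ' u) := by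
  constructor
  · refine supported_induction (p := fun f => AddMonoidAlgebra.logDer θ' f ∈ _) (by simp)
      (fun f g hf hg => by rw [map_add]; exact add_mem hf hg) (fun a ha c => ?_) hf.1
    rw [logDer_single]
    refine mul_mem_supported ?_ (single_mem_supported (Set.mem_singleton a) c) (hθ a).1
    rintro _ rfl b (rfl : _ = _)
    simpa using ha
  · rw [show AddMonoidAlgebra.logDer θ f - AddMonoidAlgebra.logDer θ' u =
      AddMonoidAlgebra.logDer θ (f - u) +
        (AddMonoidAlgebra.logDer θ u - AddMonoidAlgebra.logDer θ' u) by rw [map_sub]; ring]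
    refine add_mem ?_ ?_
    · refine supported_induction (p := fun f => AddMonoidAlgebra.logDer θ f ∈ _) (by simp)
        (fun f g hf hg => by rw [map_add]; exact add_mem hf hg) (fun a ha c => ?_) hf.2
      rw [logDer_single]
      refine mul_mem_supported ?_ (single_mem_supported (Set.mem_singleton a) c) (hθ a).mem_le
      rintro _ rfl b hb
      simpa using add_lt_add_of_lt_of_le ha hb
    · refine supported_induction (p := fun f => AddMonoidAlgebra.logDer θ f -
        AddMonoidAlgebra.logDer θ' f ∈ _) (by simp)
        (fun f g hf hg => by rw [map_add, map_add, add_sub_add_comm]; exact add_mem hf hg)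
        (fun a ha c => ?_) hf.1
      rw [logDer_single, logDer_single, ← mul_sub]
      refine mul_mem_supported ?_ (single_mem_supported (Set.mem_singleton a) c) (hθ a).2
      rintro _ rfl b hb
      simpa using add_lt_add_of_le_of_lt (le_of_eq ha) hb

theorem Lead.iterate_logDer {θ θ' : G →+ AddMonoidAlgebra k G} {e : Γ}
    (hθ : ∀ a, Lead deg (θ a) e (θ' a)) (hf : Lead deg f γ u) (n : ℕ) :
    Lead deg ((AddMonoidAlgebra.logDer θ)^[n] f) (γ + n • e)
      ((AddMonoidAlgebra.logDer θ')^[n] u) := by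
  induction n with
  | zero => simpa
  | succ n ih =>
    rw [Function.iterate_succ_apply', Function.iterate_succ_apply', succ_nsmul, ← add_assoc]
    exact ih.logDer hθ

end Lead

end AddMonoidAlgebra

namespace KorasRussell

open AddMonoidAlgebra

/-- The Laurent polynomial ring in `x, y, t`. -/
abbrev Torus (k : Type*) [Field k] : Type _ := AddMonoidAlgebra k (ℤ × ℤ × ℤ)

theorem torus_charZero (k : Type*) [Field k] [CharZero k] : CharZero (Torus k) :=
  charZero_of_injective_algebraMap (algebraMap k (Torus k)).injective

/-- The bidegree: minus the order in `x`, then the weighted degree in `y, t`. -/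
def bideg (r s : ℕ) : ℤ × ℤ × ℤ →+ ℤ ×ₗ ℤ where
  toFun g := toLex (-g.1, s * g.2.1 + r * g.2.2)
  map_zero' := by simp
  map_add' a b := by
    rw [← toLex_add, Prod.mk_add_mk]
    congr 2
    · simp; ring
    · simp; ring

theorem bideg_eq_iff {r s : ℕ} {g : ℤ × ℤ × ℤ} {a b : ℤ} :
    bideg r s g = toLex (a, b) ↔ -g.1 = a ∧ s * g.2.1 + r * g.2.2 = b := by
  simp [bideg]

theorem bideg_lt_iff {r s : ℕ} {g : ℤ × ℤ × ℤ} {a b : ℤ} :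
    bideg r s g < toLex (a, b) ↔ -g.1 < a ∨ -g.1 = a ∧ s * g.2.1 + r * g.2.2 < b := by
  simp [bideg, Prod.Lex.toLex_lt_toLex]

theorem nsmul_toLex (n : ℕ) (a b : ℤ) :
    n • (toLex (a, b) : ℤ ×ₗ ℤ) = toLex (n * a, n * b) := by
  change toLex (n • (a, b)) = _
  rw [Prod.smul_mk, nsmul_eq_mul, nsmul_eq_mul]

variable (k : Type*) [Field k]

/-- The coordinate `x`. -/
noncomputable def tx : Torus k := single (1, 0, 0) 1
/-- The coordinate `y`. -/
noncomputable def ty : Torus k := single (0, 1, 0) 1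
/-- The coordinate `t`. -/
noncomputable def tt : Torus k := single (0, 0, 1) 1
/-- The inverse of the coordinate `x`. -/
noncomputable def txi : Torus k := single (-1, 0, 0) 1
/-- The function `(y^r + t^s) / x^m`. -/
noncomputable def zhat (m r s : ℕ) : Torus k := txi k ^ m * (ty k ^ r + tt k ^ s)

theorem tx_mul_txi : tx k * txi k = 1 := by
  rw [tx, txi, single_mul_single, AddMonoidAlgebra.one_def]
  simp
  rfl

theorem tx_ne_zero : tx k ≠ 0 := by simp [tx]
theorem ty_ne_zero : ty k ≠ 0 := by simp [ty]
theorem tt_ne_zero : tt k ≠ 0 := by simp [tt]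
theorem txi_ne_zero : txi k ≠ 0 := by simp [txi]

theorem tx_pow (n : ℕ) : tx k ^ n = single ((n : ℤ), 0, 0) 1 := by simp [tx, single_pow]
theorem ty_pow (n : ℕ) : ty k ^ n = single (0, (n : ℤ), 0) 1 := by simp [ty, single_pow]
theorem tt_pow (n : ℕ) : tt k ^ n = single (0, 0, (n : ℤ)) 1 := by simp [tt, single_pow]
theorem txi_pow (n : ℕ) : txi k ^ n = single (-(n : ℤ), 0, 0) 1 := by simp [txi, single_pow]

theorem tx_pow_mul_zhat (m r s : ℕ) : tx k ^ m * zhat k m r s = ty k ^ r + tt k ^ s := by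
  rw [zhat, ← mul_assoc, ← mul_pow, tx_mul_txi, one_pow, one_mul]

theorem single_eq_smul (a b c : ℕ) (u : k) :
    (single ((a : ℤ), (b : ℤ), (c : ℤ)) u : Torus k) = u • (tx k ^ a * ty k ^ b * tt k ^ c) := by
  simp [tx_pow, ty_pow, tt_pow, single_mul_single]

/-- Exponents of the monomials of `k[x,y,t]`. -/
def octant : Set (ℤ × ℤ × ℤ) := {g | 0 ≤ g.1 ∧ 0 ≤ g.2.1 ∧ 0 ≤ g.2.2}

/-- Exponents of the monomials of `k[y,t]` of weighted degree `w`. -/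
def slice (r s : ℕ) (w : ℤ) : Set (ℤ × ℤ × ℤ) :=
  {g | g.1 = 0 ∧ 0 ≤ g.2.1 ∧ 0 ≤ g.2.2 ∧ s * g.2.1 + r * g.2.2 = w}

theorem slice_subset_octant (r s : ℕ) (w : ℤ) : slice r s w ⊆ octant :=
  fun _ hg => ⟨hg.1.ge, hg.2.1, hg.2.2.1⟩

theorem ytPow_mem_slice (r s : ℕ) (u v : k) :
    u • ty k ^ r + v • tt k ^ s ∈ supported k k (slice r s (r * s)) := by
  rw [ty_pow, tt_pow]
  refine add_mem (Submodule.smul_mem _ _ (single_mem_supported ?_ _))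
    (Submodule.smul_mem _ _ (single_mem_supported ?_ _)) <;> simp [slice, mul_comm]

theorem ytPow_ne_zero {r s : ℕ} (hr : r ≠ 0) {u v : k} (hu : u ≠ 0) :
    u • ty k ^ r + v • tt k ^ s ≠ 0 := by
  intro h
  have := congrArg (fun f : Torus k => f.coeff (0, r, 0)) h
  simp [ty_pow, tt_pow, hr, hu] at this

theorem octant_induction {A : Subalgebra k (Torus k)} (hx : tx k ∈ A) (hy : ty k ∈ A)
    (ht : tt k ∈ A) {f : Torus k} (hf : f ∈ supported k k octant) : f ∈ A := by
  refine supported_induction (p := fun f => f ∈ A) (zero_mem _) (fun _ _ => add_mem)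
    (fun g hg c => ?_) hf
  obtain ⟨a, b, d⟩ := g
  obtain ⟨ha, hb, hd⟩ := hg
  lift a to ℕ using ha
  lift b to ℕ using hb
  lift d to ℕ using hd
  rw [single_eq_smul]
  exact Subalgebra.smul_mem _ (mul_mem (mul_mem (pow_mem hx _) (pow_mem hy _)) (pow_mem ht _)) _

section Wronskian

variable {k R : Type*} [CommRing k] [CommRing R] [Algebra k R] [IsDomain R] [CharZero R]

theorem map_eq_zero_of_relation {D : Derivation k R R} {x y t z : R} {m r s : ℕ} (hm : 2 ≤ m)
    (hs : 2 ≤ s) (hx : x ∈ D.nilSubalgebra) (ht : t ∈ D.nilSubalgebra) (hx0 : x ≠ 0) (hy0 : y ≠ 0)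
    (ht0 : t ≠ 0) (hz0 : z ≠ 0) (h : x ^ m * z = y ^ r + t ^ s) (hz : D z = 0) (hy : D y = 0) :
    D x = 0 ∧ D t = 0 := by
  obtain ⟨m, rfl⟩ := Nat.exists_eq_add_of_le' hm
  obtain ⟨s, rfl⟩ := Nat.exists_eq_add_of_le' hs
  have hzn : z ∈ D.nilSubalgebra := ⟨1, hz⟩
  have hyr : D (y ^ r) = 0 := by rw [D.leibniz_pow, hy]; simp
  have hd : ((m + 2 : ℕ) : R) * x ^ (m + 1) * D x * z = ((s + 2 : ℕ) : R) * t ^ (s + 1) * D t := by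
    have := congrArg D h
    rw [D.leibniz, map_add, hyr, hz, D.leibniz_pow, D.leibniz_pow] at this
    simp only [smul_eq_mul, nsmul_eq_mul, mul_zero, zero_add,
      show m + 2 - 1 = m + 1 from rfl, show s + 2 - 1 = s + 1 from rfl] at this
    linear_combination this
  have hm0 : ((m + 2 : ℕ) : R) ≠ 0 := Nat.cast_ne_zero.2 (by omega)
  have hs0 : ((s + 2 : ℕ) : R) ≠ 0 := Nat.cast_ne_zero.2 (by omega)
  have key : D x = 0 ∨ D t = 0 := by
    refine D.map_eq_zero_or_of_wronskian (p := x ^ m * z) (q := t ^ s)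
      (w := ((m + 2 : ℕ) : R) * D x * t - ((s + 2 : ℕ) : R) * x * D t)
      (c := -(((s + 2 : ℕ) : R) * y ^ r)) (d := -(((m + 2 : ℕ) : R) * y ^ r)) hx ht
      (mul_mem (pow_mem hx _) hzn) (pow_mem ht _)
      (sub_mem (mul_mem (mul_mem (natCast_mem _ _) (D.map_mem_nilSubalgebra hx)) ht)
        (mul_mem (mul_mem (natCast_mem _ _) hx) (D.map_mem_nilSubalgebra ht)))
      (neg_ne_zero.2 (mul_ne_zero hs0 (pow_ne_zero _ hy0))) ?_
      (neg_ne_zero.2 (mul_ne_zero hm0 (pow_ne_zero _ hy0))) ?_ ?_ ?_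
    · rw [map_neg, D.leibniz, hyr, D.map_natCast, smul_zero, smul_zero, add_zero, neg_zero]
    · rw [map_neg, D.leibniz, hyr, D.map_natCast, smul_zero, smul_zero, add_zero, neg_zero]
    · linear_combination t * hd - ((s + 2 : ℕ) : R) * D t * h
    · linear_combination x * hd - ((m + 2 : ℕ) : R) * D x * h
  rcases key with h0 | h0
  · refine ⟨h0, ?_⟩
    rw [h0] at hd
    simp only [mul_zero, zero_mul] at hd
    exact (mul_eq_zero.1 hd.symm).resolve_left (mul_ne_zero hs0 (pow_ne_zero _ ht0))
  · refine ⟨?_, h0⟩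
    rw [h0] at hd
    simp only [mul_zero] at hd
    exact (mul_eq_zero.1 ((mul_eq_zero.1 hd).resolve_right hz0)).resolve_left
      (mul_ne_zero hm0 (pow_ne_zero _ hx0))

end Wronskian

variable {k : Type*} [Field k]

theorem exists_eq_mul_of_supported {S S' : Set (ℤ × ℤ × ℤ)} (v : ℤ × ℤ × ℤ)
    (h : ∀ g ∈ S, g - v ∈ S') {f : Torus k} (hf : f ∈ supported k k S) :
    ∃ p ∈ supported k k S', f = single v 1 * p := by
  refine ⟨single (-v) 1 * f, ?_, ?_⟩
  · refine mul_mem_supported (s := {-v}) (fun a ha b hb => ?_)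
      (single_mem_supported (k := k) (Set.mem_singleton (-v)) 1) hf
    rw [Set.mem_singleton_iff.1 ha, neg_add_eq_sub]
    exact h b hb
  · rw [← mul_assoc, single_mul_single]
    simp [← AddMonoidAlgebra.one_def]

theorem zhat_ne_zero (m : ℕ) {r : ℕ} (hr : r ≠ 0) (s : ℕ) : zhat k m r s ≠ 0 := by
  rw [zhat]
  refine mul_ne_zero (pow_ne_zero _ (txi_ne_zero k)) ?_
  simpa using ytPow_ne_zero k hr (s := s) (u := 1) (v := 1) one_ne_zero

/-- The Euler operator of `y`. -/
noncomputable def eulerY : ℤ × ℤ × ℤ →+ Torus k where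
  toFun g := ((g.2.1 : ℤ) : Torus k)
  map_zero' := by simp
  map_add' := by simp

/-- The Euler operator of `t`. -/
noncomputable def eulerT : ℤ × ℤ × ℤ →+ Torus k where
  toFun g := ((g.2.2 : ℤ) : Torus k)
  map_zero' := by simp
  map_add' := by simp

theorem logDer_mem_supported_of_intCast {θ : ℤ × ℤ × ℤ →+ Torus k} {φ : ℤ × ℤ × ℤ → ℤ}
    (hθ : ∀ g, θ g = (φ g : Torus k)) {S S' : Set (ℤ × ℤ × ℤ)} (h : ∀ g ∈ S, φ g ≠ 0 → g ∈ S')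
    {f : Torus k} (hf : f ∈ supported k k S) : logDer θ f ∈ supported k k S' := by
  refine supported_induction (p := fun f => logDer θ f ∈ supported k k S') (by simp)
    (fun f g hf hg => by rw [map_add]; exact add_mem hf hg) (fun g hg c => ?_) hf
  rw [logDer_single, hθ]
  by_cases h0 : φ g = 0
  · simp [h0]
  · rw [← zsmul_eq_mul']
    exact zsmul_mem (single_mem_supported (h g hg h0) c) _

variable {θ : ℤ × ℤ × ℤ →+ Torus k} {m r s : ℕ}

theorem logDer_tx : logDer θ (tx k) = tx k * θ (1, 0, 0) := by rw [tx, logDer_single]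
theorem logDer_ty : logDer θ (ty k) = ty k * θ (0, 1, 0) := by rw [ty, logDer_single]
theorem logDer_tt : logDer θ (tt k) = tt k * θ (0, 0, 1) := by rw [tt, logDer_single]

theorem map_slice {a b : ℤ} :
    θ (0, a, b) = (a : Torus k) * θ (0, 1, 0) + (b : Torus k) * θ (0, 0, 1) := by
  rw [← zsmul_eq_mul, ← zsmul_eq_mul, ← map_zsmul, ← map_zsmul, ← map_add]
  simp

theorem logDer_of_slice {w : ℤ} {c : Torus k} (hc : c ∈ supported k k (slice r s w)) :
    logDer θ c = logDer eulerY c * θ (0, 1, 0) + logDer eulerT c * θ (0, 0, 1) := by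
  refine supported_induction (p := fun c => logDer θ c =
    logDer eulerY c * θ (0, 1, 0) + logDer eulerT c * θ (0, 0, 1)) (by simp)
    (fun f g hf hg => by simp only [map_add, hf, hg]; ring) (fun g hg u => ?_) hc
  obtain ⟨a, b, d⟩ := g
  obtain rfl : a = 0 := hg.1
  rw [logDer_single, logDer_single, logDer_single, map_slice]
  simp only [eulerY, eulerT, AddMonoidHom.coe_mk, ZeroHom.coe_mk]
  ring

theorem euler_relation {w : ℤ} {c : Torus k} (hc : c ∈ supported k k (slice r s w)) :
    (s : Torus k) * logDer eulerY c + (r : Torus k) * logDer eulerT c = (w : Torus k) * c := by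
  refine supported_induction (p := fun c => (s : Torus k) * logDer eulerY c +
    (r : Torus k) * logDer eulerT c = (w : Torus k) * c) (by simp)
    (fun f g hf hg => by simp only [map_add]; linear_combination hf + hg) (fun g hg u => ?_) hc
  obtain ⟨a, b, d⟩ := g
  rw [logDer_single, logDer_single, ← hg.2.2.2]
  simp only [eulerY, eulerT, AddMonoidHom.coe_mk, ZeroHom.coe_mk]
  push_cast
  ring

theorem mem_nil_of_octant (hx : tx k ∈ (logDer θ).nilSubalgebra)
    (hy : ty k ∈ (logDer θ).nilSubalgebra) (ht : tt k ∈ (logDer θ).nilSubalgebra) {f : Torus k}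
    (hf : f ∈ supported k k octant) : f ∈ (logDer θ).nilSubalgebra :=
  octant_induction k hx hy ht hf

variable [CharZero k]

theorem exists_monomial (hx : tx k ∈ (logDer θ).nilSubalgebra)
    (hy : ty k ∈ (logDer θ).nilSubalgebra) (ht : tt k ∈ (logDer θ).nilSubalgebra)
    {c : Torus k} (hc0 : c ≠ 0) (hc : logDer θ c = 0) {v : ℤ × ℤ × ℤ}
    (hv : logDer θ (single v 1) ≠ 0) (hvn : single v 1 ∈ (logDer θ).nilSubalgebra) :
    ∃ g, c.coeff g ≠ 0 ∧ g - v ∉ octant := by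
  have := torus_charZero k
  by_contra! hne
  obtain ⟨p, hp, rfl⟩ := exists_eq_mul_of_supported (S := {g | c.coeff g ≠ 0}) (S' := octant) v
    (fun g hg => hne g hg) (f := c) (by rw [mem_supported']; intro g hg; simpa using hg)
  exact hv ((logDer θ).map_eq_zero_of_mul hvn (mem_nil_of_octant hx hy ht hp) hc0 hc).1

theorem slice_not_ker (hr : 2 ≤ r) (hs : 2 ≤ s) (hrs : r.Coprime s)
    (hx : tx k ∈ (logDer θ).nilSubalgebra)
    (hy : ty k ∈ (logDer θ).nilSubalgebra) (ht : tt k ∈ (logDer θ).nilSubalgebra)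
    (hy0 : logDer θ (ty k) ≠ 0) (ht0 : logDer θ (tt k) ≠ 0) {w : ℤ} (hw : w ≠ 0)
    {c : Torus k} (hcs : c ∈ supported k k (slice r s w)) (hc0 : c ≠ 0) : logDer θ c ≠ 0 := by
  have := torus_charZero k
  intro hc
  have hmem : ∀ g, c.coeff g ≠ 0 → g ∈ slice r s w := fun g hg => by
    by_contra h
    exact hg (mem_supported'.1 hcs g h)
  have hrw : (r : ℤ) ∣ w := by
    obtain ⟨⟨a, b, d⟩, hg, hgo⟩ := exists_monomial hx hy ht hc0 hc (v := (0, 1, 0)) hy0 hy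
    obtain ⟨h1, h2, h3, h4⟩ := hmem _ hg
    simp only [octant, Prod.mk_sub_mk, Set.mem_ofPred_eq] at h1 h2 h3 h4 hgo
    obtain rfl : b = 0 := by omega
    exact ⟨d, by rw [← h4]; ring⟩
  have hsw : (s : ℤ) ∣ w := by
    obtain ⟨⟨a, b, d⟩, hg, hgo⟩ := exists_monomial hx hy ht hc0 hc (v := (0, 0, 1)) ht0 ht
    obtain ⟨h1, h2, h3, h4⟩ := hmem _ hg
    simp only [octant, Prod.mk_sub_mk, Set.mem_ofPred_eq] at h1 h2 h3 h4 hgo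
    obtain rfl : d = 0 := by omega
    exact ⟨b, by rw [← h4]; ring⟩
  have hcop : IsCoprime (r : ℤ) (s : ℤ) := Nat.isCoprime_iff_coprime.2 hrs
  obtain ⟨p, hp, hpe⟩ := exists_eq_mul_of_supported (0, 2, 0)
    (S := {g | g ∈ octant ∧ 2 ≤ g.2.1}) (S' := octant) (f := logDer eulerY c)
    (by
      rintro ⟨a, b, d⟩ ⟨⟨h1, h2, h3⟩, h4⟩
      simp only [octant, Prod.mk_sub_mk, Set.mem_ofPred_eq] at *
      omega)
    (by
      refine logDer_mem_supported_of_intCast (φ := fun g => g.2.1) (fun g => rfl) ?_ hcs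
      rintro ⟨a, b, d⟩ hg hb
      refine ⟨slice_subset_octant _ _ _ hg, ?_⟩
      obtain ⟨h1, h2, h3, h4⟩ := hg
      simp only at h1 h2 h3 h4 hb ⊢
      have : (r : ℤ) ∣ b := hcop.dvd_of_dvd_mul_left
        ((Int.dvd_add_left (dvd_mul_right _ d)).1 (h4 ▸ hrw))
      have := Int.le_of_dvd (by omega) this
      omega)
  obtain ⟨q, hq, hqe⟩ := exists_eq_mul_of_supported (0, 0, 2)
    (S := {g | g ∈ octant ∧ 2 ≤ g.2.2}) (S' := octant) (f := logDer eulerT c)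
    (by
      rintro ⟨a, b, d⟩ ⟨⟨h1, h2, h3⟩, h4⟩
      simp only [octant, Prod.mk_sub_mk, Set.mem_ofPred_eq] at *
      omega)
    (by
      refine logDer_mem_supported_of_intCast (φ := fun g => g.2.2) (fun g => rfl) ?_ hcs
      rintro ⟨a, b, d⟩ hg hb
      refine ⟨slice_subset_octant _ _ _ hg, ?_⟩
      obtain ⟨h1, h2, h3, h4⟩ := hg
      simp only at h1 h2 h3 h4 hb ⊢
      have : (s : ℤ) ∣ d := hcop.symm.dvd_of_dvd_mul_left
        ((Int.dvd_add_right (dvd_mul_right _ b)).1 (h4 ▸ hsw))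
      have := Int.le_of_dvd (by omega) this
      omega)
  have ey : (single (0, 2, 0) 1 : Torus k) = ty k ^ 2 := by rw [ty_pow]; rfl
  have et : (single (0, 0, 2) 1 : Torus k) = tt k ^ 2 := by rw [tt_pow]; rfl
  rw [ey] at hpe
  rw [et] at hqe
  have e1 := logDer_of_slice (θ := θ) hcs
  have e2 := euler_relation hcs
  rw [hpe, hqe] at e1 e2
  rw [hc] at e1
  have e1' : ty k * p * logDer θ (ty k) + tt k * q * logDer θ (tt k) = 0 := by
    rw [logDer_ty, logDer_tt]
    linear_combination -e1
  have hwc : (w : Torus k) ≠ 0 := Int.cast_ne_zero.2 hw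
  have hD : logDer θ ((w : Torus k) * c) = 0 := by simp [Derivation.leibniz, hc]
  refine ((logDer θ).map_eq_zero_or_of_wronskian (p := p) (q := q)
    (w := (r : Torus k) * tt k * logDer θ (ty k) - (s : Torus k) * ty k * logDer θ (tt k))
    (c := -((w : Torus k) * c)) (d := (w : Torus k) * c) hy ht
    (mem_nil_of_octant hx hy ht hp) (mem_nil_of_octant hx hy ht hq)
    (sub_mem (mul_mem (mul_mem (natCast_mem _ _) ht) (Derivation.map_mem_nilSubalgebra hy))
      (mul_mem (mul_mem (natCast_mem _ _) hy) (Derivation.map_mem_nilSubalgebra ht)))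
    (neg_ne_zero.2 (mul_ne_zero hwc hc0)) (by rw [map_neg, hD, neg_zero])
    (mul_ne_zero hwc hc0) hD ?_ ?_).elim hy0 ht0
  · linear_combination (r : Torus k) * tt k * e1' - logDer θ (tt k) * e2
  · linear_combination -(s : Torus k) * ty k * e1' + logDer θ (ty k) * e2

variable {k : Type*} [Field k] {θ : ℤ × ℤ × ℤ →+ Torus k} {m r s : ℕ}

theorem iterate_logDer_mem {e : ℤ ×ₗ ℤ}
    (hθ : ∀ a, θ a ∈ supported k k {g | bideg r s g = e}) {f : Torus k} {γ : ℤ ×ₗ ℤ}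
    (hf : f ∈ supported k k {g | bideg r s g = γ}) (n : ℕ) :
    (logDer θ)^[n] f ∈ supported k k {g | bideg r s g = γ + n • e} :=
  ((Lead.self hf).iterate_logDer (fun a => Lead.self (hθ a)) n).1

theorem eq_of_mem_supported {f : Torus k} {γ δ : ℤ ×ₗ ℤ} (hf0 : f ≠ 0)
    (hf : f ∈ supported k k {g | bideg r s g = γ}) (hf' : f ∈ supported k k {g | bideg r s g = δ}) :
    γ = δ :=
  (Lead.unique (Lead.self hf) (Lead.self hf') hf0 hf0).1

theorem zhat_mem_supported :
    zhat k m r s ∈ supported k k {g | bideg r s g = toLex ((m : ℤ), (r * s : ℤ))} := by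
  rw [zhat, mul_add, txi_pow, ty_pow, tt_pow, single_mul_single, single_mul_single]
  refine add_mem (single_mem_supported ?_ _) (single_mem_supported ?_ _) <;>
    simp [bideg_eq_iff, mul_comm]

theorem zhat_pow_mem_supported (N : ℕ) :
    zhat k m r s ^ N ∈ supported k k
      {g | bideg r s g = toLex ((N * m : ℤ), (N * (r * s) : ℤ))} := by
  have := ((Lead.self (zhat_mem_supported (k := k) (m := m) (r := r) (s := s))).pow N).1
  rwa [nsmul_toLex] at this

theorem no_homogeneous_derivation [CharZero k] (hm : 2 ≤ m) (hr : 2 ≤ r) (hs : 2 ≤ s)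
    (hrs : r.Coprime s)
    {e : ℤ ×ₗ ℤ} (hθ : ∀ a, θ a ∈ supported k k {g | bideg r s g = e}) (hθ0 : θ ≠ 0)
    (hx : tx k ∈ (logDer θ).nilSubalgebra) (hy : ty k ∈ (logDer θ).nilSubalgebra)
    (ht : tt k ∈ (logDer θ).nilSubalgebra) (hz : logDer θ (zhat k m r s) = 0)
    (hgood : ∀ h ∈ supported k k octant, ∀ γ, h ∈ supported k k {g | bideg r s g = γ} →
      ∀ n, (logDer θ)^[n] h ≠ 0 → ∃ (N i : ℕ) (w : ℤ) (c : Torus k), c ≠ 0 ∧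
        c ∈ supported k k (slice r s w) ∧
        (logDer θ)^[n] h = zhat k m r s ^ N * (tx k ^ i * c)) : False := by
  have := torus_charZero k
  set D := logDer θ with hDdef
  have hznil : zhat k m r s ∈ D.nilSubalgebra := ⟨1, hz⟩
  have hz0 : zhat k m r s ≠ 0 := zhat_ne_zero m (by omega) s
  have hrel := tx_pow_mul_zhat k m r s
  have hnt : ¬(D (tx k) = 0 ∧ D (ty k) = 0 ∧ D (tt k) = 0) := by
    rintro ⟨h1, h2, h3⟩
    refine hθ0 (AddMonoidHom.ext fun ⟨a, b, d⟩ => ?_)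
    rw [hDdef, logDer_tx] at h1
    rw [hDdef, logDer_ty] at h2
    rw [hDdef, logDer_tt] at h3
    have h1 := (mul_eq_zero.1 h1).resolve_left (tx_ne_zero k)
    have h2 := (mul_eq_zero.1 h2).resolve_left (ty_ne_zero k)
    have h3 := (mul_eq_zero.1 h3).resolve_left (tt_ne_zero k)
    rw [show ((a, b, d) : ℤ × ℤ × ℤ) = a • (1, 0, 0) + (0, b, d) by simp, map_add, map_zsmul,
      map_slice, h1, h2, h3]
    simp
  have hy0 : D (ty k) ≠ 0 := fun h => by
    obtain ⟨h1, h2⟩ := map_eq_zero_of_relation hm hs hx ht (tx_ne_zero k) (ty_ne_zero k)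
      (tt_ne_zero k) hz0 hrel hz h
    exact hnt ⟨h1, h, h2⟩
  have ht0 : D (tt k) ≠ 0 := fun h => by
    obtain ⟨h1, h2⟩ := map_eq_zero_of_relation hm hr hx hy (tx_ne_zero k) (tt_ne_zero k)
      (ty_ne_zero k) hz0 (hrel.trans (add_comm _ _)) hz h
    exact hnt ⟨h1, h2, h⟩
  have hslice {w : ℤ} (hw : w ≠ 0) {c : Torus k} (hc : c ∈ supported k k (slice r s w))
      (hc0 : c ≠ 0) : D c ≠ 0 := slice_not_ker hr hs hrs hx hy ht hy0 ht0 hw hc hc0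
  have hrs0 : (r * s : ℤ) ≠ 0 := by positivity
  have hx0 : D (tx k) ≠ 0 := fun h => by
    refine hslice hrs0 (ytPow_mem_slice k r s 1 1) (ytPow_ne_zero k (by omega) one_ne_zero) ?_
    rw [one_smul, one_smul, ← hrel, D.leibniz, D.leibniz_pow, h, hz]
    simp
  have key {h : Torus k} (hh : h ∈ supported k k octant) {γ : ℤ ×ₗ ℤ}
      (hγ : h ∈ supported k k {g | bideg r s g = γ}) {n : ℕ} (hn : D.HasDeg h n) :
      ∃ (N : ℕ) (u : k), u ≠ 0 ∧ D^[n] h = u • zhat k m r s ^ N ∧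
        γ + n • e = toLex ((N * m : ℤ), (N * (r * s) : ℤ)) := by
    obtain ⟨N, i, w, c, hc0, hc, hE⟩ := hgood h hh γ hγ n hn.1
    have hk : D (D^[n] h) = 0 := by
      rw [← Function.iterate_succ_apply' D]
      exact hn.2
    have hcn : c ∈ D.nilSubalgebra :=
      mem_nil_of_octant hx hy ht (supported_mono (slice_subset_octant r s w) hc)
    rw [hE] at hk
    have hne := hn.1
    rw [hE] at hne
    obtain ⟨hkz, hkc⟩ := D.map_eq_zero_of_mul (pow_mem hznil N)
      (mul_mem (pow_mem hx i) hcn) hne hk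
    obtain ⟨hki, hkc'⟩ := D.map_eq_zero_of_mul (pow_mem hx i) hcn (right_ne_zero_of_mul hne) hkc
    obtain rfl : i = 0 := by
      by_contra hi
      exact hx0 (D.map_eq_zero_of_pow hx hi hki)
    obtain rfl : w = 0 := by
      by_contra hw
      exact hslice hw hc hc0 hkc'
    have hcu : c = algebraMap k _ (c.coeff 0) := by
      ext g
      by_cases hg : g = 0
      · simp [hg]
      · rw [mem_supported'.1 hc g]
        · simp [Ne.symm hg]
        · rintro ⟨h1, h2, h3, h4⟩
          apply hg
          have h5 : (s : ℤ) * g.2.1 = 0 := by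
            have : 0 ≤ (s : ℤ) * g.2.1 := by positivity
            have : 0 ≤ (r : ℤ) * g.2.2 := by positivity
            omega
          have h6 : (r : ℤ) * g.2.2 = 0 := by omega
          refine Prod.ext h1 (Prod.ext ((mul_eq_zero.1 h5).resolve_left (by omega))
            ((mul_eq_zero.1 h6).resolve_left (by omega)))
    have hE' : D^[n] h = (c.coeff 0) • zhat k m r s ^ N := by
      rw [hE, pow_zero, one_mul, mul_comm, Algebra.smul_def, ← hcu]
    refine ⟨N, c.coeff 0, fun h0 => hc0 (by rw [hcu, h0, map_zero]), hE', ?_⟩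
    refine eq_of_mem_supported hn.1 (iterate_logDer_mem hθ hγ n) ?_
    rw [hE']
    exact Submodule.smul_mem _ _ (zhat_pow_mem_supported N)
  obtain ⟨⟨e₁, e₂⟩, rfl⟩ : ∃ p : ℤ × ℤ, toLex p = e := ⟨ofLex e, rfl⟩
  have hm0 : (m : ℤ) ≠ 0 := by positivity
  have hM : e₁ * (r * s) - e₂ * m ≠ 0 := by
    intro hM
    obtain ⟨n, hn⟩ := Derivation.exists_hasDeg hx (tx_ne_zero k)
    obtain ⟨N, u, -, -, h⟩ := key (γ := toLex (-1, 0))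
      (single_mem_supported (by simp [octant]) 1)
      (single_mem_supported (by simp [bideg_eq_iff]) 1) hn
    rw [nsmul_toLex, ← toLex_add, EmbeddingLike.apply_eq_iff_eq, Prod.mk_add_mk,
      Prod.mk.injEq] at h
    apply hrs0
    linear_combination (-(r * s : ℤ)) * h.1 + (m : ℤ) * h.2 + n * hM
  have key2 {h : Torus k} (hs : h ∈ supported k k (slice r s (r * s))) {n : ℕ}
      (hn : D.HasDeg h n) : ∃ (N : ℕ) (u : k), u ≠ 0 ∧ D^[n] h = u • zhat k m r s ^ N ∧
        n * (e₁ * (r * s) - e₂ * m) = r * s * m ∧ n * e₁ = N * m := by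
    obtain ⟨N, u, hu, h1, h2⟩ := key (γ := toLex (0, (r * s : ℤ)))
      (supported_mono (slice_subset_octant r s _) hs)
      (supported_mono (fun g hg => bideg_eq_iff.2 ⟨by rw [hg.1, neg_zero], hg.2.2.2⟩) hs) hn
    rw [nsmul_toLex, ← toLex_add, EmbeddingLike.apply_eq_iff_eq, Prod.mk_add_mk,
      Prod.mk.injEq] at h2
    refine ⟨N, u, hu, h1, ?_, by linear_combination h2.1⟩
    linear_combination (r * s : ℤ) * h2.1 - (m : ℤ) * h2.2
  have hyt (u v : k) : u • ty k ^ r + v • tt k ^ s ∈ D.nilSubalgebra :=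
    add_mem (Subalgebra.smul_mem _ (pow_mem hy _) _) (Subalgebra.smul_mem _ (pow_mem ht _) _)
  have huniq {n n' : ℕ} (h : n * (e₁ * (r * s) - e₂ * m) = r * s * m)
      (h' : n' * (e₁ * (r * s) - e₂ * m) = r * s * m) : n = n' := by
    have := mul_right_cancel₀ hM (h.trans h'.symm)
    exact_mod_cast this
  have hY := ytPow_mem_slice k r s 1 0
  have hT := ytPow_mem_slice k r s 0 1
  rw [one_smul, zero_smul, add_zero] at hY
  rw [one_smul, zero_smul, zero_add] at hT
  obtain ⟨n, hn⟩ := Derivation.exists_hasDeg (pow_mem hy r) (pow_ne_zero r (ty_ne_zero k))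
  obtain ⟨n', hn'⟩ := Derivation.exists_hasDeg (pow_mem ht s) (pow_ne_zero s (tt_ne_zero k))
  obtain ⟨N, u, hu, h1, h2, h3⟩ := key2 hY hn
  obtain ⟨N', v, hv, h1', h2', h3'⟩ := key2 hT hn'
  obtain rfl := huniq h2 h2'
  obtain rfl : N = N' := by
    have := mul_right_cancel₀ hm0 (h3.symm.trans h3')
    exact_mod_cast this
  obtain ⟨l, hl⟩ := Derivation.exists_hasDeg (hyt v (-u)) (ytPow_ne_zero k (by omega) hv)
  obtain ⟨_, _, _, _, h2'', _⟩ := key2 (ytPow_mem_slice k r s v (-u)) hl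
  obtain rfl := huniq h2 h2''
  apply hl.1
  have hsm (c : k) (f : Torus k) : D^[n] (c • f) = c • D^[n] f := by
    rw [← D.coeFn_coe, ← Module.End.coe_pow, map_smul]
  rw [iterate_map_add, hsm, hsm, h1, h1', smul_smul, smul_smul, ← add_smul]
  simp [mul_comm]

variable (k : Type*) [Field k]

/-- The subalgebra `k[x,y,t]` of the Laurent polynomial ring. -/
def octAlg : Subalgebra k (Torus k) where
  carrier := supported k k octant
  mul_mem' := mul_mem_supported (s := octant) (t := octant) (u := octant) fun _ ha _ hb =>
    ⟨add_nonneg ha.1 hb.1, add_nonneg ha.2.1 hb.2.1, add_nonneg ha.2.2 hb.2.2⟩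
  add_mem' := add_mem
  algebraMap_mem' c := by
    rw [Algebra.algebraMap_eq_smul_one]
    exact Submodule.smul_mem _ _ (single_mem_supported (by simp [octant]) 1)

variable {k}

theorem mem_octAlg {f : Torus k} : f ∈ octAlg k ↔ f ∈ supported k k octant := Iff.rfl

theorem tx_mem_octAlg : tx k ∈ octAlg k := single_mem_supported (by simp [octant]) _
theorem ty_mem_octAlg : ty k ∈ octAlg k := single_mem_supported (by simp [octant]) _
theorem tt_mem_octAlg : tt k ∈ octAlg k := single_mem_supported (by simp [octant]) _

/-- The function `y^r + t^s + x q(x)`. -/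
noncomputable def tF (r s : ℕ) (q : Polynomial k) : Torus k :=
  ty k ^ r + tt k ^ s + tx k * Polynomial.aeval (tx k) q

/-- The function `z = (y^r + t^s + x q(x)) / x^m`. -/
noncomputable def tz (m r s : ℕ) (q : Polynomial k) : Torus k := txi k ^ m * tF r s q

variable {m r s : ℕ} {q : Polynomial k}

theorem aeval_tx_mem_octAlg : Polynomial.aeval (tx k) q ∈ octAlg k := by
  rw [Polynomial.aeval_eq_sum_range]
  exact sum_mem fun i _ => Subalgebra.smul_mem _ (pow_mem tx_mem_octAlg i) _

theorem tF_mem_octAlg : tF r s q ∈ octAlg k :=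
  add_mem (add_mem (pow_mem ty_mem_octAlg _) (pow_mem tt_mem_octAlg _))
    (mul_mem tx_mem_octAlg aeval_tx_mem_octAlg)

theorem tx_pow_mul_tz : tx k ^ m * tz m r s q = tF r s q := by
  rw [tz, ← mul_assoc, ← mul_pow, tx_mul_txi, one_pow, one_mul]

theorem lead_tz : Lead (bideg r s) (tz m r s q) (toLex ((m : ℤ), (r * s : ℤ))) (zhat k m r s) := by
  have h : Lead (bideg r s) (txi k ^ m * (tx k * Polynomial.aeval (tx k) q))
      (toLex ((m : ℤ), (r * s : ℤ))) 0 := by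
    refine Lead.of_lt ?_
    refine mul_mem_supported (s := {(-(m : ℤ), 0, 0)}) (t := {g | 1 ≤ g.1}) (fun a ha b hb => ?_)
      ?_ (mul_mem_supported (s := {(1, 0, 0)}) (t := octant) (fun a ha b hb => ?_)
        (single_mem_supported (k := k) (Set.mem_singleton ((1, 0, 0) : ℤ × ℤ × ℤ)) 1)
          aeval_tx_mem_octAlg)
    · rw [Set.mem_singleton_iff.1 ha]
      simp only [Set.mem_ofPred_eq] at hb ⊢
      rw [bideg_lt_iff]
      left
      simp only [Prod.fst_add]
      omega
    · rw [txi_pow]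
      exact single_mem_supported (k := k) (Set.mem_singleton (-(m : ℤ), (0 : ℤ), (0 : ℤ))) 1
    · rw [Set.mem_singleton_iff.1 ha]
      have := hb.1
      simp only [Set.mem_ofPred_eq, Prod.fst_add]
      omega
  have := (Lead.self (zhat_mem_supported (k := k) (m := m) (r := r) (s := s))).add h
  rwa [add_zero, zhat, ← mul_add] at this

variable (m r s q)

/-- The subalgebra `k[x,y,z,t]` of the Laurent polynomial ring. -/
noncomputable def krSub : Subalgebra k (Torus k) :=
  (aeval ![tx k, ty k, tz m r s q, tt k] : MvPolynomial (Fin 4) k →ₐ[k] Torus k).range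

/-- Elements which are polynomials of degree at most `N` in `z`. -/
def Filt : ℕ → Torus k → Prop
  | 0, b => b ∈ octAlg k
  | N + 1, b => ∃ p ∈ octAlg k, ∃ b', Filt N b' ∧ b = p * tz m r s q ^ (N + 1) + b'

variable {m r s q}

theorem Filt.succ {N : ℕ} {b : Torus k} (h : Filt m r s q N b) : Filt m r s q (N + 1) b :=
  ⟨0, zero_mem _, b, h, by simp⟩

theorem Filt.mono {N M : ℕ} {b : Torus k} (h : Filt m r s q N b) (hNM : N ≤ M) :
    Filt m r s q M b := by
  induction hNM with
  | refl => exact h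
  | step _ ih => exact ih.succ

theorem Filt.add {N : ℕ} {b c : Torus k} (hb : Filt m r s q N b) (hc : Filt m r s q N c) :
    Filt m r s q N (b + c) := by
  induction N generalizing b c with
  | zero => exact add_mem (S := Subalgebra k (Torus k)) hb hc
  | succ N ih =>
    obtain ⟨p, hp, b', hb', rfl⟩ := hb
    obtain ⟨p', hp', c', hc', rfl⟩ := hc
    exact ⟨p + p', add_mem hp hp', b' + c', ih hb' hc', by ring⟩

theorem Filt.octAlg_mul {N : ℕ} {b o : Torus k} (hb : Filt m r s q N b) (ho : o ∈ octAlg k) :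
    Filt m r s q N (o * b) := by
  induction N generalizing b with
  | zero => exact mul_mem (S := Subalgebra k (Torus k)) ho hb
  | succ N ih =>
    obtain ⟨p, hp, b', hb', rfl⟩ := hb
    exact ⟨o * p, mul_mem ho hp, o * b', ih hb', by ring⟩

theorem Filt.tz_mul {N : ℕ} {b : Torus k} (hb : Filt m r s q N b) :
    Filt m r s q (N + 1) (tz m r s q * b) := by
  induction N generalizing b with
  | zero => exact ⟨b, hb, 0, zero_mem (octAlg k), by ring⟩
  | succ N ih =>
    obtain ⟨p, hp, b', hb', rfl⟩ := hb
    exact ⟨p, hp, _, ih hb', by ring⟩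

theorem filt_mul_pow {o : Torus k} (ho : o ∈ octAlg k) (N : ℕ) :
    Filt m r s q N (o * tz m r s q ^ N) := by
  induction N with
  | zero => simpa [Filt] using ho
  | succ N ih =>
    rw [pow_succ', mul_left_comm]
    exact ih.tz_mul

theorem Filt.mem_supported {N : ℕ} {b : Torus k} (hb : Filt m r s q N b) :
    b ∈ supported k k {g : ℤ × ℤ × ℤ | -g.1 ≤ N * m} := by
  induction N generalizing b with
  | zero =>
    refine supported_mono (s := octant) (fun g hg => ?_) hb
    have := hg.1
    simpa using this
  | succ N ih =>
    obtain ⟨p, hp, b', hb', rfl⟩ := hb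
    refine add_mem (mul_mem_supported (s := octant)
      (t := {g | -g.1 ≤ ((N + 1 : ℕ) : ℤ) * m}) (fun a ha b hb => ?_) hp ?_)
      (supported_mono (fun g hg => ?_) (ih hb'))
    · have := ha.1
      simp only [Set.mem_ofPred_eq, Prod.fst_add] at hb ⊢
      omega
    · refine supported_mono (fun g hg => ?_) (lead_tz.pow (N + 1)).mem_le
      simp only [Set.mem_ofPred_eq, nsmul_toLex] at hg ⊢
      rw [le_iff_lt_or_eq, bideg_lt_iff, bideg_eq_iff] at hg
      omega
    · simp only [Set.mem_ofPred_eq] at hg ⊢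
      push_cast
      nlinarith

theorem exists_filt {b : Torus k} (hb : b ∈ krSub m r s q) : ∃ N, Filt m r s q N b := by
  obtain ⟨p, rfl⟩ := hb
  simp only [AlgHom.toRingHom_eq_coe, RingHom.coe_coe]
  induction p using MvPolynomial.induction_on with
  | C c => exact ⟨0, by rw [aeval_C]; exact algebraMap_mem (octAlg k) c⟩
  | add p p' hp hp' =>
    obtain ⟨N, hN⟩ := hp
    obtain ⟨M, hM⟩ := hp'
    exact ⟨max N M, by
      rw [map_add]
      exact (hN.mono (le_max_left _ _)).add (hM.mono (le_max_right _ _))⟩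
  | mul_X p i hp =>
    obtain ⟨N, hN⟩ := hp
    rw [map_mul, aeval_X, mul_comm]
    fin_cases i
    · exact ⟨N, hN.octAlg_mul tx_mem_octAlg⟩
    · exact ⟨N, hN.octAlg_mul ty_mem_octAlg⟩
    · exact ⟨N + 1, hN.tz_mul⟩
    · exact ⟨N, hN.octAlg_mul tt_mem_octAlg⟩

theorem exists_split {S : Set (ℤ × ℤ × ℤ)} (P : ℤ × ℤ × ℤ → Prop) {f : Torus k}
    (hf : f ∈ supported k k S) : ∃ f₁ ∈ supported k k {g | g ∈ S ∧ P g},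
      ∃ f₂ ∈ supported k k {g | g ∈ S ∧ ¬P g}, f = f₁ + f₂ := by
  refine supported_induction (p := fun f => ∃ f₁ ∈ supported k k {g | g ∈ S ∧ P g},
      ∃ f₂ ∈ supported k k {g | g ∈ S ∧ ¬P g}, f = f₁ + f₂) ⟨0, zero_mem _, 0, zero_mem _, by simp⟩
      ?_ (fun g hg c => ?_) hf
  · rintro _ _ ⟨f₁, h₁, f₂, h₂, rfl⟩ ⟨g₁, h₁', g₂, h₂', rfl⟩
    exact ⟨_, add_mem h₁ h₁', _, add_mem h₂ h₂', by ring⟩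
  · by_cases hP : P g
    · exact ⟨single g c, single_mem_supported (s := {g | g ∈ S ∧ P g}) ⟨hg, hP⟩ c, 0, zero_mem _,
        by simp⟩
    · exact ⟨0, zero_mem _, single g c, single_mem_supported (s := {g | g ∈ S ∧ ¬P g}) ⟨hg, hP⟩ c,
        by simp⟩

theorem Filt.normalForm {N : ℕ} {b : Torus k} (hb : Filt m r s q N b) :
    b ∈ octAlg k ∨ ∃ (M : ℕ) (p b' : Torus k), p ≠ 0 ∧
      p ∈ supported k k {g | g ∈ octant ∧ g.1 < m} ∧ Filt m r s q M b' ∧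
      b = p * tz m r s q ^ (M + 1) + b' := by
  induction N generalizing b with
  | zero => exact Or.inl hb
  | succ N ih =>
    obtain ⟨p, hp, b', hb', rfl⟩ := hb
    obtain ⟨p₁, hp₁, p₂, hp₂, rfl⟩ := exists_split (fun g => g.1 < m) (mem_octAlg.1 hp)
    obtain ⟨p', hp', rfl⟩ := exists_eq_mul_of_supported (S' := octant) ((m : ℤ), 0, 0)
      (fun g hg => by
        obtain ⟨⟨h1, h2, h3⟩, h4⟩ := hg
        simp only [octant, Set.mem_ofPred_eq, Prod.fst_sub, Prod.snd_sub, sub_zero]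
        omega) hp₂
    have hF : Filt m r s q N (single ((m : ℤ), 0, 0) 1 * p' * tz m r s q ^ (N + 1) + b') := by
      rw [← tx_pow, show tx k ^ m * p' * tz m r s q ^ (N + 1) =
        p' * (tx k ^ m * tz m r s q) * tz m r s q ^ N by ring, tx_pow_mul_tz]
      exact (filt_mul_pow (mul_mem (mem_octAlg.2 hp') tF_mem_octAlg) N).add hb'
    by_cases h0 : p₁ = 0
    · subst h0
      rw [zero_add]
      exact ih hF
    · exact Or.inr ⟨N, p₁, _, h0, hp₁, hF, by ring⟩

theorem exists_lead_of_octAlg {p : Torus k} (hp0 : p ≠ 0) {S : Set (ℤ × ℤ × ℤ)} (hS : S ⊆ octant)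
    (hp : p ∈ supported k k S) : ∃ (i : ℕ) (w : ℤ) (c : Torus k), c ≠ 0 ∧
      c ∈ supported k k (slice r s w) ∧ (∃ g ∈ S, g.1 = i) ∧
      Lead (bideg r s) p (toLex (-(i : ℤ), w)) (tx k ^ i * c) := by
  obtain ⟨γ, h1, h2⟩ := exists_lead (bideg r s) hp0
  have h3 := comp_mem_supported (deg := bideg r s) (γ := γ) hp
  obtain ⟨g, hg⟩ : ∃ g, (comp (bideg r s) γ p).coeff g ≠ 0 := by
    by_contra! h
    exact h2 (by ext g; simpa using h g)
  obtain ⟨hgS, hgγ⟩ : g ∈ S ∧ bideg r s g = γ := by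
    by_contra h
    exact hg (mem_supported'.1 h3 g h)
  obtain ⟨i, hi⟩ := Int.eq_ofNat_of_zero_le (hS hgS).1
  obtain ⟨w, rfl⟩ : ∃ w, γ = toLex (-(i : ℤ), w) :=
    ⟨_, by rw [← hgγ, bideg_eq_iff, hi]; exact ⟨rfl, rfl⟩⟩
  obtain ⟨c, hc, hE⟩ := exists_eq_mul_of_supported (S' := slice r s w) ((i : ℤ), 0, 0)
    (fun g hg => by
      obtain ⟨h4, h5⟩ := hg
      have h6 := hS h4
      rw [Set.mem_ofPred_eq, bideg_eq_iff] at h5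
      simp only [slice, octant, Set.mem_ofPred_eq, Prod.fst_sub, Prod.snd_sub, sub_zero] at h6 ⊢
      omega) h3
  rw [← tx_pow] at hE
  refine ⟨i, w, c, ?_, hc, ⟨g, hgS, hi⟩, hE ▸ lead_comp h1⟩
  rintro rfl
  exact h2 (by rw [hE, mul_zero])

theorem lead_normalForm {M i : ℕ} {w : ℤ} {p c b' : Torus k} (hi : i < m)
    (hL : Lead (bideg r s) p (toLex (-(i : ℤ), w)) (tx k ^ i * c)) (hb' : Filt m r s q M b') :
    Lead (bideg r s) (p * tz m r s q ^ (M + 1) + b')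
      (toLex ((M + 1) * m - i, w + (M + 1) * (r * s)))
        (zhat k m r s ^ (M + 1) * (tx k ^ i * c)) := by
  rw [mul_comm (zhat k m r s ^ _), ← add_zero (_ * zhat k m r s ^ _)]
  have h := hL.mul (lead_tz (q := q) (m := m) |>.pow (M + 1))
  rw [nsmul_toLex, ← toLex_add, Prod.mk_add_mk] at h
  push_cast at h
  rw [neg_add_eq_sub] at h
  refine h.add (Lead.of_lt (supported_mono (fun g hg => ?_) hb'.mem_supported))
  simp only [Set.mem_ofPred_eq] at hg ⊢
  rw [bideg_lt_iff]
  left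
  nlinarith

/-- Leading forms of elements of `k[x,y,z,t]`. -/
theorem exists_lead_of_mem {b : Torus k} (hb : b ∈ krSub m r s q) (hb0 : b ≠ 0) :
    ∃ (N i : ℕ) (w : ℤ) (c : Torus k) (γ : ℤ ×ₗ ℤ), c ≠ 0 ∧ c ∈ supported k k (slice r s w) ∧
      Lead (bideg r s) b γ (zhat k m r s ^ N * (tx k ^ i * c)) ∧ (b ∈ octAlg k ∨ N ≠ 0) := by
  obtain ⟨N, hN⟩ := exists_filt hb
  rcases hN.normalForm with h | ⟨M, p, b', hp0, hp, hb', rfl⟩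
  · obtain ⟨i, w, c, hc0, hc, -, hL⟩ := exists_lead_of_octAlg (r := r) (s := s) hb0 subset_rfl h
    exact ⟨0, i, w, c, _, hc0, hc, by rwa [pow_zero, one_mul], Or.inl h⟩
  · obtain ⟨i, w, c, hc0, hc, ⟨g, ⟨-, hi⟩, hgi⟩, hL⟩ :=
      exists_lead_of_octAlg (r := r) (s := s) hp0 (fun g hg => hg.1) hp
    exact ⟨M + 1, i, w, c, _, hc0, hc, lead_normalForm (by omega) hL hb', Or.inr (by omega)⟩

/-- If `x^m b` is a polynomial in `x, y, t` then `b` has degree at most one in `z`. -/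
theorem exists_of_tx_pow_mul_mem {b : Torus k} (hr : r ≠ 0) (hb : b ∈ krSub m r s q)
    (h : tx k ^ m * b ∈ octAlg k) :
    ∃ p ∈ octAlg k, ∃ b' ∈ octAlg k, b = p * tz m r s q + b' := by
  obtain ⟨N, hN⟩ := exists_filt hb
  rcases hN.normalForm with h' | ⟨M, p, b', hp0, hp, hb', hE⟩
  · exact ⟨0, zero_mem _, b, h', by simp⟩
  obtain rfl : M = 0 := by
    obtain ⟨i, w, c, hc0, hc, ⟨g, ⟨-, hi⟩, hgi⟩, hL⟩ :=
      exists_lead_of_octAlg (r := r) (s := s) hp0 (fun g hg => hg.1) hp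
    have h1 := lead_normalForm (by omega) hL hb'
    rw [← hE] at h1
    have hx : Lead (bideg r s) (tx k ^ m) (toLex (-(m : ℤ), 0)) (tx k ^ m) := by
      rw [tx_pow]
      exact Lead.self (single_mem_supported (by simp [bideg_eq_iff]) 1)
    have hu : zhat k m r s ^ (M + 1) * (tx k ^ i * c) ≠ 0 :=
      mul_ne_zero (pow_ne_zero _ (zhat_ne_zero m hr s))
        (mul_ne_zero (pow_ne_zero _ (tx_ne_zero k)) hc0)
    have hb0 : tx k ^ m * b ≠ 0 := by
      refine mul_ne_zero (pow_ne_zero _ (tx_ne_zero k)) ?_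
      rintro rfl
      exact hu ((Lead.of_lt (zero_mem _)).eq_of_eq h1).symm
    obtain ⟨j, w', c', hc0', -, -, hL'⟩ :=
      exists_lead_of_octAlg (r := r) (s := s) hb0 subset_rfl h
    have := (hL'.unique (hx.mul h1) (mul_ne_zero (pow_ne_zero _ (tx_ne_zero k)) hc0')
      (mul_ne_zero (pow_ne_zero _ (tx_ne_zero k)) hu)).1
    rw [← toLex_add, EmbeddingLike.apply_eq_iff_eq, Prod.mk_add_mk, Prod.mk.injEq] at this
    have h2 : (M : ℤ) * m < 1 * m := by linarith [this.1]
    have h3 := lt_of_mul_lt_mul_right h2 (by positivity)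
    omega
  exact ⟨p, mem_octAlg.2 (supported_mono (fun g hg => hg.1) hp), b', hb', by simpa using hE⟩

variable {k : Type*} [Field k] {θ : ℤ × ℤ × ℤ →+ Torus k} {m r s : ℕ} {q : Polynomial k}

theorem map_eq_combination (θ : ℤ × ℤ × ℤ →+ Torus k) (g : ℤ × ℤ × ℤ) :
    θ g = g.1 • θ (1, 0, 0) + g.2.1 • θ (0, 1, 0) + g.2.2 • θ (0, 0, 1) := by
  rw [← map_zsmul, ← map_zsmul, ← map_zsmul, ← map_add, ← map_add]
  simp

theorem exists_max_degree (hθ : θ ≠ 0) (r s : ℕ) : ∃ e : ℤ ×ₗ ℤ,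
    (∀ a, θ a ∈ supported k k {g | bideg r s g ≤ e}) ∧ ∃ a, comp (bideg r s) e (θ a) ≠ 0 := by
  classical
  let U : Finset (ℤ × ℤ × ℤ) := (θ (1, 0, 0)).coeff.support ∪
    ((θ (0, 1, 0)).coeff.support ∪ (θ (0, 0, 1)).coeff.support)
  have hU : U.Nonempty := by
    by_contra h
    rw [Finset.not_nonempty_iff_eq_empty, Finset.union_eq_empty, Finset.union_eq_empty] at h
    simp only [Finsupp.support_eq_empty, coeff_eq_zero] at h
    refine hθ (AddMonoidHom.ext fun g => ?_)
    rw [map_eq_combination, h.1, h.2.1, h.2.2]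
    simp
  obtain ⟨g, hg, hmax⟩ := U.exists_max_image (bideg r s) hU
  have hsup (f : Torus k) (hf : f.coeff.support ⊆ U) :
      f ∈ supported k k {a | bideg r s a ≤ bideg r s g} := fun a ha => hmax a (hf ha)
  refine ⟨bideg r s g, fun a => ?_, ?_⟩
  · rw [map_eq_combination]
    refine add_mem (add_mem (zsmul_mem (hsup _ ?_) _) (zsmul_mem (hsup _ ?_) _))
      (zsmul_mem (hsup _ ?_) _)
    · exact Finset.subset_union_left
    · exact Finset.subset_union_left.trans Finset.subset_union_right
    · exact Finset.subset_union_right.trans Finset.subset_union_right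
  · have hex : ∃ a, g ∈ (θ a).coeff.support := by
      simp only [U, Finset.mem_union] at hg
      rcases hg with h | h | h <;> exact ⟨_, h⟩
    obtain ⟨a, ha⟩ := hex
    refine ⟨a, fun h => Finsupp.mem_support_iff.1 ha ?_⟩
    have := congrArg (fun f : Torus k => f.coeff g) h
    simpa [coeff_comp] using this

theorem octAlg_le_krSub : octAlg k ≤ krSub m r s q := by
  have hX (i : Fin 4) : ![tx k, ty k, tz m r s q, tt k] i ∈ krSub m r s q :=
    ⟨X i, by simp⟩
  intro f hf
  exact octant_induction k (hX 0) (hX 1) (hX 3) hf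

theorem lead_single (g : ℤ × ℤ × ℤ) :
    Lead (bideg r s) (single g 1 : Torus k) (bideg r s g) (single g 1) :=
  Lead.self (single_mem_supported (s := {a | bideg r s a = bideg r s g}) rfl 1)

theorem tz_mem_krSub : tz m r s q ∈ krSub m r s q := ⟨X 2, by simp⟩

/-- The kernel of a nonzero locally nilpotent derivation of `k[x,y,z,t]` lies in `k[x,y,t]`. -/
theorem mem_octAlg_of_map_eq_zero [CharZero k] (hm : 2 ≤ m) (hr : 2 ≤ r) (hs : 2 ≤ s)
    (hrs : r.Coprime s) (hθ : θ ≠ 0) (hpres : ∀ b ∈ krSub m r s q, logDer θ b ∈ krSub m r s q)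
    (hnil : ∀ b ∈ krSub m r s q, b ∈ (logDer θ).nilSubalgebra) {f : Torus k}
    (hf : f ∈ krSub m r s q) (h0 : logDer θ f = 0) : f ∈ octAlg k := by
  have := torus_charZero k
  obtain ⟨e, he, a, ha⟩ := exists_max_degree hθ r s
  set θ' := (comp (bideg r s) e).comp θ with hθ'
  have hL : ∀ a, Lead (bideg r s) (θ a) e (θ' a) := fun a => lead_comp (he a)
  have hθ'0 : θ' ≠ 0 := fun h => ha (DFunLike.congr_fun h a)
  have hpresn (n : ℕ) {b : Torus k} (hb : b ∈ krSub m r s q) :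
      (logDer θ)^[n] b ∈ krSub m r s q := by
    induction n with
    | zero => exact hb
    | succ n ih => rw [Function.iterate_succ_apply']; exact hpres _ ih
  have hnil' {b u : Torus k} {γ : ℤ ×ₗ ℤ} (hb : b ∈ krSub m r s q)
      (hbu : Lead (bideg r s) b γ u) : u ∈ (logDer θ').nilSubalgebra := by
    obtain ⟨n, hn⟩ := hnil b hb
    have := hbu.iterate_logDer hL n
    rw [hn] at this
    exact ⟨n, ((Lead.of_lt (zero_mem _)).eq_of_eq this).symm⟩
  have hx : tx k ∈ (logDer θ').nilSubalgebra :=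
    hnil' (octAlg_le_krSub tx_mem_octAlg) (lead_single (1, 0, 0))
  have hy : ty k ∈ (logDer θ').nilSubalgebra :=
    hnil' (octAlg_le_krSub ty_mem_octAlg) (lead_single (0, 1, 0))
  have ht : tt k ∈ (logDer θ').nilSubalgebra :=
    hnil' (octAlg_le_krSub tt_mem_octAlg) (lead_single (0, 0, 1))
  have hz : zhat k m r s ∈ (logDer θ').nilSubalgebra := hnil' tz_mem_krSub lead_tz
  by_contra hfo
  have hf0 : f ≠ 0 := fun h => hfo (h ▸ zero_mem _)
  obtain ⟨N, i, w, c, γ, hc0, hc, hlead, hN⟩ := exists_lead_of_mem hf hf0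
  have hN := hN.resolve_left hfo
  have hcn : c ∈ (logDer θ').nilSubalgebra :=
    mem_nil_of_octant hx hy ht (supported_mono (slice_subset_octant r s w) hc)
  have hz0 : logDer θ' (zhat k m r s) = 0 := by
    have h1 := hlead.logDer hL
    rw [h0] at h1
    have h2 := ((Lead.of_lt (zero_mem _)).eq_of_eq h1).symm
    exact Derivation.map_eq_zero_of_pow hz hN (Derivation.map_eq_zero_of_mul (pow_mem hz N)
      (mul_mem (pow_mem hx i) hcn) (mul_ne_zero (pow_ne_zero _ (zhat_ne_zero m (by omega) s))
        (mul_ne_zero (pow_ne_zero _ (tx_ne_zero k)) hc0)) h2).1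
  refine no_homogeneous_derivation hm hr hs hrs (fun a => (hL a).1) hθ'0 hx hy ht hz0 ?_
  intro h hh γ hγ n hn
  have h1 := (Lead.self hγ).iterate_logDer hL n
  have h2 : (logDer θ)^[n] h ≠ 0 := fun h3 => hn
    ((Lead.of_lt (zero_mem _)).eq_of_eq (h3 ▸ h1)).symm
  obtain ⟨N, i, w, c, δ, hc0, hc, hlead, -⟩ :=
    exists_lead_of_mem (hpresn n (octAlg_le_krSub (mem_octAlg.2 hh))) h2
  exact ⟨N, i, w, c, hc0, hc, (h1.unique hlead hn (mul_ne_zero (pow_ne_zero _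
    (zhat_ne_zero m (by omega) s)) (mul_ne_zero (pow_ne_zero _ (tx_ne_zero k)) hc0))).2⟩

section Evaluation

variable (k : Type*) [Field k]

/-- The embedding of the polynomial ring in `x, y, t` into the Laurent polynomial ring. -/
noncomputable def evalS : MvPolynomial (Fin 3) k →ₐ[k] Torus k := aeval ![tx k, ty k, tt k]

@[simp] theorem evalS_X0 : evalS k (X 0) = tx k := by simp [evalS]
@[simp] theorem evalS_X1 : evalS k (X 1) = ty k := by simp [evalS]
@[simp] theorem evalS_X2 : evalS k (X 2) = tt k := by simp [evalS]

theorem coeff_evalS (p : MvPolynomial (Fin 3) k) (d : Fin 3 →₀ ℕ) :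
    (evalS k p).coeff ((d 0 : ℤ), (d 1 : ℤ), (d 2 : ℤ)) = p.coeff d := by
  classical
  induction p using MvPolynomial.induction_on' with
  | add p q hp hq =>
      rw [map_add, AddMonoidAlgebra.coeff_add, MvPolynomial.coeff_add, Finsupp.add_apply, hp, hq]
  | monomial u a =>
    have : evalS k (monomial u a) = single ((u 0 : ℤ), (u 1 : ℤ), (u 2 : ℤ)) a := by
      rw [evalS, aeval_monomial, Finsupp.prod_fintype _ _ (fun i => pow_zero _),
        Fin.prod_univ_three,
        single_eq_smul, Algebra.smul_def]
      rfl
    rw [this, coeff_single, coeff_monomial, Finsupp.single_apply]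
    congr 1
    simp only [Prod.mk.injEq, Nat.cast_inj, eq_iff_iff]
    constructor
    · rintro ⟨h0, h1, h2⟩
      ext i
      fin_cases i <;> assumption
    · rintro rfl
      exact ⟨rfl, rfl, rfl⟩

theorem evalS_injective : Function.Injective (evalS k) := by
  intro p q h
  ext d
  rw [← coeff_evalS, ← coeff_evalS, h]

theorem evalS_range : (evalS k).range = octAlg k := by
  refine le_antisymm ?_ fun f hf => octant_induction k (A := (evalS k).range) ⟨X 0, evalS_X0 k⟩
    ⟨X 1, evalS_X1 k⟩ ⟨X 2, evalS_X2 k⟩ hf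
  rw [evalS, ← Algebra.adjoin_range_eq_range_aeval, Algebra.adjoin_le_iff]
  rintro _ ⟨i, rfl⟩
  fin_cases i
  exacts [tx_mem_octAlg, ty_mem_octAlg, tt_mem_octAlg]

theorem evalS_mem (p : MvPolynomial (Fin 3) k) : evalS k p ∈ octAlg k :=
  evalS_range k ▸ (evalS k).mem_range_self p

end Evaluation

variable (k : Type) [Field k] (m r s : ℕ) (q : Polynomial k)

/-- Evaluation of polynomials in `x, y, z, t` in the Laurent polynomial ring. -/
noncomputable def evalKr : MvPolynomial (Fin 4) k →ₐ[k] Torus k :=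
  aeval ![tx k, ty k, tz m r s q, tt k]

@[simp] theorem evalKr_X0 : evalKr k m r s q (X 0) = tx k := by simp [evalKr]
@[simp] theorem evalKr_X1 : evalKr k m r s q (X 1) = ty k := by simp [evalKr]
@[simp] theorem evalKr_X2 : evalKr k m r s q (X 2) = tz m r s q := by simp [evalKr]
@[simp] theorem evalKr_X3 : evalKr k m r s q (X 3) = tt k := by simp [evalKr]

theorem evalKr_krRel : evalKr k m r s q (krRel k m r s q) = 0 := by
  simp only [krRel, map_sub, map_mul, map_pow, evalKr_X0, evalKr_X1, evalKr_X2, evalKr_X3,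
    ← Polynomial.aeval_algHom_apply, tx_pow_mul_tz, tF]
  ring

/-- The embedding of the coordinate ring into the Laurent polynomial ring. -/
noncomputable def krEmb : krAlg k m r s q →ₐ[k] Torus k :=
  Ideal.Quotient.liftₐ _ (evalKr k m r s q) fun a ha => by
    obtain ⟨b, rfl⟩ := Ideal.mem_span_singleton'.1 ha
    rw [map_mul, evalKr_krRel, mul_zero]

@[simp] theorem krEmb_mk (p : MvPolynomial (Fin 4) k) :
    krEmb k m r s q (Ideal.Quotient.mk _ p) = evalKr k m r s q p := rfl

theorem krEmb_range : (krEmb k m r s q).range = krSub m r s q := by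
  ext f
  constructor
  · rintro ⟨a, rfl⟩
    obtain ⟨p, rfl⟩ := Ideal.Quotient.mk_surjective a
    exact ⟨p, rfl⟩
  · rintro ⟨p, rfl⟩
    exact ⟨Ideal.Quotient.mk _ p, rfl⟩

theorem krEmb_mem (a : krAlg k m r s q) : krEmb k m r s q a ∈ krSub m r s q :=
  krEmb_range k m r s q ▸ (krEmb k m r s q).mem_range_self a

/-- The inclusion of variables `x, y, t` into `x, y, z, t`. -/
noncomputable def incl : MvPolynomial (Fin 3) k →ₐ[k] MvPolynomial (Fin 4) k :=
  aeval ![X 0, X 1, X 3]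

theorem evalKr_incl (p : MvPolynomial (Fin 3) k) : evalKr k m r s q (incl k p) = evalS k p := by
  rw [← AlgHom.comp_apply]
  congr 1
  refine MvPolynomial.algHom_ext fun i => ?_
  fin_cases i <;> simp [incl]

theorem exists_incl (f : MvPolynomial (Fin 4) k) :
    ∃ (n : ℕ) (g : MvPolynomial (Fin 3) k),
      X 0 ^ n * f - incl k g ∈ Ideal.span {krRel k m r s q} := by
  induction f using MvPolynomial.induction_on with
  | C a => exact ⟨0, C a, by simp [incl, MvPolynomial.algebraMap_eq]⟩
  | add f f' hf hf' =>
    obtain ⟨n, g, h⟩ := hf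
    obtain ⟨n', g', h'⟩ := hf'
    refine ⟨n + n', X 0 ^ n' * g + X 0 ^ n * g', ?_⟩
    have e : X 0 ^ (n + n') * (f + f') - incl k (X 0 ^ n' * g + X 0 ^ n * g') =
        X 0 ^ n' * (X 0 ^ n * f - incl k g) + X 0 ^ n * (X 0 ^ n' * f' - incl k g') := by
      simp only [map_add, map_mul, map_pow, show incl k (X 0) = X 0 by simp [incl]]
      ring
    rw [e]
    exact add_mem (Ideal.mul_mem_left _ _ h) (Ideal.mul_mem_left _ _ h')
  | mul_X f i hf =>
    obtain ⟨n, g, h⟩ := hf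
    have aux (j : Fin 3) (hj : incl k (X j) = X i) : ∃ (n : ℕ) (g : MvPolynomial (Fin 3) k),
      X 0 ^ n * (f * X i) - incl k g ∈ Ideal.span {krRel k m r s q} := by
      refine ⟨n, g * X j, ?_⟩
      rw [map_mul, hj, ← mul_assoc, ← sub_mul]
      exact Ideal.mul_mem_right _ _ h
    have e0 : incl k (X 0) = X 0 := by simp [incl]
    have e1 : incl k (X 1) = X 1 := by simp [incl]
    have e2 : incl k (X 2) = X 3 := by simp [incl]
    fin_cases i
    · exact aux 0 e0
    · exact aux 1 e1
    · refine ⟨n + m, g * (X 1 ^ r + X 2 ^ s + X 0 * Polynomial.aeval (X 0) q), ?_⟩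
      have e : X 0 ^ (n + m) * (f * X 2) -
          incl k (g * (X 1 ^ r + X 2 ^ s + X 0 * Polynomial.aeval (X 0) q)) =
          (X 0 ^ n * f - incl k g) * (X 0 ^ m * X 2) + incl k g * krRel k m r s q := by
        simp only [map_add, map_mul, map_pow, e0, e1, e2, ← Polynomial.aeval_algHom_apply, krRel]
        ring
      change X 0 ^ (n + m) * (f * X 2) - _ ∈ _
      rw [e]
      exact add_mem (Ideal.mul_mem_right _ _ h)
        (Ideal.mul_mem_left _ _ (Ideal.mem_span_singleton_self _))
    · exact aux 2 e2

theorem mem_span_of_X_mul_mem (hm : m ≠ 0) (hs : s ≠ 0) {f : MvPolynomial (Fin 4) k}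
    (h : X 0 * f ∈ Ideal.span {krRel k m r s q}) : f ∈ Ideal.span {krRel k m r s q} := by
  obtain ⟨g, hg⟩ := Ideal.mem_span_singleton'.1 h
  have hX : Prime (X 0 : MvPolynomial (Fin 4) k) := X_prime
  rcases hX.dvd_or_dvd ⟨f, hg⟩ with ⟨g', rfl⟩ | ⟨g', hg'⟩
  · refine Ideal.mem_span_singleton'.2 ⟨g', mul_left_cancel₀ hX.ne_zero ?_⟩
    rw [← hg, mul_assoc]
  · exfalso
    have := congrArg (aeval (![0, 1, 0, 0] : Fin 4 → k)) hg'
    simp [krRel, hm, hs] at this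

theorem krEmb_injective (hm : m ≠ 0) (hs : s ≠ 0) :
    Function.Injective (krEmb k m r s q) := by
  rw [injective_iff_map_eq_zero]
  intro a ha
  obtain ⟨f, rfl⟩ := Ideal.Quotient.mk_surjective a
  rw [krEmb_mk] at ha
  obtain ⟨n, g, h⟩ := exists_incl k m r s q f
  have hg : g = 0 := by
    obtain ⟨b, hb⟩ := Ideal.mem_span_singleton'.1 h
    have := congrArg (evalKr k m r s q) hb
    rw [map_mul, evalKr_krRel, mul_zero, map_sub, map_mul, ha, mul_zero, evalKr_incl, zero_sub,
      zero_eq_neg] at this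
    exact (map_eq_zero_iff _ (evalS_injective k)).1 this
  rw [hg, map_zero, sub_zero] at h
  rw [Ideal.Quotient.eq_zero_iff_mem]
  clear hg ha
  induction n with
  | zero => simpa using h
  | succ n ih =>
    rw [pow_succ', mul_assoc] at h
    exact ih (mem_span_of_X_mul_mem k m r s q hm hs h)

section Locally

variable {k : Type} [Field k] {m r s : ℕ} {q q' : Polynomial k}

/-- The additive map with prescribed values on the standard basis of `ℤ³`. -/
def addHom {M : Type*} [AddCommGroup M] (u v w : M) : ℤ × ℤ × ℤ →+ M :=
  AddMonoidHom.mk' (fun g => g.1 • u + g.2.1 • v + g.2.2 • w) fun a b => by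
    simp only [Prod.fst_add, Prod.snd_add, add_smul]
    abel

theorem single_mul_single_neg_mul (g : ℤ × ℤ × ℤ) (f : Torus k) :
    single g (1 : k) * (single (-g) 1 * f) = f := by
  rw [← mul_assoc, single_mul_single, add_neg_cancel, mul_one, ← AddMonoidAlgebra.one_def, one_mul]

theorem exists_logDer_extending_of_generators {R : Type*} [CommRing R] [Algebra k R]
    (ι : R →ₐ[k] Torus k) {x y z t : R} (hx : ι x = tx k) (hy : ι y = ty k) (ht : ι t = tt k)
    (hrel : x ^ m * z = y ^ r + t ^ s + x * Polynomial.aeval x q)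
    (htop : Algebra.adjoin k {x, y, z, t} = ⊤) (D : Derivation k R R) :
    ∃ θ : ℤ × ℤ × ℤ →+ Torus k, ∀ a, logDer θ (ι a) = ι (D a) := by
  let θ := addHom (single (-(1, 0, 0)) 1 * ι (D x)) (single (-(0, 1, 0)) 1 * ι (D y))
    (single (-(0, 0, 1)) 1 * ι (D t))
  have h0 : logDer θ (tx k) = ι (D x) := by
    rw [tx, logDer_single]
    simp only [θ, addHom, AddMonoidHom.mk'_apply, one_smul, zero_smul, add_zero]
    exact single_mul_single_neg_mul _ _
  have h1 : logDer θ (ty k) = ι (D y) := by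
    rw [ty, logDer_single]
    simp only [θ, addHom, AddMonoidHom.mk'_apply, one_smul, zero_smul, add_zero, zero_add]
    exact single_mul_single_neg_mul _ _
  have h3 : logDer θ (tt k) = ι (D t) := by
    rw [tt, logDer_single]
    simp only [θ, addHom, AddMonoidHom.mk'_apply, one_smul, zero_smul, add_zero, zero_add]
    exact single_mul_single_neg_mul _ _
  clear_value θ
  let E : Subalgebra k R :=
    { carrier := {a | logDer θ (ι a) = ι (D a)}
      mul_mem' := fun {a b} (ha : _ = _) (hb : _ = _) => by
        change _ = _
        rw [map_mul, Derivation.leibniz, Derivation.leibniz, ha, hb]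
        simp only [smul_eq_mul, map_add, map_mul]
      add_mem' := fun {a b} (ha : _ = _) (hb : _ = _) => by
        change _ = _
        rw [map_add, map_add, map_add, map_add, ha, hb]
      algebraMap_mem' := fun c => by
        change _ = _
        rw [AlgHom.commutes, Derivation.map_algebraMap, Derivation.map_algebraMap, map_zero] }
  have m0 : x ∈ E := by change logDer θ (ι x) = _; rw [hx, h0]
  have m1 : y ∈ E := by change logDer θ (ι y) = _; rw [hy, h1]
  have m3 : t ∈ E := by change logDer θ (ι t) = _; rw [ht, h3]
  have m2 : z ∈ E := by
    have hin : x ^ m * z ∈ E := by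
      rw [hrel]
      refine add_mem (add_mem (pow_mem m1 _) (pow_mem m3 _)) (mul_mem m0 ?_)
      rw [Polynomial.aeval_eq_sum_range]
      exact sum_mem fun i _ => Subalgebra.smul_mem _ (pow_mem m0 i) _
    have hin' : logDer θ (ι (x ^ m * z)) = ι (D (x ^ m * z)) := hin
    have hp : logDer θ (ι (x ^ m)) = ι (D (x ^ m)) := pow_mem m0 m
    rw [map_mul, Derivation.leibniz, Derivation.leibniz, hp] at hin'
    simp only [smul_eq_mul, map_add, map_mul, map_pow, hx] at hin'
    exact mul_left_cancel₀ (pow_ne_zero m (tx_ne_zero k)) (add_right_cancel hin')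
  have hE : E = ⊤ := by
    rw [← top_le_iff, ← htop, Algebra.adjoin_le_iff]
    rintro _ (rfl | rfl | rfl | rfl) <;> assumption
  refine ⟨θ, fun a => ?_⟩
  have : a ∈ E := hE ▸ Algebra.mem_top
  exact this

/-- The class of a variable in the coordinate ring. -/
noncomputable def gen (k : Type) [Field k] (m r s : ℕ) (q : Polynomial k) (i : Fin 4) :
    krAlg k m r s q := Ideal.Quotient.mkₐ k _ (X i)

theorem rel_of_map_krRel_eq_zero {R : Type*} [CommRing R] [Algebra k R]
    (f : MvPolynomial (Fin 4) k →ₐ[k] R) (h : f (krRel k m r s q) = 0) :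
    f (X 0) ^ m * f (X 2) = f (X 1) ^ r + f (X 3) ^ s + f (X 0) * Polynomial.aeval (f (X 0)) q := by
  rw [krRel] at h
  simp only [map_sub, map_mul, map_pow, ← Polynomial.aeval_algHom_apply] at h
  linear_combination h

theorem gen_rel : gen k m r s q 0 ^ m * gen k m r s q 2 = gen k m r s q 1 ^ r +
    gen k m r s q 3 ^ s + gen k m r s q 0 * Polynomial.aeval (gen k m r s q 0) q :=
  rel_of_map_krRel_eq_zero (Ideal.Quotient.mkₐ k _)
    (Ideal.Quotient.eq_zero_iff_mem.2 (Ideal.mem_span_singleton_self _))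

theorem adjoin_gen : Algebra.adjoin k {gen k m r s q 0, gen k m r s q 1, gen k m r s q 2,
    gen k m r s q 3} = ⊤ := by
  have h : ({gen k m r s q 0, gen k m r s q 1, gen k m r s q 2, gen k m r s q 3} : Set _) =
      Ideal.Quotient.mkₐ k (Ideal.span {krRel k m r s q}) '' Set.range X := by
    ext a
    constructor
    · rintro (rfl | rfl | rfl | rfl)
      exacts [⟨_, ⟨0, rfl⟩, rfl⟩, ⟨_, ⟨1, rfl⟩, rfl⟩, ⟨_, ⟨2, rfl⟩, rfl⟩, ⟨_, ⟨3, rfl⟩, rfl⟩]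
    · rintro ⟨_, ⟨i, rfl⟩, rfl⟩
      fin_cases i
      exacts [.inl rfl, .inr (.inl rfl), .inr (.inr (.inl rfl)), .inr (.inr (.inr rfl))]
  rw [h, Algebra.adjoin_image, MvPolynomial.adjoin_range_X, Algebra.map_top, AlgHom.range_eq_top]
  exact Ideal.Quotient.mkₐ_surjective k _

@[simp] theorem krEmb_gen (i : Fin 4) :
    krEmb k m r s q (gen k m r s q i) = evalKr k m r s q (X i) := rfl

theorem exists_logDer_extending (D : Derivation k (krAlg k m r s q) (krAlg k m r s q)) :
    ∃ θ : ℤ × ℤ × ℤ →+ Torus k,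
      ∀ a, logDer θ (krEmb k m r s q a) = krEmb k m r s q (D a) :=
  exists_logDer_extending_of_generators (krEmb k m r s q) (by simp) (by simp) (by simp)
    gen_rel adjoin_gen D

theorem krEmb_mem_octAlg_of_map_eq_zero [CharZero k] (hm : 2 ≤ m) (hr : 2 ≤ r) (hs : 2 ≤ s)
    (hrs : r.Coprime s) (D : Derivation k (krAlg k m r s q) (krAlg k m r s q)) (hD : D ≠ 0)
    (hnil : ∀ a, a ∈ D.nilSubalgebra) {a : krAlg k m r s q} (ha : D a = 0) :
    krEmb k m r s q a ∈ octAlg k := by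
  obtain ⟨θ, hθ⟩ := exists_logDer_extending D
  have hmem {b : Torus k} (hb : b ∈ krSub m r s q) : ∃ a, krEmb k m r s q a = b := by
    rwa [← krEmb_range] at hb
  have hit (n : ℕ) (a) : (logDer θ)^[n] (krEmb k m r s q a) = krEmb k m r s q (D^[n] a) := by
    induction n with
    | zero => rfl
    | succ n ih => rw [Function.iterate_succ_apply', ih, hθ, Function.iterate_succ_apply']
  refine mem_octAlg_of_map_eq_zero hm hr hs hrs (θ := θ) ?_ ?_ ?_ (krEmb_mem k m r s q a) ?_
  · rintro rfl
    refine hD (Derivation.ext fun a => krEmb_injective k m r s q (by omega) (by omega) ?_)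
    rw [← hθ]
    have : logDer (0 : ℤ × ℤ × ℤ →+ Torus k) = 0 := by
      refine Derivation.ext fun b => ?_
      induction b using induction_linear with
      | zero => simp
      | add x y hx hy => rw [map_add, hx, hy]; simp
      | single g c => rw [logDer_single]; simp
    rw [this]
    simp
  · intro b hb
    obtain ⟨a, rfl⟩ := hmem hb
    rw [hθ]
    exact krEmb_mem k m r s q _
  · intro b hb
    obtain ⟨a, rfl⟩ := hmem hb
    obtain ⟨n, hn⟩ := hnil a
    exact ⟨n, by rw [hit, hn, map_zero]⟩
  · rw [hθ, ha, map_zero]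

end Locally

end KorasRussell

/-- Transport of a derivation along an isomorphism of algebras. -/
def Derivation.conj {k A B : Type*} [CommRing k] [CommRing A] [CommRing B] [Algebra k A]
    [Algebra k B] (e : A ≃ₐ[k] B) (D : Derivation k A A) : Derivation k B B :=
  Derivation.mk' (e.toLinearMap ∘ₗ D.toLinearMap ∘ₗ e.symm.toLinearMap) fun a b => by
    simp

@[simp] theorem Derivation.conj_apply {k A B : Type*} [CommRing k] [CommRing A] [CommRing B]
    [Algebra k A] [Algebra k B] (e : A ≃ₐ[k] B) (D : Derivation k A A) (b : B) :
    D.conj e b = e (D (e.symm b)) := rfl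

namespace KorasRussell

section Locally

variable {k : Type} [Field k] {m r s : ℕ} {q q' : Polynomial k}

theorem exists_derivation_gen (d : Fin 4 → MvPolynomial (Fin 4) k)
    (hd : mkDerivation k d (krRel k m r s q) = 0) :
    ∃ D : Derivation k (krAlg k m r s q) (krAlg k m r s q),
      ∀ i, D (gen k m r s q i) = Ideal.Quotient.mkₐ k _ (d i) := by
  have h : ∀ f, Ideal.Quotient.mkₐ k (Ideal.span {krRel k m r s q}) f = 0 →
      Ideal.Quotient.mkₐ k (Ideal.span {krRel k m r s q}) (mkDerivation k d f) = 0 := by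
    intro f hf
    obtain ⟨b, rfl⟩ := Ideal.mem_span_singleton'.1 (Ideal.Quotient.eq_zero_iff_mem.1 hf)
    rw [Derivation.leibniz, hd, smul_zero, zero_add, smul_eq_mul]
    exact Ideal.Quotient.eq_zero_iff_mem.2
      (Ideal.mul_mem_right _ _ (Ideal.mem_span_singleton_self _))
  refine ⟨Derivation.liftOfSurjective (Ideal.Quotient.mkₐ_surjective k _) h, fun i => ?_⟩
  rw [gen, Derivation.liftOfSurjective_apply, mkDerivation_X]

theorem mkDerivation_krRel (d : Fin 4 → MvPolynomial (Fin 4) k) (h0 : d 0 = 0) :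
    mkDerivation k d (krRel k m r s q) =
      X 0 ^ m * d 2 - C (r : k) * X 1 ^ (r - 1) * d 1 - C (s : k) * X 3 ^ (s - 1) * d 3 := by
  have hx : mkDerivation k d (X 0) = 0 := by rw [mkDerivation_X, h0]
  have hq : mkDerivation k d (Polynomial.aeval (X 0) q) = 0 := by
    rw [Polynomial.aeval_eq_sum_range, map_sum]
    refine Finset.sum_eq_zero fun i _ => ?_
    rw [Derivation.map_smul, Derivation.leibniz_pow, hx, smul_zero, smul_zero, smul_zero]
  simp only [krRel, map_sub, Derivation.leibniz, Derivation.leibniz_pow, hx, hq, mkDerivation_X]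
  simp only [smul_eq_mul, nsmul_eq_mul, map_natCast]
  ring

theorem mem_nilSubalgebra_of_map {R : Type*} [CommRing R] [Algebra k R] {D : Derivation k R R}
    {a : R} (h : D a ∈ D.nilSubalgebra) : a ∈ D.nilSubalgebra := by
  obtain ⟨n, hn⟩ := h
  exact ⟨n + 1, hn⟩

theorem mem_nilSubalgebra_of_gen {D : Derivation k (krAlg k m r s q) (krAlg k m r s q)}
    (h : ∀ i, gen k m r s q i ∈ D.nilSubalgebra) (a) : a ∈ D.nilSubalgebra := by
  have : D.nilSubalgebra = ⊤ := by
    rw [← top_le_iff, ← adjoin_gen, Algebra.adjoin_le_iff]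
    rintro _ (rfl | rfl | rfl | rfl) <;> apply h
  rw [this]
  exact Algebra.mem_top

theorem gen_zero_pow_ne_zero (n : ℕ) : gen k m r s q 0 ^ n ≠ 0 := by
  intro h
  have := congrArg (krEmb k m r s q) h
  rw [map_pow, krEmb_gen, evalKr_X0, map_zero] at this
  exact pow_ne_zero n (tx_ne_zero k) this

theorem exists_nilpotent_derivation_y : ∃ D : Derivation k (krAlg k m r s q) (krAlg k m r s q),
    D ≠ 0 ∧ (∀ a, a ∈ D.nilSubalgebra) ∧ D (gen k m r s q 0) = 0 ∧ D (gen k m r s q 3) = 0 := by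
  obtain ⟨D, hD⟩ := exists_derivation_gen (q := q) (m := m) (r := r) (s := s)
    ![0, X 0 ^ m, C (r : k) * X 1 ^ (r - 1), 0] (by
      rw [mkDerivation_krRel _ rfl]
      simp only [Matrix.cons_val]
      ring)
  have h0 : D (gen k m r s q 0) = 0 := by rw [hD]; simp
  have h3 : D (gen k m r s q 3) = 0 := by rw [hD]; simp
  have h1 : D (gen k m r s q 1) = gen k m r s q 0 ^ m := by rw [hD]; rfl
  have h2 : D (gen k m r s q 2) = algebraMap k _ r * gen k m r s q 1 ^ (r - 1) := by
    rw [hD]; rfl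
  have n0 : gen k m r s q 0 ∈ D.nilSubalgebra := ⟨1, h0⟩
  have n1 : gen k m r s q 1 ∈ D.nilSubalgebra :=
    mem_nilSubalgebra_of_map (h1 ▸ pow_mem n0 _)
  refine ⟨D, ?_, mem_nilSubalgebra_of_gen fun i => ?_, h0, h3⟩
  · rintro rfl
    exact gen_zero_pow_ne_zero m h1.symm
  · fin_cases i
    exacts [n0, n1, mem_nilSubalgebra_of_map
      (h2 ▸ mul_mem (Subalgebra.algebraMap_mem _ _) (pow_mem n1 _)), ⟨1, h3⟩]

theorem exists_nilpotent_derivation_t : ∃ D : Derivation k (krAlg k m r s q) (krAlg k m r s q),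
    D ≠ 0 ∧ (∀ a, a ∈ D.nilSubalgebra) ∧ D (gen k m r s q 0) = 0 ∧ D (gen k m r s q 1) = 0 := by
  obtain ⟨D, hD⟩ := exists_derivation_gen (q := q) (m := m) (r := r) (s := s)
    ![0, 0, C (s : k) * X 3 ^ (s - 1), X 0 ^ m] (by
      rw [mkDerivation_krRel _ rfl]
      simp only [Matrix.cons_val]
      ring)
  have h0 : D (gen k m r s q 0) = 0 := by rw [hD]; simp
  have h1 : D (gen k m r s q 1) = 0 := by rw [hD]; simp
  have h3 : D (gen k m r s q 3) = gen k m r s q 0 ^ m := by rw [hD]; rfl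
  have h2 : D (gen k m r s q 2) = algebraMap k _ s * gen k m r s q 3 ^ (s - 1) := by
    rw [hD]; rfl
  have n0 : gen k m r s q 0 ∈ D.nilSubalgebra := ⟨1, h0⟩
  have n3 : gen k m r s q 3 ∈ D.nilSubalgebra :=
    mem_nilSubalgebra_of_map (h3 ▸ pow_mem n0 _)
  refine ⟨D, ?_, mem_nilSubalgebra_of_gen fun i => ?_, h0, h1⟩
  · rintro rfl
    exact gen_zero_pow_ne_zero m h3.symm
  · fin_cases i
    exacts [n0, ⟨1, h1⟩, mem_nilSubalgebra_of_map
      (h2 ▸ mul_mem (Subalgebra.algebraMap_mem _ _) (pow_mem n3 _)), n3]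

theorem krEmb_equiv_mem_octAlg [CharZero k] (hm : 2 ≤ m) (hr : 2 ≤ r) (hs : 2 ≤ s)
    (hrs : r.Coprime s) (φ : krAlg k m r s q ≃ₐ[k] krAlg k m r s q')
    {D : Derivation k (krAlg k m r s q) (krAlg k m r s q)} (hD : D ≠ 0)
    (hnil : ∀ a, a ∈ D.nilSubalgebra) {a : krAlg k m r s q} (ha : D a = 0) :
    krEmb k m r s q' (φ a) ∈ octAlg k := by
  have hit (n : ℕ) (a) : (D.conj φ)^[n] (φ a) = φ (D^[n] a) := by
    induction n with
    | zero => rfl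
    | succ n ih => simp only [Function.iterate_succ_apply', ih, Derivation.conj_apply,
        AlgEquiv.symm_apply_apply]
  refine krEmb_mem_octAlg_of_map_eq_zero hm hr hs hrs (D.conj φ) ?_ (fun b => ?_) ?_
  · intro h
    refine hD (Derivation.ext fun a => φ.injective ?_)
    have := congrArg (fun E : Derivation k _ _ => E (φ a)) h
    simpa using this
  · obtain ⟨n, hn⟩ := hnil (φ.symm b)
    refine ⟨n, ?_⟩
    rw [← φ.apply_symm_apply b, hit, hn, map_zero]
  · simp [ha]

/-- The inclusion of the polynomial ring in `x, y, t` into the coordinate ring. -/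
noncomputable def polyIncl (k : Type) [Field k] (m r s : ℕ) (q : Polynomial k) :
    MvPolynomial (Fin 3) k →ₐ[k] krAlg k m r s q :=
  aeval ![gen k m r s q 0, gen k m r s q 1, gen k m r s q 3]

@[simp] theorem polyIncl_X0 : polyIncl k m r s q (X 0) = gen k m r s q 0 := by simp [polyIncl]
@[simp] theorem polyIncl_X1 : polyIncl k m r s q (X 1) = gen k m r s q 1 := by simp [polyIncl]
@[simp] theorem polyIncl_X2 : polyIncl k m r s q (X 2) = gen k m r s q 3 := by simp [polyIncl]

@[simp] theorem krEmb_polyIncl (p : MvPolynomial (Fin 3) k) :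
    krEmb k m r s q (polyIncl k m r s q p) = evalS k p := by
  rw [← AlgHom.comp_apply]
  congr 1
  refine MvPolynomial.algHom_ext fun i => ?_
  fin_cases i
  · simp
  · simp
  · exact (congrArg _ polyIncl_X2).trans ((evalKr_X3 k m r s q).trans (evalS_X2 k).symm)

theorem exists_polyIncl_equiv [CharZero k] (hm : 2 ≤ m) (hr : 2 ≤ r) (hs : 2 ≤ s)
    (hrs : r.Coprime s) (φ : krAlg k m r s q ≃ₐ[k] krAlg k m r s q') (p : MvPolynomial (Fin 3) k) :
    ∃ p', polyIncl k m r s q' p' = φ (polyIncl k m r s q p) := by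
  obtain ⟨D, hD, hnil, h0, h3⟩ := exists_nilpotent_derivation_y (k := k) (m := m) (r := r) (s := s)
    (q := q)
  obtain ⟨E, hE, hnilE, h0', h1⟩ := exists_nilpotent_derivation_t (k := k) (m := m) (r := r)
    (s := s) (q := q)
  have key {D : Derivation k (krAlg k m r s q) (krAlg k m r s q)} (hD : D ≠ 0)
      (hnil : ∀ a, a ∈ D.nilSubalgebra) {a : krAlg k m r s q} (ha : D a = 0) :
      φ a ∈ (polyIncl k m r s q').range := by
    have := krEmb_equiv_mem_octAlg hm hr hs hrs φ hD hnil ha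
    rw [← evalS_range] at this
    obtain ⟨p', hp'⟩ := this
    refine ⟨p', krEmb_injective k m r s q' (by omega) (by omega) ?_⟩
    rw [← hp']
    exact krEmb_polyIncl p'
  have : ((φ : krAlg k m r s q →ₐ[k] krAlg k m r s q').comp (polyIncl k m r s q)).range ≤
      (polyIncl k m r s q').range := by
    rw [polyIncl, MvPolynomial.comp_aeval, ← Algebra.adjoin_range_eq_range_aeval,
      Algebra.adjoin_le_iff]
    rintro _ ⟨i, rfl⟩
    fin_cases i
    exacts [key hD hnil h0, key hE hnilE h1, key hD hnil h3]
  exact this ⟨p, rfl⟩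

theorem polyIncl_injective : Function.Injective (polyIncl k m r s q) := fun p p' h => by
  apply evalS_injective k
  rw [← krEmb_polyIncl (m := m) (r := r) (s := s) (q := q), h, krEmb_polyIncl]

/-- An isomorphism of coordinate rings restricts to the polynomial ring in `x, y, t`. -/
theorem exists_restricted_equiv [CharZero k] (hm : 2 ≤ m) (hr : 2 ≤ r) (hs : 2 ≤ s)
    (hrs : r.Coprime s) (φ : krAlg k m r s q ≃ₐ[k] krAlg k m r s q') :
    ∃ Φ : MvPolynomial (Fin 3) k ≃ₐ[k] MvPolynomial (Fin 3) k,
      ∀ p, polyIncl k m r s q' (Φ p) = φ (polyIncl k m r s q p) := by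
  have main {q q' : Polynomial k} (φ : krAlg k m r s q ≃ₐ[k] krAlg k m r s q') :
      ∃ Φ : MvPolynomial (Fin 3) k →ₐ[k] MvPolynomial (Fin 3) k,
      ∀ p, polyIncl k m r s q' (Φ p) = φ (polyIncl k m r s q p) := by
    choose g hg using exists_polyIncl_equiv hm hr hs hrs φ
    have : (φ : krAlg k m r s q →ₐ[k] krAlg k m r s q').comp (polyIncl k m r s q) =
        (polyIncl k m r s q').comp (aeval fun i => g (X i)) := by
      refine MvPolynomial.algHom_ext fun i => ?_
      rw [AlgHom.comp_apply, AlgHom.comp_apply, aeval_X, hg]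
      rfl
    exact ⟨aeval fun i => g (X i), fun p => (DFunLike.congr_fun this p).symm⟩
  obtain ⟨Φ, hΦ⟩ := main φ
  obtain ⟨Ψ, hΨ⟩ := main φ.symm
  refine ⟨AlgEquiv.ofAlgHom Φ Ψ (AlgHom.ext fun p => ?_) (AlgHom.ext fun p => ?_), hΦ⟩
  · exact polyIncl_injective (m := m) (r := r) (s := s) (q := q') (by simp [hΦ, hΨ])
  · exact polyIncl_injective (m := m) (r := r) (s := s) (q := q) (by simp [hΦ, hΨ])

end Locally

section Restriction

variable {k : Type} [Field k] {m r s : ℕ} {q q' : Polynomial k}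

/-- The polynomial `y^r + t^s + x q(x)` in `x, y, t`. -/
noncomputable def krPoly (r s : ℕ) (q : Polynomial k) : MvPolynomial (Fin 3) k :=
  X 1 ^ r + X 2 ^ s + X 0 * Polynomial.aeval (X 0) q

theorem evalS_krPoly : evalS k (krPoly r s q) = tF r s q := by
  simp [krPoly, tF, ← Polynomial.aeval_algHom_apply]

theorem polyIncl_krPoly :
    polyIncl k m r s q (krPoly r s q) = gen k m r s q 0 ^ m * gen k m r s q 2 := by
  rw [gen_rel, krPoly]
  simp only [map_add, map_mul, map_pow, ← Polynomial.aeval_algHom_apply, polyIncl_X0, polyIncl_X1,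
    polyIncl_X2]

theorem exists_tx_pow_mul_mem_octAlg (a : krAlg k m r s q) :
    ∃ n, tx k ^ n * krEmb k m r s q a ∈ octAlg k := by
  obtain ⟨f, rfl⟩ := Ideal.Quotient.mk_surjective a
  obtain ⟨n, g, h⟩ := exists_incl k m r s q f
  refine ⟨n, ?_⟩
  obtain ⟨b, hb⟩ := Ideal.mem_span_singleton'.1 h
  have := congrArg (evalKr k m r s q) hb
  rw [map_mul, evalKr_krRel, mul_zero, map_sub, map_mul, map_pow, evalKr_X0, evalKr_incl,
    eq_comm, sub_eq_zero] at this
  rw [krEmb_mk, this]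
  exact evalS_mem k g

theorem X_dvd_of_mul_mem_octAlg {c : MvPolynomial (Fin 3) k} {f : Torus k} {n N : ℕ}
    (hf : f ∉ octAlg k) (hN : tx k ^ N * f ∈ octAlg k) (hc : evalS k c ^ n * f ∈ octAlg k) :
    X 0 ∣ c := by
  have hX : Prime (X 0 : MvPolynomial (Fin 3) k) := X_prime
  induction N with
  | zero => exact absurd (by simpa using hN) hf
  | succ N ih =>
    by_cases hN' : tx k ^ N * f ∈ octAlg k
    · exact ih hN'
    rw [← evalS_range] at hN hc
    obtain ⟨g, hg⟩ := hN
    obtain ⟨h, hh⟩ := hc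
    have hg : evalS k g = tx k ^ (N + 1) * f := hg
    have hh : evalS k h = evalS k c ^ n * f := hh
    have e : c ^ n * g = X 0 * (X 0 ^ N * h) := by
      apply evalS_injective k
      simp only [map_mul, map_pow, hg, hh, evalS_X0]
      ring
    rcases hX.dvd_or_dvd ⟨_, e⟩ with h1 | ⟨g', rfl⟩
    · exact hX.dvd_of_dvd_pow h1
    · refine absurd ?_ hN'
      have : tx k ^ N * f = evalS k g' := by
        refine mul_left_cancel₀ (tx_ne_zero k) ?_
        rw [← mul_assoc, ← pow_succ', ← hg, map_mul, evalS_X0]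
      rw [this]
      exact evalS_mem k g'

theorem tz_notMem_octAlg (hm : m ≠ 0) (hs : s ≠ 0) : tz m r s q ∉ octAlg k := by
  rw [← evalS_range]
  rintro ⟨g, hg⟩
  have hg : evalS k g = tz m r s q := hg
  have e : X 0 ^ m * g = krPoly r s q := by
    apply evalS_injective k
    rw [map_mul, map_pow, evalS_X0, hg, tx_pow_mul_tz, evalS_krPoly]
  have := congrArg (aeval (![0, 1, 0] : Fin 3 → k)) e
  simp [krPoly, hm, hs] at this

theorem X_dvd_map_X (hm : m ≠ 0) (hs : s ≠ 0)
    (φ : krAlg k m r s q ≃ₐ[k] krAlg k m r s q')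
    (Φ : MvPolynomial (Fin 3) k ≃ₐ[k] MvPolynomial (Fin 3) k)
    (hΦ : ∀ p, polyIncl k m r s q' (Φ p) = φ (polyIncl k m r s q p)) : X 0 ∣ Φ (X 0) := by
  obtain ⟨N, hN⟩ := exists_tx_pow_mul_mem_octAlg (φ (gen k m r s q 2))
  refine X_dvd_of_mul_mem_octAlg (n := m) (fun h => ?_) hN ?_
  · rw [← evalS_range] at h
    obtain ⟨p, hp⟩ := h
    have hp : evalS k p = _ := hp
    rw [← krEmb_polyIncl (m := m) (r := r) (s := s) (q := q'),
      (krEmb_injective k m r s q' hm hs).eq_iff, ← Φ.apply_symm_apply p, hΦ,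
        φ.injective.eq_iff] at hp
    have := congrArg (krEmb k m r s q) hp
    rw [krEmb_polyIncl, krEmb_gen, evalKr_X2] at this
    exact tz_notMem_octAlg hm hs (this ▸ evalS_mem k _)
  · rw [← krEmb_polyIncl (m := m) (r := r) (s := s) (q := q'), hΦ, polyIncl_X0, ← map_pow,
      ← map_mul,
      ← map_pow, ← map_mul, ← polyIncl_krPoly, ← hΦ, krEmb_polyIncl]
    exact evalS_mem k _

theorem exists_map_X_eq (hm : m ≠ 0) (hs : s ≠ 0)
    (φ : krAlg k m r s q ≃ₐ[k] krAlg k m r s q')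
    (Φ : MvPolynomial (Fin 3) k ≃ₐ[k] MvPolynomial (Fin 3) k)
    (hΦ : ∀ p, polyIncl k m r s q' (Φ p) = φ (polyIncl k m r s q p)) :
    ∃ c : k, c ≠ 0 ∧ Φ (X 0) = C c * X 0 := by
  have h1 := X_dvd_map_X hm hs φ Φ hΦ
  have h2 : X 0 ∣ Φ.symm (X 0) := X_dvd_map_X hm hs φ.symm Φ.symm fun p => by
    rw [AlgEquiv.eq_symm_apply, ← hΦ, AlgEquiv.apply_symm_apply]
  have h3 : Φ (X 0) ∣ X 0 := by
    simpa using map_dvd Φ h2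
  obtain ⟨u, hu⟩ := associated_of_dvd_dvd h1 h3
  obtain ⟨c, hc, hc'⟩ := (MvPolynomial.isUnit_iff_eq_C_of_isReduced).1 u.isUnit
  exact ⟨c, hc.ne_zero, by rw [← hu, hc', mul_comm]⟩

theorem exists_map_krPoly_eq (hr : r ≠ 0)
    (φ : krAlg k m r s q ≃ₐ[k] krAlg k m r s q')
    (Φ : MvPolynomial (Fin 3) k ≃ₐ[k] MvPolynomial (Fin 3) k)
    (hΦ : ∀ p, polyIncl k m r s q' (Φ p) = φ (polyIncl k m r s q p)) {c : k}
    (hc : Φ (X 0) = C c * X 0) :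
    ∃ a b, Φ (krPoly r s q) = a * krPoly r s q' + X 0 ^ m * b := by
  have e : evalS k (Φ (krPoly r s q)) =
      tx k ^ m * krEmb k m r s q' (φ (algebraMap k _ c ^ m * gen k m r s q 2)) := by
    rw [← krEmb_polyIncl (m := m) (r := r) (s := s) (q := q'), hΦ, polyIncl_krPoly, map_mul,
      map_pow,
      ← polyIncl_X0, ← hΦ, hc, map_mul, map_pow, krEmb_polyIncl, map_mul, evalS_X0,
      map_mul, map_mul, map_pow, map_pow, AlgEquiv.commutes, AlgHom.commutes]
    have : evalS k (C c) = algebraMap k _ c := (evalS k).commutes c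
    rw [this]
    ring
  obtain ⟨p, hp, b, hb, h⟩ := exists_of_tx_pow_mul_mem hr (krEmb_mem k m r s q' _)
    (e ▸ evalS_mem k _)
  rw [← evalS_range] at hp hb
  obtain ⟨p, rfl⟩ := hp
  obtain ⟨b, rfl⟩ := hb
  refine ⟨p, b, evalS_injective k ?_⟩
  rw [e, h, map_add, map_mul, map_mul, map_pow, evalS_X0, evalS_krPoly, ← tx_pow_mul_tz (m := m)]
  change _ * (evalS k p * _ + evalS k b) = _
  ring

theorem exists_polynomial_equiv [CharZero k] (hm : 2 ≤ m) (hr : 2 ≤ r) (hs : 2 ≤ s)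
    (hrs : r.Coprime s) (φ : krAlg k m r s q ≃ₐ[k] krAlg k m r s q') :
    ∃ (Φ : MvPolynomial (Fin 3) k ≃ₐ[k] MvPolynomial (Fin 3) k) (c : k), c ≠ 0 ∧
      Φ (X 0) = C c * X 0 ∧
      (∃ a b, Φ (krPoly r s q) = a * krPoly r s q' + X 0 ^ m * b) ∧
      (∃ a b, Φ.symm (krPoly r s q') = a * krPoly r s q + X 0 ^ m * b) := by
  obtain ⟨Φ, hΦ⟩ := exists_restricted_equiv hm hr hs hrs φ
  have hΦ' (p) : polyIncl k m r s q (Φ.symm p) = φ.symm (polyIncl k m r s q' p) := by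
    rw [AlgEquiv.eq_symm_apply, ← hΦ, AlgEquiv.apply_symm_apply]
  obtain ⟨c, hc0, hc⟩ := exists_map_X_eq (by omega) (by omega) φ Φ hΦ
  obtain ⟨c', -, hc'⟩ := exists_map_X_eq (by omega) (by omega) φ.symm Φ.symm hΦ'
  exact ⟨Φ, c, hc0, hc, exists_map_krPoly_eq (by omega) φ Φ hΦ hc,
    exists_map_krPoly_eq (by omega) φ.symm Φ.symm hΦ' hc'⟩

end Restriction

section Functional

variable {k : Type*} [Field k]

/-- The monomial `y^i t^j` with coefficient a polynomial in `x`. -/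
noncomputable def ytMon (p : Polynomial k) (i j : ℕ) : MvPolynomial (Fin 3) k :=
  Polynomial.aeval (X 0) p * X 1 ^ i * X 2 ^ j

theorem ytMon_induction {P : MvPolynomial (Fin 3) k → Prop} (hadd : ∀ a b, P a → P b → P (a + b))
    (hmon : ∀ p i j, P (ytMon p i j)) (a : MvPolynomial (Fin 3) k) : P a := by
  induction a using MvPolynomial.induction_on' with
  | add a b ha hb => exact hadd a b ha hb
  | monomial d c =>
    convert hmon (Polynomial.monomial (d 0) c) (d 1) (d 2)
    rw [ytMon, Polynomial.aeval_monomial, monomial_eq,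
      Finsupp.prod_fintype _ _ (fun i => pow_zero _),
      Fin.prod_univ_three, MvPolynomial.algebraMap_eq]
    ring

theorem exists_linearMap_ytMon (l : ℕ → ℕ → Polynomial k) :
    ∃ L : MvPolynomial (Fin 3) k →ₗ[k] Polynomial k, ∀ p i j, L (ytMon p i j) = p * l i j := by
  refine ⟨(basisMonomials (Fin 3) k).constr k fun d => Polynomial.X ^ d 0 * l (d 1) (d 2),
    fun p i j => ?_⟩
  induction p using Polynomial.induction_on' with
  | add p p' hp hp' =>
    rw [add_mul, ← hp, ← hp', ← map_add]
    congr 1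
    simp only [ytMon, map_add]
    ring
  | monomial n c =>
    have : ytMon (Polynomial.monomial n c) i j = c • basisMonomials (Fin 3) k
        (Finsupp.single 0 n + Finsupp.single 1 i + Finsupp.single 2 j) := by
      rw [ytMon, Polynomial.aeval_monomial, coe_basisMonomials, MvPolynomial.algebraMap_eq,
        X_pow_eq_monomial, X_pow_eq_monomial, X_pow_eq_monomial, C_mul_monomial, monomial_mul,
        monomial_mul, smul_monomial]
      simp
    rw [this, map_smul, Module.Basis.constr_basis]
    simp [Polynomial.smul_eq_C_mul, ← Polynomial.C_mul_X_pow_eq_monomial, mul_assoc]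

/-- The moments `∏ (l + 1/r)` supported on multiples of `r`. -/
noncomputable def moment (k : Type*) [Field k] (r i : ℕ) : k :=
  if r ∣ i then ∏ l ∈ Finset.range (i / r), ((l : k) + (r : k)⁻¹) else 0

theorem moment_add [CharZero k] {r : ℕ} (hr : r ≠ 0) (i : ℕ) :
    r * moment k r (i + r) = (i + 1) * moment k r i := by
  have hr' : (r : k) ≠ 0 := Nat.cast_ne_zero.2 hr
  by_cases h : r ∣ i
  · obtain ⟨n, rfl⟩ := h
    rw [moment, moment, if_pos (by simp), if_pos (by simp), ← Nat.mul_succ,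
      Nat.mul_div_cancel_left _ (by omega), Nat.mul_div_cancel_left _ (by omega),
      Finset.prod_range_succ]
    push_cast
    field_simp
  · rw [moment, moment, if_neg (by simpa using h), if_neg h]
    simp

theorem moment_sub_one {r : ℕ} (hr : 2 ≤ r) : moment k r (r - 1) = 0 :=
  if_neg fun h => absurd (Nat.le_of_dvd (by omega) h) (by omega)

/-- The coefficients `(-x q)^n / ∏ (l + 1 + 1/r + 1/s)`. -/
noncomputable def betaCoeff (r s : ℕ) (q : Polynomial k) (n : ℕ) : Polynomial k :=
  Polynomial.C (∏ l ∈ Finset.range n, ((l : k) + 1 + (r : k)⁻¹ + (s : k)⁻¹)⁻¹) *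
    (-(Polynomial.X * q)) ^ n

theorem betaCoeff_succ [CharZero k] {r s : ℕ} (hr : r ≠ 0) (hs : s ≠ 0) (q : Polynomial k) (n : ℕ) :
    Polynomial.C ((n : k) + 1 + (r : k)⁻¹ + (s : k)⁻¹) * betaCoeff r s q (n + 1) =
      -(Polynomial.X * q) * betaCoeff r s q n := by
  have hr' : (r : k) ≠ 0 := Nat.cast_ne_zero.2 hr
  have hs' : (s : k) ≠ 0 := Nat.cast_ne_zero.2 hs
  have h : (n : k) + 1 + (r : k)⁻¹ + (s : k)⁻¹ ≠ 0 := by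
    have e : (n : k) + 1 + (r : k)⁻¹ + (s : k)⁻¹ = ((n + 1) * r * s + s + r : ℕ) / (r * s) := by
      push_cast
      field_simp
    rw [e]
    exact div_ne_zero (Nat.cast_ne_zero.2 (by omega)) (mul_ne_zero hr' hs')
  rw [betaCoeff, betaCoeff, Finset.prod_range_succ, Polynomial.C_mul, pow_succ]
  have h2 : Polynomial.C ((n : k) + 1 + (r : k)⁻¹ + (s : k)⁻¹) *
      Polynomial.C ((n : k) + 1 + (r : k)⁻¹ + (s : k)⁻¹)⁻¹ = 1 := by
    rw [← Polynomial.C_mul, mul_inv_cancel₀ h, Polynomial.C_1]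
  linear_combination (Polynomial.C (∏ l ∈ Finset.range n, ((l : k) + 1 + (r : k)⁻¹ + (s : k)⁻¹)⁻¹) *
    (-(Polynomial.X * q)) ^ n * (-(Polynomial.X * q))) * h2

/-- The coefficients of the functional annihilating the exact forms. -/
noncomputable def ytMoment (r s : ℕ) (q : Polynomial k) (i j : ℕ) : Polynomial k :=
  Polynomial.C (moment k r i * moment k s j) * betaCoeff r s q (i / r + j / s)

theorem ytMoment_hamiltonian [CharZero k] {r s : ℕ} (hr : 2 ≤ r) (hs : 2 ≤ s) (q : Polynomial k)
    (i j : ℕ) :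
    Polynomial.C (i * s : k) * ytMoment r s q (i - 1) (j + (s - 1)) =
      Polynomial.C (j * r : k) * ytMoment r s q (i + (r - 1)) (j - 1) := by
  rcases i with _ | i
  · simp [ytMoment, moment_sub_one hr]
  rcases j with _ | j
  · simp [ytMoment, moment_sub_one hs]
  rw [show i + 1 + (r - 1) = i + r by omega, show j + 1 + (s - 1) = j + s by omega]
  simp only [ytMoment, Nat.add_sub_cancel, Nat.add_div_right _ (show 0 < r by omega),
    Nat.add_div_right _ (show 0 < s by omega)]
  rw [show i / r + (j / s).succ = (i / r).succ + j / s by omega, ← mul_assoc, ← mul_assoc,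
    ← Polynomial.C_mul, ← Polynomial.C_mul]
  congr 2
  have h1 := moment_add (k := k) (r := r) (by omega) i
  have h2 := moment_add (k := k) (r := s) (by omega) j
  push_cast
  linear_combination (↑i + 1) * moment k r i * h2 - (↑j + 1) * moment k s j * h1

theorem ytMoment_symm (r s : ℕ) (q : Polynomial k) (i j : ℕ) :
    ytMoment r s q i j = ytMoment s r q j i := by
  have h (n) : betaCoeff r s q n = betaCoeff s r q n := by
    simp only [betaCoeff, add_right_comm]
  rw [ytMoment, ytMoment, h, mul_comm (moment k r i), add_comm (i / r)]

theorem ytMoment_exact [CharZero k] {r s : ℕ} (hr : 2 ≤ r) (hs : 2 ≤ s) (q : Polynomial k)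
    (i j : ℕ) :
    Polynomial.C ((i + r : ℕ) : k) * ytMoment r s q (i + (r - 1)) j +
      Polynomial.C (i : k) * ytMoment r s q (i - 1) (j + s) +
      Polynomial.C (i : k) * (Polynomial.X * q) * ytMoment r s q (i - 1) j = 0 := by
  rcases i with _ | i
  · simp [ytMoment, moment_sub_one hr]
  have hr' : (r : k) ≠ 0 := Nat.cast_ne_zero.2 (by omega)
  have hs' : (s : k) ≠ 0 := Nat.cast_ne_zero.2 (by omega)
  rw [show i + 1 + (r - 1) = i + r by omega]
  simp only [ytMoment, Nat.add_sub_cancel, Nat.add_div_right _ (show 0 < r by omega),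
    Nat.add_div_right _ (show 0 < s by omega)]
  rw [show i / r + (j / s).succ = i / r + j / s + 1 by omega,
    show (i / r).succ + j / s = i / r + j / s + 1 by omega]
  have h1 := moment_add (k := k) (r := r) (by omega) i
  have h2 := moment_add (k := k) (r := s) (by omega) j
  have h3 := betaCoeff_succ (show r ≠ 0 by omega) (show s ≠ 0 by omega) q (i / r + j / s)
  have key : ((i + 1 + r : ℕ) : k) * (moment k r (i + r) * moment k s j) +
      ((i + 1 : ℕ) : k) * (moment k r i * moment k s (j + s)) =
      (i + 1) * moment k r i * moment k s j *
        (((i / r + j / s : ℕ) : k) + 1 + (r : k)⁻¹ + (s : k)⁻¹) := by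
    by_cases hi : r ∣ i
    · by_cases hj : s ∣ j
      · have h1' : moment k r (i + r) = (r : k)⁻¹ * ((i + 1) * moment k r i) := by
          rw [← h1, inv_mul_cancel_left₀ hr']
        have h2' : moment k s (j + s) = (s : k)⁻¹ * ((j + 1) * moment k s j) := by
          rw [← h2, inv_mul_cancel_left₀ hs']
        rw [h1', h2']
        obtain ⟨a, rfl⟩ := hi
        obtain ⟨b, rfl⟩ := hj
        rw [Nat.mul_div_cancel_left _ (by omega), Nat.mul_div_cancel_left _ (by omega)]
        push_cast
        field_simp
        ring
      · have e : moment k s j = 0 := if_neg hj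
        have e' : moment k s (j + s) = 0 := if_neg (by simpa using hj)
        simp [e, e']
    · have e : moment k r i = 0 := if_neg hi
      have e' : moment k r (i + r) = 0 := if_neg (by simpa using hi)
      simp [e, e']
  have key' := congrArg Polynomial.C key
  push_cast at key' h3 ⊢
  simp only [map_add, map_mul, map_one, map_natCast] at key' h3 ⊢
  linear_combination betaCoeff r s q (i / r + j / s + 1) * key' + ((i : Polynomial k) + 1) *
    Polynomial.C (moment k r i) * Polynomial.C (moment k s j) * h3

end Functional

section Functional

variable {k : Type} [Field k]

theorem pderiv_aeval_X_zero {i : Fin 3} (hi : i ≠ 0) (p : Polynomial k) :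
    pderiv i (Polynomial.aeval (X 0 : MvPolynomial (Fin 3) k) p) = 0 := by
  rw [Polynomial.aeval_eq_sum_range, map_sum]
  refine Finset.sum_eq_zero fun n _ => ?_
  rw [Derivation.map_smul, Derivation.leibniz_pow, pderiv_X_of_ne hi.symm, smul_zero,
    smul_zero, smul_zero]

theorem pderiv_one_ytMon (p : Polynomial k) (i j : ℕ) :
    pderiv 1 (ytMon p i j) = ytMon (Polynomial.C (i : k) * p) (i - 1) j := by
  simp only [ytMon, Derivation.leibniz, Derivation.leibniz_pow, pderiv_aeval_X_zero one_ne_zero,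
    pderiv_X_self, pderiv_X_of_ne (show (2 : Fin 3) ≠ 1 by decide), map_mul, map_natCast,
    smul_eq_mul, nsmul_eq_mul]
  ring

theorem pderiv_two_ytMon (p : Polynomial k) (i j : ℕ) :
    pderiv 2 (ytMon p i j) = ytMon (Polynomial.C (j : k) * p) i (j - 1) := by
  simp only [ytMon, Derivation.leibniz, Derivation.leibniz_pow,
    pderiv_aeval_X_zero (show (2 : Fin 3) ≠ 0 by decide),
    pderiv_X_self, pderiv_X_of_ne (show (1 : Fin 3) ≠ 2 by decide), map_mul, map_natCast,
    smul_eq_mul, nsmul_eq_mul]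
  ring

theorem krPoly_mul_ytMon (r s : ℕ) (q p : Polynomial k) (i j : ℕ) :
    krPoly r s q * ytMon p i j =
      ytMon p (i + r) j + ytMon p i (j + s) + ytMon (Polynomial.X * q * p) i j := by
  simp only [krPoly, ytMon, map_mul, Polynomial.aeval_X]
  ring

/-- A `k[x]`-linear functional that annihilates relative divergences of vector fields vanishing on
`y^r + t^s + x q(x) = 0` and of Hamiltonian vector fields. -/
theorem exists_functional [CharZero k] {r s : ℕ} (hr : 2 ≤ r) (hs : 2 ≤ s) (q : Polynomial k) :
    ∃ L : MvPolynomial (Fin 3) k →ₗ[k] Polynomial k,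
      (∀ p f, L (Polynomial.aeval (X 0) p * f) = p * L f) ∧ L 1 = 1 ∧
      (∀ f, L (pderiv 1 (krPoly r s q * f)) = 0) ∧ (∀ f, L (pderiv 2 (krPoly r s q * f)) = 0) ∧
      ∀ f, L (pderiv 1 (f * (C (s : k) * X 2 ^ (s - 1)))) =
        L (pderiv 2 (f * (C (r : k) * X 1 ^ (r - 1)))) := by
  obtain ⟨L, hL⟩ := exists_linearMap_ytMon (ytMoment r s q)
  refine ⟨L, fun p f => ?_, ?_, fun f => ?_, fun f => ?_, fun f => ?_⟩
  · induction f using ytMon_induction with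
    | hadd a b ha hb => rw [mul_add, map_add, ha, hb, map_add, mul_add]
    | hmon p' i j =>
      have : Polynomial.aeval (X 0) p * ytMon p' i j = ytMon (p * p') i j := by
        simp only [ytMon, map_mul]
        ring
      rw [this, hL, hL, mul_assoc]
  · have : (1 : MvPolynomial (Fin 3) k) = ytMon 1 0 0 := by simp [ytMon]
    rw [this, hL]
    simp [ytMoment, moment, betaCoeff]
  · induction f using ytMon_induction with
    | hadd a b ha hb => rw [mul_add, map_add, map_add, ha, hb, add_zero]
    | hmon p i j =>
      have h := ytMoment_exact hr hs q i j
      simp only [krPoly_mul_ytMon, map_add, pderiv_one_ytMon, hL]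
      rw [show i + r - 1 = i + (r - 1) by omega]
      linear_combination p * h
  · induction f using ytMon_induction with
    | hadd a b ha hb => rw [mul_add, map_add, map_add, ha, hb, add_zero]
    | hmon p i j =>
      have h := ytMoment_exact hs hr q j i
      simp only [ytMoment_symm s r] at h
      simp only [krPoly_mul_ytMon, map_add, pderiv_two_ytMon, hL]
      rw [show j + s - 1 = j + (s - 1) by omega]
      linear_combination p * h
  · induction f using ytMon_induction with
    | hadd a b ha hb => rw [add_mul, add_mul, map_add, map_add, ha, hb, map_add, map_add]
    | hmon p i j =>
      have h := ytMoment_hamiltonian hr hs q i j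
      have e1 : ytMon p i j * (C (s : k) * X 2 ^ (s - 1)) =
          ytMon (Polynomial.C (s : k) * p) i (j + (s - 1)) := by
        simp only [ytMon, map_mul, map_natCast]
        ring
      have e2 : ytMon p i j * (C (r : k) * X 1 ^ (r - 1)) =
          ytMon (Polynomial.C (r : k) * p) (i + (r - 1)) j := by
        simp only [ytMon, map_mul, map_natCast]
        ring
      rw [e1, e2, pderiv_one_ytMon, pderiv_two_ytMon, hL, hL]
      simp only [Polynomial.C_mul] at h
      linear_combination p * h

end Functional

section Divisibility

variable {k : Type} [Field k]

theorem X_zero_dvd_sub_aeval (f : MvPolynomial (Fin 3) k) :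
    X 0 ∣ f - aeval ![0, X 1, (X 2 : MvPolynomial (Fin 3) k)] f := by
  induction f using MvPolynomial.induction_on with
  | C a => simp [MvPolynomial.algebraMap_eq]
  | add f g hf hg => rw [map_add, add_sub_add_comm]; exact dvd_add hf hg
  | mul_X f i hf =>
    rw [map_mul, aeval_X]
    have h : X 0 ∣ X i - (![0, X 1, X 2] : Fin 3 → MvPolynomial (Fin 3) k) i := by
      fin_cases i <;> simp
    have e (a b c d : MvPolynomial (Fin 3) k) : a * b - c * d = (a - c) * b + c * (b - d) := by ring
    rw [e]
    exact dvd_add (hf.mul_right _) (h.mul_left _)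

/-- The relations between `y^(r-1)` and `t^(s-1)` modulo `x`. -/
theorem exists_syzygy {u v : k} (hu : u ≠ 0) (hv : v ≠ 0) (i j : ℕ)
    {A B f : MvPolynomial (Fin 3) k} (h : C u * X 1 ^ i * A + C v * X 2 ^ j * B = X 0 * f) :
    ∃ ψ a b, A = ψ * (C v * X 2 ^ j) + X 0 * a ∧ B = -ψ * (C u * X 1 ^ i) + X 0 * b := by
  obtain ⟨a, ha⟩ := X_zero_dvd_sub_aeval A
  obtain ⟨b, hb⟩ := X_zero_dvd_sub_aeval B
  have h' := congrArg (aeval ![0, X 1, (X 2 : MvPolynomial (Fin 3) k)]) h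
  simp only [map_add, map_mul, map_pow, aeval_X, Matrix.cons_val, zero_mul,
    MvPolynomial.algHom_C, MvPolynomial.algebraMap_eq] at h'
  generalize aeval ![0, X 1, (X 2 : MvPolynomial (Fin 3) k)] A = A' at *
  generalize aeval ![0, X 1, (X 2 : MvPolynomial (Fin 3) k)] B = B' at *
  have hvv : C v * C v⁻¹ = (1 : MvPolynomial (Fin 3) k) := by
    rw [← C_mul, mul_inv_cancel₀ hv, C_1]
  have huu : C u⁻¹ * C u = (1 : MvPolynomial (Fin 3) k) := by
    rw [← C_mul, inv_mul_cancel₀ hu, C_1]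
  have hdvd : X 2 ^ j ∣ X 1 ^ i * A' :=
    ⟨-(C u⁻¹ * C v * B'), by linear_combination C u⁻¹ * h' - X 1 ^ i * A' * huu⟩
  have hnd : ¬ (X 2 : MvPolynomial (Fin 3) k) ∣ X 1 ^ i := fun hd => by
    simpa [X_dvd_X] using X_prime.dvd_of_dvd_pow hd
  obtain ⟨c, hc⟩ := (X_prime (R := k) (i := (2 : Fin 3))).pow_dvd_of_dvd_mul_left j hnd hdvd
  refine ⟨C v⁻¹ * c, a, b, by linear_combination ha + hc - X 2 ^ j * c * hvv, ?_⟩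
  have hne : (C v * X 2 ^ j : MvPolynomial (Fin 3) k) ≠ 0 :=
    mul_ne_zero (C_ne_zero.2 hv) (pow_ne_zero _ (X_ne_zero _))
  have : B' = -(C v⁻¹ * c) * (C u * X 1 ^ i) := by
    refine mul_left_cancel₀ hne ?_
    linear_combination h' - C u * X 1 ^ i * hc + C u * X 1 ^ i * X 2 ^ j * c * hvv
  linear_combination hb + this

theorem X_pow_dvd_of_divergence [CharZero k] {m r s : ℕ} (hm : m ≠ 0) (hr : 2 ≤ r) (hs : 2 ≤ s)
    {q d : Polynomial k} {a b g h : MvPolynomial (Fin 3) k}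
    (hF : C (r : k) * X 1 ^ (r - 1) * a + C (s : k) * X 2 ^ (s - 1) * b =
      h * krPoly r s q + X 0 ^ m * g)
    (hd : pderiv 1 a + pderiv 2 b = Polynomial.aeval (X 0) d) :
    Polynomial.X ^ (m - 1) ∣ q * d := by
  obtain ⟨m, rfl⟩ : ∃ n, m = n + 1 := Nat.exists_eq_succ_of_ne_zero hm
  have hr' : (r : k) ≠ 0 := Nat.cast_ne_zero.2 (by omega)
  have hs' : (s : k) ≠ 0 := Nat.cast_ne_zero.2 (by omega)
  have hrr : C (r : k)⁻¹ * C (r : k) = (1 : MvPolynomial (Fin 3) k) := by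
    rw [← C_mul, inv_mul_cancel₀ hr', C_1]
  have hss : C (s : k)⁻¹ * C (s : k) = (1 : MvPolynomial (Fin 3) k) := by
    rw [← C_mul, inv_mul_cancel₀ hs', C_1]
  obtain ⟨L, hL, hL1, hLy, hLt, hLH⟩ := exists_functional hr hs q
  have hry : (X 1 : MvPolynomial (Fin 3) k) ^ r = X 1 ^ (r - 1) * X 1 := by
    rw [← pow_succ, Nat.sub_add_cancel (by omega)]
  have hst : (X 2 : MvPolynomial (Fin 3) k) ^ s = X 2 ^ (s - 1) * X 2 := by
    rw [← pow_succ, Nat.sub_add_cancel (by omega)]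
  have hpoly : krPoly r s q = X 1 ^ (r - 1) * X 1 + X 2 ^ (s - 1) * X 2 +
      X 0 * Polynomial.aeval (X 0) q := by rw [krPoly, hry, hst]
  have hA : C (r : k) * X 1 ^ (r - 1) * (a - C (r : k)⁻¹ * h * X 1) +
      C (s : k) * X 2 ^ (s - 1) * (b - C (s : k)⁻¹ * h * X 2) =
      X 0 * (Polynomial.aeval (X 0) q * h + X 0 ^ m * g) := by
    rw [hpoly] at hF
    linear_combination hF - X 1 ^ (r - 1) * X 1 * h * hrr - X 2 ^ (s - 1) * X 2 * h * hss
  obtain ⟨ψ, κ, μ, h1, h2⟩ := exists_syzygy hr' hs' _ _ hA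
  have h3 : Polynomial.aeval (X 0) q * h + X 0 ^ m * g =
      C (r : k) * X 1 ^ (r - 1) * κ + C (s : k) * X 2 ^ (s - 1) * μ := by
    refine mul_left_cancel₀ (X_ne_zero (R := k) (0 : Fin 3)) ?_
    rw [← hA, h1, h2]
    ring
  obtain ⟨Ψ, hΨ⟩ : ∃ Ψ, Ψ = Polynomial.aeval (X 0) q * ψ + C (r : k)⁻¹ * X 1 * μ -
    C (s : k)⁻¹ * X 2 * κ := ⟨_, rfl⟩
  have ha : Polynomial.aeval (X 0) q * a = krPoly r s q * κ + Ψ * (C (s : k) * X 2 ^ (s - 1)) -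
      Polynomial.aeval (X 0) (Polynomial.X ^ m : Polynomial k) * (g * (C (r : k)⁻¹ * X 1)) := by
    rw [hpoly, hΨ, map_pow, Polynomial.aeval_X]
    linear_combination Polynomial.aeval (X 0) q * h1 + C (r : k)⁻¹ * X 1 * h3 +
      X 1 ^ (r - 1) * X 1 * κ * hrr + X 2 ^ (s - 1) * X 2 * κ * hss
  have hb : Polynomial.aeval (X 0) q * b = krPoly r s q * μ - Ψ * (C (r : k) * X 1 ^ (r - 1)) -
      Polynomial.aeval (X 0) (Polynomial.X ^ m : Polynomial k) * (g * (C (s : k)⁻¹ * X 2)) := by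
    rw [hpoly, hΨ, map_pow, Polynomial.aeval_X]
    linear_combination Polynomial.aeval (X 0) q * h2 + C (s : k)⁻¹ * X 2 * h3 +
      X 1 ^ (r - 1) * X 1 * μ * hrr + X 2 ^ (s - 1) * X 2 * μ * hss
  have hy (p : Polynomial k) (f : MvPolynomial (Fin 3) k) :
      pderiv 1 (Polynomial.aeval (X 0) p * f) = Polynomial.aeval (X 0) p * pderiv 1 f := by
    rw [Derivation.leibniz, pderiv_aeval_X_zero one_ne_zero, smul_zero, add_zero, smul_eq_mul]
  have ht (p : Polynomial k) (f : MvPolynomial (Fin 3) k) :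
      pderiv 2 (Polynomial.aeval (X 0) p * f) = Polynomial.aeval (X 0) p * pderiv 2 f := by
    rw [Derivation.leibniz, pderiv_aeval_X_zero (by decide), smul_zero, add_zero, smul_eq_mul]
  have ha' := congrArg (fun f => L (pderiv 1 f)) ha
  have hb' := congrArg (fun f => L (pderiv 2 f)) hb
  simp only [map_sub, map_add L, map_add (pderiv _), hy, ht, hL, hLy, hLt] at ha' hb'
  have hd' := congrArg L hd
  rw [← mul_one (Polynomial.aeval _ d), hL, hL1, map_add] at hd'
  refine ⟨-(L (pderiv 1 (g * (C (r : k)⁻¹ * X 1))) + L (pderiv 2 (g * (C (s : k)⁻¹ * X 2)))), ?_⟩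
  rw [Nat.add_sub_cancel]
  linear_combination ha' + hb' - q * hd' + hLH Ψ

end Divisibility

section Divergence

variable {k : Type*} [Field k]

theorem derivation_map_eq_sum {σ : Type*} [Fintype σ] (Φ : MvPolynomial σ k →ₐ[k] MvPolynomial σ k)
    (E : Derivation k (MvPolynomial σ k) (MvPolynomial σ k)) (f : MvPolynomial σ k) :
    E (Φ f) = ∑ p, Φ (pderiv p f) * E (Φ (X p)) := by
  classical
  induction f using MvPolynomial.induction_on with
  | C a => simp [MvPolynomial.algHom_C]
  | add f g hf hg => simp only [map_add, add_mul, Finset.sum_add_distrib, hf, hg]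
  | mul_X f i hf =>
    have h : ∑ p, Φ f * Φ (pderiv p (X i)) * E (Φ (X p)) = Φ f * E (Φ (X i)) := by
      rw [Finset.sum_eq_single i]
      · rw [pderiv_X_self, map_one, mul_one]
      · intro p _ hp
        rw [pderiv_X_of_ne hp.symm, map_zero, mul_zero, zero_mul]
      · simp
    rw [map_mul, Derivation.leibniz, hf]
    simp only [Derivation.leibniz, smul_eq_mul, map_add, map_mul, add_mul, Finset.sum_add_distrib]
    rw [h, Finset.mul_sum]
    congr 1
    exact Finset.sum_congr rfl fun p _ => by ring

theorem pderiv_pderiv_comm {σ : Type*} (i j : σ) (f : MvPolynomial σ k) :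
    pderiv i (pderiv j f) = pderiv j (pderiv i f) := by
  classical
  have h (i j l : σ) : pderiv i (pderiv j (X l : MvPolynomial σ k)) = 0 := by
    rcases eq_or_ne l j with rfl | hl
    · rw [pderiv_X_self, pderiv_one]
    · rw [pderiv_X_of_ne hl, map_zero]
  induction f using MvPolynomial.induction_on with
  | C a => simp
  | add f g hf hg => simp only [map_add, hf, hg]
  | mul_X f l hf =>
    simp only [Derivation.leibniz, smul_eq_mul, map_add, h, hf, mul_zero]
    ring

theorem pderiv_derivation {σ : Type*} [Fintype σ]
    (E : Derivation k (MvPolynomial σ k) (MvPolynomial σ k)) (f : MvPolynomial σ k) (l : σ) :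
    pderiv l (E f) = E (pderiv l f) + ∑ j, pderiv j f * pderiv l (E (X j)) := by
  have h (f) : E f = ∑ j, pderiv j f * E (X j) := derivation_map_eq_sum (AlgHom.id k _) E f
  conv_lhs => rw [h f]
  rw [h (pderiv l f), map_sum, ← Finset.sum_add_distrib]
  refine Finset.sum_congr rfl fun j _ => ?_
  rw [Derivation.leibniz, smul_eq_mul, smul_eq_mul, pderiv_pderiv_comm]
  ring

/-- The divergence of a polynomial vector field. -/
noncomputable def divergence (D : Derivation k (MvPolynomial (Fin 3) k) (MvPolynomial (Fin 3) k)) :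
    MvPolynomial (Fin 3) k := ∑ i, pderiv i (D (X i))

theorem trace_adjugate_mul_map {R : Type*} [CommRing R] [Algebra k R] (E : Derivation k R R)
    (M : Matrix (Fin 3) (Fin 3) R) : (M.adjugate * M.map E).trace = E M.det := by
  simp only [Matrix.trace_fin_three, Matrix.mul_apply, Fin.sum_univ_three,
    Matrix.adjugate_fin_three,
    Matrix.det_fin_three, Matrix.map_apply, map_add, map_sub, Derivation.leibniz, smul_eq_mul,
    Matrix.of_apply, Matrix.cons_val]
  ring

theorem derivation_isUnit_eq_zero {σ : Type*}
    (E : Derivation k (MvPolynomial σ k) (MvPolynomial σ k)) {f : MvPolynomial σ k}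
    (hf : IsUnit f) : E f = 0 := by
  obtain ⟨c, -, rfl⟩ := (MvPolynomial.isUnit_iff_eq_C_of_isReduced).1 hf
  exact E.map_algebraMap c

theorem divergence_conj (Φ : MvPolynomial (Fin 3) k ≃ₐ[k] MvPolynomial (Fin 3) k)
    (D : Derivation k (MvPolynomial (Fin 3) k) (MvPolynomial (Fin 3) k)) :
    divergence (D.conj Φ) = Φ (divergence D) := by
  set E := D.conj Φ with hE
  let M : Matrix (Fin 3) (Fin 3) (MvPolynomial (Fin 3) k) := fun i j => pderiv j (Φ (X i))
  let M' : Matrix (Fin 3) (Fin 3) (MvPolynomial (Fin 3) k) :=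
    fun i j => Φ (pderiv j (Φ.symm (X i)))
  let P : Matrix (Fin 3) (Fin 3) (MvPolynomial (Fin 3) k) := fun i j => Φ (pderiv j (D (X i)))
  let N : Matrix (Fin 3) (Fin 3) (MvPolynomial (Fin 3) k) := fun i j => pderiv j (E (X i))
  have chain (l : Fin 3) (f) : pderiv l (Φ f) = ∑ p, Φ (pderiv p f) * pderiv l (Φ (X p)) :=
    derivation_map_eq_sum (Φ : MvPolynomial (Fin 3) k →ₐ[k] MvPolynomial (Fin 3) k) (pderiv l) f
  have hM' : M' * M = 1 := by
    ext1 i l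
    rw [Matrix.mul_apply, ← chain l (Φ.symm (X i)), AlgEquiv.apply_symm_apply, pderiv_X,
      Matrix.one_apply, Pi.single_apply, eq_comm]
  have hdet : IsUnit M.det := by
    refine IsUnit.of_mul_eq_one_right M'.det ?_
    rw [← Matrix.det_mul, hM', Matrix.det_one]
  have hPM : P * M = M.map E + M * N := by
    ext1 i l
    rw [Matrix.mul_apply, ← chain l (D (X i)), Matrix.add_apply, Matrix.mul_apply, Matrix.map_apply]
    have : Φ (D (X i)) = E (Φ (X i)) := by simp [hE]
    rw [this]
    exact pderiv_derivation E (Φ (X i)) l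
  have htr := congrArg (fun A => (M.adjugate * A).trace) hPM
  simp only [mul_add, Matrix.trace_add] at htr
  rw [trace_adjugate_mul_map, derivation_isUnit_eq_zero E hdet, zero_add, ← mul_assoc, ← mul_assoc,
    Matrix.adjugate_mul, Matrix.trace_mul_comm, ← mul_assoc, Matrix.mul_adjugate, smul_mul_assoc,
    smul_mul_assoc, one_mul, one_mul, Matrix.trace_smul, Matrix.trace_smul] at htr
  have := hdet.mul_left_cancel htr
  rw [divergence, divergence, map_sum]
  exact this.symm

end Divergence

section Divergence

variable {k : Type} [Field k]

theorem derivation_aeval_X (E : Derivation k (MvPolynomial (Fin 3) k) (MvPolynomial (Fin 3) k))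
    (p : Polynomial k) : E (Polynomial.aeval (X 0) p) =
      Polynomial.aeval (X 0) (Polynomial.derivative p) * E (X 0) := by
  induction p using Polynomial.induction_on' with
  | add p q hp hq => simp only [map_add, add_mul, hp, hq]
  | monomial n c =>
    rw [Polynomial.derivative_monomial, Polynomial.aeval_monomial, Polynomial.aeval_monomial,
      Derivation.leibniz, Derivation.map_algebraMap, Derivation.leibniz_pow]
    simp only [smul_eq_mul, nsmul_eq_mul, map_mul, map_natCast]
    ring

theorem derivation_krPoly (E : Derivation k (MvPolynomial (Fin 3) k) (MvPolynomial (Fin 3) k))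
    (r s : ℕ) (q : Polynomial k) : E (krPoly r s q) =
      C (r : k) * X 1 ^ (r - 1) * E (X 1) + C (s : k) * X 2 ^ (s - 1) * E (X 2) +
        Polynomial.aeval (X 0) (Polynomial.derivative (Polynomial.X * q)) * E (X 0) := by
  rw [← derivation_aeval_X, krPoly, map_mul, Polynomial.aeval_X, map_add, map_add,
    Derivation.leibniz_pow, Derivation.leibniz_pow]
  simp only [smul_eq_mul, nsmul_eq_mul, map_natCast, mul_assoc]

theorem divergence_smul (f : MvPolynomial (Fin 3) k)
    (E : Derivation k (MvPolynomial (Fin 3) k) (MvPolynomial (Fin 3) k)) :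
    divergence (f • E) = f * divergence E + E f := by
  have h : E f = ∑ j, pderiv j f * E (X j) := derivation_map_eq_sum (AlgHom.id k _) E f
  rw [h, divergence, divergence, Finset.mul_sum, ← Finset.sum_add_distrib]
  refine Finset.sum_congr rfl fun j _ => ?_
  rw [Derivation.smul_apply, smul_eq_mul, Derivation.leibniz, smul_eq_mul, smul_eq_mul]
  ring

theorem divergence_sub (D E : Derivation k (MvPolynomial (Fin 3) k) (MvPolynomial (Fin 3) k)) :
    divergence (D - E) = divergence D - divergence E := by
  simp only [divergence, Derivation.sub_apply, map_sub, Finset.sum_sub_distrib]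

/-- The vector field scaling `y^r + t^s + x q(x)`. -/
noncomputable def scalingDer (r s : ℕ) (q : Polynomial k) :
    Derivation k (MvPolynomial (Fin 3) k) (MvPolynomial (Fin 3) k) :=
  mkDerivation k ![C (r * s : k) * (X 0 * Polynomial.aeval (X 0) q),
    C (s : k) * (X 1 * Polynomial.aeval (X 0) (Polynomial.derivative (Polynomial.X * q))),
    C (r : k) * (X 2 * Polynomial.aeval (X 0) (Polynomial.derivative (Polynomial.X * q)))]

variable {r s : ℕ} {q q' : Polynomial k}

theorem scalingDer_X0 : scalingDer r s q (X 0) =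
    C (r * s : k) * (X 0 * Polynomial.aeval (X 0) q) := by simp [scalingDer]

theorem scalingDer_X1 : scalingDer r s q (X 1) = C (s : k) * (X 1 *
    Polynomial.aeval (X 0) (Polynomial.derivative (Polynomial.X * q))) := by
  rw [scalingDer, mkDerivation_X]; rfl

theorem scalingDer_X2 : scalingDer r s q (X 2) = C (r : k) * (X 2 *
    Polynomial.aeval (X 0) (Polynomial.derivative (Polynomial.X * q))) := by
  rw [scalingDer, mkDerivation_X]; rfl

theorem scalingDer_krPoly (hr : r ≠ 0) (hs : s ≠ 0) : scalingDer r s q (krPoly r s q) =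
    C (r * s : k) * Polynomial.aeval (X 0) (Polynomial.derivative (Polynomial.X * q)) *
      krPoly r s q := by
  have hry : (X 1 : MvPolynomial (Fin 3) k) ^ r = X 1 ^ (r - 1) * X 1 := by
    rw [← pow_succ, Nat.sub_add_cancel (by omega)]
  have hst : (X 2 : MvPolynomial (Fin 3) k) ^ s = X 2 ^ (s - 1) * X 2 := by
    rw [← pow_succ, Nat.sub_add_cancel (by omega)]
  rw [derivation_krPoly, scalingDer_X0, scalingDer_X1, scalingDer_X2, krPoly, hry, hst, C_mul]
  ring

theorem divergence_scalingDer : divergence (scalingDer r s q) = C (r * s + r + s : k) *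
    Polynomial.aeval (X 0) (Polynomial.derivative (Polynomial.X * q)) := by
  have e : (X 0 * Polynomial.aeval (X 0) q : MvPolynomial (Fin 3) k) =
    Polynomial.aeval (X 0) (Polynomial.X * q) := by simp
  rw [divergence, Fin.sum_univ_three, scalingDer_X0, scalingDer_X1, scalingDer_X2, e,
    pderiv_C_mul, pderiv_C_mul, pderiv_C_mul, derivation_aeval_X, pderiv_X_self,
    Derivation.leibniz, Derivation.leibniz, derivation_aeval_X, derivation_aeval_X,
    pderiv_X_self, pderiv_X_self, pderiv_X_of_ne (show (0 : Fin 3) ≠ 1 by decide),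
    pderiv_X_of_ne (show (0 : Fin 3) ≠ 2 by decide)]
  simp only [smul_eq_mul, map_add]
  ring

theorem X_pow_dvd_of_polynomial_equiv [CharZero k] {m : ℕ} (hm : m ≠ 0) (hr : 2 ≤ r) (hs : 2 ≤ s)
    (Φ : MvPolynomial (Fin 3) k ≃ₐ[k] MvPolynomial (Fin 3) k) {c : k} (hc : c ≠ 0)
    (hX : Φ (X 0) = C c * X 0)
    (h1 : ∃ a b, Φ (krPoly r s q) = a * krPoly r s q' + X 0 ^ m * b)
    (h2 : ∃ a b, Φ.symm (krPoly r s q') = a * krPoly r s q + X 0 ^ m * b)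
    (Q : Polynomial k) (hQ : Q = q.comp (Polynomial.C c * Polynomial.X)) :
    Polynomial.X ^ (m - 1) ∣ q' * (Polynomial.C (r + s : k) * (Polynomial.X *
      (q' * Polynomial.derivative Q - Q * Polynomial.derivative q'))) := by
  have hΦp (p : Polynomial k) : Φ (Polynomial.aeval (X 0) p) =
      Polynomial.aeval (X 0) (p.comp (Polynomial.C c * Polynomial.X)) := by
    rw [← Polynomial.aeval_algHom_apply, hX, Polynomial.aeval_comp, map_mul, Polynomial.aeval_C,
      Polynomial.aeval_X, MvPolynomial.algebraMap_eq]
  have hcc : C c⁻¹ * C c = (1 : MvPolynomial (Fin 3) k) := by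
    rw [← C_mul, inv_mul_cancel₀ hc, C_1]
  have hΦC (a : k) : Φ (C a) = C a := Φ.commutes a
  have hXs : Φ.symm (X 0) = C c⁻¹ * X 0 := by
    rw [AlgEquiv.symm_apply_eq, map_mul, hΦC, hX]
    linear_combination -X 0 * hcc
  obtain ⟨E, hE⟩ : ∃ E, E = (scalingDer r s q).conj Φ := ⟨_, rfl⟩
  have hEX : E (X 0) = C (r * s : k) * (X 0 * Polynomial.aeval (X 0) Q) := by
    rw [hE, Derivation.conj_apply, hXs, ← smul_eq_C_mul, Derivation.map_smul, scalingDer_X0,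
      smul_eq_C_mul]
    generalize (r * s : k) = u
    rw [map_mul, map_mul, map_mul, hΦC, hΦC, hX, hΦp, hQ]
    linear_combination C u * X 0 *
      Polynomial.aeval (X 0) (q.comp (Polynomial.C c * Polynomial.X)) * hcc
  obtain ⟨A, B, hEF⟩ : ∃ A B, E (krPoly r s q') = A * krPoly r s q' + X 0 ^ m * B := by
    obtain ⟨a, b, h2⟩ := h2
    obtain ⟨a', b', h1⟩ := h1
    obtain ⟨m, rfl⟩ : ∃ n, m = n + 1 := Nat.exists_eq_succ_of_ne_zero hm
    obtain ⟨A, B, h⟩ : ∃ A B, scalingDer r s q (a * krPoly r s q + X 0 ^ (m + 1) * b) =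
        A * krPoly r s q + X 0 ^ (m + 1) * B := by
      rw [map_add, Derivation.leibniz, Derivation.leibniz, Derivation.leibniz_pow,
        scalingDer_krPoly (by omega) (by omega), scalingDer_X0]
      refine ⟨scalingDer r s q a + a * (C (r * s : k) *
        Polynomial.aeval (X 0) (Polynomial.derivative (Polynomial.X * q))),
        scalingDer r s q b + b * ((m : MvPolynomial (Fin 3) k) + 1) *
          (C (r * s : k) * Polynomial.aeval (X 0) q), ?_⟩
      simp only [smul_eq_mul, nsmul_eq_mul, Nat.add_sub_cancel]
      push_cast
      ring
    refine ⟨Φ A * a', Φ A * b' + C c ^ (m + 1) * Φ B, ?_⟩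
    rw [hE, Derivation.conj_apply, h2, h, map_add, map_mul, map_mul, map_pow, h1, hX]
    ring
  obtain ⟨V, hV⟩ : ∃ V, V = Polynomial.aeval (X 0 : MvPolynomial (Fin 3) k) q' • E -
    Polynomial.aeval (X 0 : MvPolynomial (Fin 3) k) Q • scalingDer r s q' := ⟨_, rfl⟩
  have hVX : V (X 0) = 0 := by
    rw [hV, Derivation.sub_apply, Derivation.smul_apply, Derivation.smul_apply, hEX, scalingDer_X0,
      smul_eq_mul, smul_eq_mul]
    ring
  have hVF := derivation_krPoly V r s q'
  rw [hVX, mul_zero, add_zero] at hVF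
  have hdiv : divergence V = pderiv 1 (V (X 1)) + pderiv 2 (V (X 2)) := by
    rw [divergence, Fin.sum_univ_three, hVX, map_zero, zero_add]
  refine X_pow_dvd_of_divergence (a := V (X 1)) (b := V (X 2)) (g := Polynomial.aeval (X 0) q' * B)
    (h := Polynomial.aeval (X 0) q' * A - Polynomial.aeval (X 0) Q * (C (r * s : k) *
      Polynomial.aeval (X 0) (Polynomial.derivative (Polynomial.X * q')))) hm hr hs ?_ ?_
  · rw [← hVF, hV, Derivation.sub_apply, Derivation.smul_apply, Derivation.smul_apply, hEF,
      scalingDer_krPoly (by omega) (by omega), smul_eq_mul, smul_eq_mul]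
    ring
  · have hcomp : (Polynomial.derivative (Polynomial.X * q)).comp
        (Polynomial.C c * Polynomial.X) = Q + Polynomial.X * Polynomial.derivative Q := by
      rw [hQ, Polynomial.derivative_comp]
      simp only [Polynomial.derivative_mul, Polynomial.derivative_X, Polynomial.derivative_C,
        Polynomial.add_comp, Polynomial.mul_comp, Polynomial.X_comp, one_mul, zero_mul, zero_add,
        mul_one]
      ring
    rw [← hdiv, hV, divergence_sub, divergence_smul, divergence_smul, derivation_aeval_X,
      derivation_aeval_X, hEX, scalingDer_X0, hE, divergence_conj, divergence_scalingDer,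
      divergence_scalingDer, map_mul, hΦC, hΦp, hcomp]
    simp only [Polynomial.derivative_mul, Polynomial.derivative_X, map_mul, map_sub, map_add,
      Polynomial.aeval_X, Polynomial.aeval_C, MvPolynomial.algebraMap_eq, one_mul]
    ring

end Divergence

section Family

variable {k : Type} [Field k]

theorem X_pow_dvd_of_wronskian [CharZero k] {n : ℕ} {W q : Polynomial k} (hW : W.coeff 0 = 0)
    (hq : q.coeff 0 ≠ 0)
    (h : Polynomial.X ^ n ∣ q * Polynomial.derivative W - W * Polynomial.derivative q) :
    Polynomial.X ^ (n + 1) ∣ W := by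
  suffices H : ∀ j ≤ n + 1, Polynomial.X ^ j ∣ W from H _ le_rfl
  intro j
  induction j with
  | zero => simp
  | succ j ih =>
    intro hj
    rcases j with _ | j
    · simpa [Polynomial.X_dvd_iff] using hW
    obtain ⟨U, rfl⟩ := ih (by omega)
    obtain ⟨V, hV⟩ := h
    obtain ⟨e, he⟩ := Nat.exists_eq_add_of_le (show j + 1 ≤ n by omega)
    have h3 : Polynomial.X ^ j * (Polynomial.C ((j : k) + 1) * (q * U)) = Polynomial.X ^ j *
        (Polynomial.X * (Polynomial.X ^ e * V - q * Polynomial.derivative U +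
          U * Polynomial.derivative q)) := by
      rw [he, Polynomial.derivative_mul, Polynomial.derivative_X_pow] at hV
      simp only [Nat.add_sub_cancel, Nat.cast_add, Nat.cast_one] at hV
      linear_combination hV
    have h4 := mul_left_cancel₀ (pow_ne_zero j Polynomial.X_ne_zero) h3
    have h5 := congrArg (fun p => Polynomial.coeff p 0) h4
    simp only [Polynomial.mul_coeff_zero, Polynomial.coeff_C_zero, Polynomial.coeff_X_zero,
      zero_mul] at h5
    have hU : U.coeff 0 = 0 := by
      have := Nat.cast_add_one_ne_zero (R := k) j
      simpa [this, hq] using h5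
    rw [pow_succ]
    exact mul_dvd_mul_left _ (Polynomial.X_dvd_iff.2 hU)

theorem coeff_qFam_zero (m : ℕ) (a : ℕ → k) : (qFam k m a).coeff 0 = 1 := by
  have h : ∑ x ∈ Finset.Icc 2 (m - 1), (Polynomial.C (a x) * Polynomial.X ^ x).coeff 0 = 0 :=
    Finset.sum_eq_zero fun i hi => by
      rw [Polynomial.coeff_C_mul_X_pow, if_neg (by simp at hi; omega)]
  rw [qFam, Polynomial.coeff_add, Polynomial.finsetSum_coeff, h]
  simp [Polynomial.coeff_one]

theorem coeff_qFam_one (m : ℕ) (a : ℕ → k) : (qFam k m a).coeff 1 = 1 := by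
  have h : ∑ x ∈ Finset.Icc 2 (m - 1), (Polynomial.C (a x) * Polynomial.X ^ x).coeff 1 = 0 :=
    Finset.sum_eq_zero fun i hi => by
      rw [Polynomial.coeff_C_mul_X_pow, if_neg (by simp at hi; omega)]
  rw [qFam, Polynomial.coeff_add, Polynomial.finsetSum_coeff, h]
  simp [Polynomial.coeff_one]

theorem coeff_qFam {m i : ℕ} (a : ℕ → k) (hi : i ∈ Finset.Icc 2 (m - 1)) :
    (qFam k m a).coeff i = a i := by
  have h2 : 2 ≤ i := (Finset.mem_Icc.1 hi).1
  rw [qFam, Polynomial.coeff_add, Polynomial.finsetSum_coeff]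
  simp only [Polynomial.coeff_C_mul_X_pow, Finset.sum_ite_eq, if_pos hi]
  simp [Polynomial.coeff_one, Polynomial.coeff_X, show i ≠ 0 by omega, show 1 ≠ i by omega]

theorem eq_of_polynomial_equiv [CharZero k] {m r s : ℕ} (hm : 4 ≤ m) (hr : 2 ≤ r) (hs : 2 ≤ s)
    {a a' : ℕ → k} (Φ : MvPolynomial (Fin 3) k ≃ₐ[k] MvPolynomial (Fin 3) k) {c : k} (hc : c ≠ 0)
    (hX : Φ (X 0) = C c * X 0)
    (h1 : ∃ f g, Φ (krPoly r s (qFam k m a)) = f * krPoly r s (qFam k m a') + X 0 ^ m * g)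
    (h2 : ∃ f g, Φ.symm (krPoly r s (qFam k m a')) = f * krPoly r s (qFam k m a) + X 0 ^ m * g)
    {i : ℕ} (hi : i ∈ Finset.Icc 2 (m - 2)) : a i = a' i := by
  obtain ⟨Q, hQ⟩ : ∃ Q, Q = (qFam k m a).comp (Polynomial.C c * Polynomial.X) := ⟨_, rfl⟩
  have hQi (j : ℕ) : Q.coeff j = (qFam k m a).coeff j * c ^ j := by
    rw [hQ, Polynomial.comp_C_mul_X_coeff]
  have key := X_pow_dvd_of_polynomial_equiv (by omega) hr hs Φ hc hX h1 h2 Q hQ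
  have hq0 := coeff_qFam_zero m a'
  have hndvd : ¬ Polynomial.X ∣ qFam k m a' := by
    rw [Polynomial.X_dvd_iff, hq0]; exact one_ne_zero
  have hrs0 : (r + s : k) ≠ 0 := by
    rw [← Nat.cast_add]; exact Nat.cast_ne_zero.2 (by omega)
  replace key := Polynomial.prime_X.pow_dvd_of_dvd_mul_left _ hndvd key
  rw [IsUnit.dvd_mul_left (Polynomial.isUnit_C.2 hrs0.isUnit), show m - 1 = (m - 2) + 1 by omega,
    pow_succ', mul_dvd_mul_iff_left Polynomial.X_ne_zero] at key
  have hdvd : Polynomial.X ^ (m - 2 + 1) ∣ Q - qFam k m a' := by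
    refine X_pow_dvd_of_wronskian (q := qFam k m a') ?_ (by rw [hq0]; exact one_ne_zero) ?_
    · rw [Polynomial.coeff_sub, hQi, hq0, coeff_qFam_zero]; simp
    · convert key using 1
      rw [Polynomial.derivative_sub]; ring
  rw [Polynomial.X_pow_dvd_iff] at hdvd
  have hcoeff (j : ℕ) (hj : j < m - 2 + 1) :
      (qFam k m a).coeff j * c ^ j = (qFam k m a').coeff j := by
    rw [← hQi, ← sub_eq_zero, ← Polynomial.coeff_sub, hdvd j hj]
  have hc1 : c = 1 := by
    simpa [coeff_qFam_one] using hcoeff 1 (by omega)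
  rw [Finset.mem_Icc] at hi
  have h := hcoeff i (by omega)
  rwa [hc1, one_pow, mul_one, coeff_qFam a (Finset.mem_Icc.2 (by omega)),
    coeff_qFam a' (Finset.mem_Icc.2 (by omega))] at h

/-- The shift `z ↦ z + d` of the ambient affine space. -/
noncomputable def shiftZ (d : k) : MvPolynomial (Fin 4) k →ₐ[k] MvPolynomial (Fin 4) k :=
  aeval ![X 0, X 1, X 2 + C d, X 3]

theorem shiftZ_comp (d e : k) (h : d + e = 0) :
    (shiftZ d).comp (shiftZ e) = AlgHom.id k (MvPolynomial (Fin 4) k) := by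
  refine MvPolynomial.algHom_ext fun i => ?_
  fin_cases i
  · simp [shiftZ]
  · simp [shiftZ]
  · simp [shiftZ, add_assoc, ← C_add, h]
  · simp [shiftZ]

/-- The shift `z ↦ z + d` as an automorphism. -/
noncomputable def shiftZEquiv (d : k) : MvPolynomial (Fin 4) k ≃ₐ[k] MvPolynomial (Fin 4) k :=
  AlgEquiv.ofAlgHom (shiftZ d) (shiftZ (-d)) (shiftZ_comp _ _ (by simp)) (shiftZ_comp _ _ (by simp))

theorem shiftZ_krRel {m r s : ℕ} {q q' : Polynomial k} {d : k}
    (h : Polynomial.X * q = Polynomial.X * q' + Polynomial.C d * Polynomial.X ^ m) :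
    shiftZ d (krRel k m r s q) = krRel k m r s q' := by
  have h' := congrArg (Polynomial.aeval (X 0 : MvPolynomial (Fin 4) k)) h
  simp only [map_mul, map_add, map_pow, Polynomial.aeval_X, Polynomial.aeval_C,
    MvPolynomial.algebraMap_eq] at h'
  have e0 : shiftZ d (X 0) = X 0 := by simp [shiftZ]
  have e1 : shiftZ d (X 1) = X 1 := by simp [shiftZ]
  have e2 : shiftZ d (X 2) = X 2 + C d := by simp [shiftZ]
  have e3 : shiftZ d (X 3) = X 3 := by simp [shiftZ]
  rw [krRel, map_sub, map_sub, map_sub, map_mul, map_pow, map_pow, map_pow, map_mul,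
    ← Polynomial.aeval_algHom_apply, e0, e1, e2, e3, krRel]
  linear_combination -h'

theorem X_mul_qFam_eq {m : ℕ} (hm : 4 ≤ m) {a a' : ℕ → k}
    (h : ∀ i ∈ Finset.Icc 2 (m - 2), a i = a' i) :
    Polynomial.X * qFam k m a = Polynomial.X * qFam k m a' +
      Polynomial.C (a (m - 1) - a' (m - 1)) * Polynomial.X ^ m := by
  obtain ⟨n, rfl⟩ : ∃ n, m = n + 2 := ⟨m - 2, by omega⟩
  simp only [qFam, show n + 2 - 1 = n + 1 by omega, show n + 2 - 2 = n by omega] at h ⊢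
  rw [Finset.sum_Icc_succ_top (by omega), Finset.sum_Icc_succ_top (by omega),
    Finset.sum_congr rfl fun i hi => by rw [h i hi], Polynomial.C_sub]
  ring

theorem nonempty_krAlg_equiv {m r s : ℕ} {q q' : Polynomial k} {d : k}
    (h : Polynomial.X * q = Polynomial.X * q' + Polynomial.C d * Polynomial.X ^ m) :
    Nonempty (krAlg k m r s q ≃ₐ[k] krAlg k m r s q') := by
  refine ⟨Ideal.quotientEquivAlg _ _ (shiftZEquiv d) ?_⟩
  rw [Ideal.map_span, Set.image_singleton]
  exact congrArg (fun f => Ideal.span {f}) (shiftZ_krRel h).symm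

end Family

end KorasRussell

/-- Dubouloz–Fasel, Corollary 3: for `m ≥ 4` and coprime `r, s ≥ 2`, the members of the family
`x^m z = y^r + t^s + x + x² + ∑_{i=2}^{m-1} a_i x^(i+1)` over two parameter tuples are
isomorphic iff the parameters agree in the range `2 ≤ i ≤ m - 2`. -/
theorem family_iso_iff (k : Type) [Field k] [CharZero k] (m r s : ℕ)
    (hm : 4 ≤ m) (hr : 2 ≤ r) (hs : 2 ≤ s) (hrs : Nat.Coprime r s) (a a' : ℕ → k) :
    Nonempty (krAlg k m r s (qFam k m a) ≃ₐ[k] krAlg k m r s (qFam k m a')) ↔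
      ∀ i ∈ Finset.Icc 2 (m - 2), a i = a' i := by
  constructor
  · rintro ⟨φ⟩ i hi
    obtain ⟨Φ, c, hc, hX, h1, h2⟩ :=
      KorasRussell.exists_polynomial_equiv (by omega) hr hs hrs φ
    exact KorasRussell.eq_of_polynomial_equiv hm hr hs Φ hc hX h1 h2 hi
  · intro h
    exact KorasRussell.nonempty_krAlg_equiv (KorasRussell.X_mul_qFam_eq hm h)
end

section
/- For integers m ≥ 2 and coprime r, s ≥ 2 and a polynomial q ∈ k[x] with q(0) ≠ 0, the k-algebra A(m,r,s,q) is a smooth k-algebra (equivalently, the affine threefold X(m,r,s,q) is smooth over k). -/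
open MvPolynomial

/-- If a derivation of a formally smooth algebra `P` takes the value `1` at `F`, then the hypersurface
`P ⧸ (F)` is formally smooth: `p ↦ p - F * D p` induces a section of `P ⧸ (F ^ 2) → P ⧸ (F)`. -/
theorem formallySmooth_quotient_span_singleton_of_derivation {R P : Type*} [CommRing R]
    [CommRing P] [Algebra R P] [Algebra.FormallySmooth R P] (D : Derivation R P P) (F : P)
    (hD : D F = 1) : Algebra.FormallySmooth R (P ⧸ Ideal.span {F}) := by
  let f : P →ₐ[R] P ⧸ Ideal.span {F} := Ideal.Quotient.mkₐ R _
  have hker : RingHom.ker f.toRingHom = Ideal.span {F} := Ideal.mk_ker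
  have hsq : RingHom.ker f.toRingHom ^ 2 = Ideal.span {F ^ 2} := by
    rw [hker, Ideal.span_singleton_pow]
  have hmem : ∀ c : P, F ^ 2 * c ∈ RingHom.ker f.toRingHom ^ 2 := fun c ↦ by
    rw [hsq]
    exact Ideal.mul_mem_right _ _ (Ideal.mem_span_singleton_self _)
  let φ : P →ₐ[R] P ⧸ RingHom.ker f.toRingHom ^ 2 :=
    AlgHom.ofLinearMap
      ((Ideal.Quotient.mkₐ R (RingHom.ker f.toRingHom ^ 2)).toLinearMap ∘ₗ
        (LinearMap.id - LinearMap.mulLeft R F ∘ₗ D.toLinearMap))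
      (by
        change Ideal.Quotient.mk _ (1 - F * D 1) = 1
        rw [D.map_one_eq_zero, mul_zero, sub_zero, map_one])
      (fun x y ↦ by
        simp only [LinearMap.comp_apply, AlgHom.toLinearMap_apply, ← map_mul]
        refine Ideal.Quotient.eq.mpr ?_
        convert hmem (-(D x * D y)) using 1
        simp
        ring)
  have hφ : ∀ x, φ x = Ideal.Quotient.mk _ (x - F * D x) := fun _ ↦ rfl
  have hφF : ∀ a ∈ Ideal.span {F}, φ a = 0 := by
    intro a ha
    obtain ⟨c, rfl⟩ := Ideal.mem_span_singleton'.mp ha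
    have : φ F = 0 := by rw [hφ, hD, mul_one, sub_self, map_zero]
    rw [map_mul, this, mul_zero]
  refine Algebra.FormallySmooth.of_split f (Ideal.Quotient.liftₐ _ φ hφF) ?_
  refine Ideal.Quotient.algHom_ext _ (AlgHom.ext fun x ↦ ?_)
  change f (x - F * D x) = f x
  have : f F = 0 := Ideal.Quotient.eq_zero_iff_mem.mpr (Ideal.mem_span_singleton_self _)
  simp [this]

theorem pderiv_two_krRel (k : Type) [Field k] (m r s : ℕ) (q : Polynomial k) :
    pderiv 2 (krRel k m r s q) = X 0 ^ m := by
  have hq : pderiv 2 (Polynomial.aeval (X 0 : MvPolynomial (Fin 4) k) q) = 0 := by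
    rw [Derivation.map_aeval]
    simp [pderiv_X]
  simp [krRel, hq, pderiv_X, Derivation.leibniz_pow]

theorem exists_pderiv_zero_krRel (k : Type) [Field k] (m r s : ℕ) (hm : 2 ≤ m)
    (q : Polynomial k) :
    ∃ h, pderiv 0 (krRel k m r s q) = C (-q.eval 0) + X 0 * h := by
  obtain ⟨n, rfl⟩ := Nat.exists_eq_add_of_le' hm
  have hq : Polynomial.aeval (X 0 : MvPolynomial (Fin 4) k) q =
      X 0 * Polynomial.aeval (X 0) q.divX + C (q.eval 0) := by
    conv_lhs => rw [← Polynomial.X_mul_divX_add q]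
    simp [MvPolynomial.algebraMap_eq, Polynomial.coeff_zero_eq_eval_zero]
  refine ⟨((n : MvPolynomial (Fin 4) k) + 2) * X 0 ^ n * X 2 - Polynomial.aeval (X 0) q.divX
    - pderiv 0 (Polynomial.aeval (X 0 : MvPolynomial (Fin 4) k) q), ?_⟩
  have : pderiv 0 (krRel k (n + 2) r s q) = ((n : MvPolynomial (Fin 4) k) + 2) * X 0 ^ (n + 1) * X 2
      - Polynomial.aeval (X 0) q
      - X 0 * pderiv 0 (Polynomial.aeval (X 0 : MvPolynomial (Fin 4) k) q) := by
    simp [krRel, pderiv_X, Derivation.leibniz_pow]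
    ring
  rw [this]
  nth_rewrite 1 [hq]
  rw [C_neg]
  ring

/-- The threefold `X(m,r,s,q)` is smooth over `k`: its coordinate ring `A(m,r,s,q)`
is a smooth `k`-algebra. -/
theorem krAlg_smooth (k : Type) [Field k] [CharZero k] (m r s : ℕ)
    (hm : 2 ≤ m) (hr : 2 ≤ r) (hs : 2 ≤ s) (hrs : Nat.Coprime r s)
    (q : Polynomial k) (hq : q.eval 0 ≠ 0) :
    Algebra.Smooth k (krAlg k m r s q) := by
  obtain ⟨h, hh⟩ := exists_pderiv_zero_krRel k m r s hm q
  have hconst : IsCoprime (X 0 : MvPolynomial (Fin 4) k) (C (-q.eval 0)) :=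
    ⟨0, C (-q.eval 0)⁻¹, by
      rw [zero_mul, zero_add, ← C_mul, inv_mul_cancel₀ (neg_ne_zero.mpr hq), C_1]⟩
  have hcop : IsCoprime ((X 0 : MvPolynomial (Fin 4) k) ^ m) (C (-q.eval 0) + X 0 * h) :=
    (hconst.add_mul_left_right h).pow_left
  obtain ⟨a, b, hab⟩ := hcop
  have hsmooth : Algebra.FormallySmooth k (krAlg k m r s q) :=
    formallySmooth_quotient_span_singleton_of_derivation
      (a • pderiv 2 + b • pderiv 0) (krRel k m r s q) (by
        simp [pderiv_two_krRel, hh, ← hab])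
  have hfp : Algebra.FinitePresentation k (krAlg k m r s q) :=
    Algebra.FinitePresentation.quotient ⟨{krRel k m r s q}, by simp⟩
  exact ⟨hsmooth, hfp⟩
end

section
/- The unique k-derivation D of the polynomial ring k[x,t,u,v] determined by D(x) = 0, D(t) = 0, D(u) = 2·t·v and D(v) = x² satisfies D(v²t − x²u − 1) = 0 (hence descends to a k-derivation of the coordinate ring B = k[x,t,u,v]/(v²t − x²u − 1) of the smooth affine threefold V = {v²t − x²u = 1}), is locally nilpotent (for every p ∈ k[x,t,u,v] there exists n with D^n(p) = 0), and is fixed-point free on V: the ideal of k[x,t,u,v] generated by 2·t·v, x² and v²t − x²u − 1 is the unit ideal. -/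
open MvPolynomial

/-- The `k`-derivation of `k[x,t,u,v]` with `D x = 0`, `D t = 0`, `D u = 2tv`, `D v = x²`
(variables `x = X 0`, `t = X 1`, `u = X 2`, `v = X 3`). -/
noncomputable def vDer (k : Type) [Field k] :
    Derivation k (MvPolynomial (Fin 4) k) (MvPolynomial (Fin 4) k) :=
  MvPolynomial.mkDerivation k fun i =>
    if i = 0 then 0
    else if i = 1 then 0
    else if i = 2 then 2 * X 1 * X 3
    else X 0 ^ 2

namespace Derivation

variable {R A : Type*} [CommRing R] [CommRing A] [Algebra R A]

/-- If `D^m a = 0` and `D^n b = 0`, then `D^(m+n) (a * b) = 0`. -/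
theorem iterate_add_mul_eq_zero (D : Derivation R A A) {m n : ℕ} {a b : A}
    (ha : D^[m] a = 0) (hb : D^[n] b = 0) : D^[m + n] (a * b) = 0 := by
  induction h : m + n generalizing m n a b with
  | zero =>
    obtain rfl : m = 0 := by omega
    simp_all
  | succ N ih =>
    rw [Function.iterate_succ_apply, D.leibniz, smul_eq_mul, smul_eq_mul, iterate_map_add]
    have iterate_zero (j : ℕ) : D^[j] 0 = 0 := iterate_map_zero D j
    have hab : D^[N] (a * D b) = 0 := by
      cases n with
      | zero => simp_all
      | succ n => exact ih ha hb (by omega)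
    have hba : D^[N] (b * D a) = 0 := by
      cases m with
      | zero => simp_all
      | succ m => exact ih hb ha (by omega)
    rw [hab, hba, add_zero]

theorem iterate_eq_zero_of_le_s11 (D : Derivation R A A) {m n : ℕ} {a : A} (hmn : m ≤ n)
    (ha : D^[m] a = 0) : D^[n] a = 0 := by
  obtain ⟨j, rfl⟩ := Nat.exists_eq_add_of_le' hmn
  rw [Function.iterate_add_apply, ha, iterate_map_zero]

/-- The elements killed by some power of a derivation form a subalgebra. -/
def nilSubalgebra_s11 (D : Derivation R A A) : Subalgebra R A where
  carrier := {a | ∃ n : ℕ, D^[n] a = 0}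
  mul_mem' := by
    rintro a b ⟨m, ha⟩ ⟨n, hb⟩
    exact ⟨m + n, D.iterate_add_mul_eq_zero ha hb⟩
  add_mem' := by
    rintro a b ⟨m, ha⟩ ⟨n, hb⟩
    refine ⟨m + n, ?_⟩
    rw [iterate_map_add, D.iterate_eq_zero_of_le_s11 (Nat.le_add_right m n) ha,
      D.iterate_eq_zero_of_le_s11 (Nat.le_add_left n m) hb, add_zero]
  algebraMap_mem' r := ⟨1, D.map_algebraMap r⟩

theorem mem_nilSubalgebra {D : Derivation R A A} {a : A} :
    a ∈ D.nilSubalgebra_s11 ↔ ∃ n : ℕ, D^[n] a = 0 :=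
  Iff.rfl

theorem mem_nilSubalgebra_of_apply_mem {D : Derivation R A A} {a : A}
    (h : D a ∈ D.nilSubalgebra_s11) : a ∈ D.nilSubalgebra_s11 :=
  let ⟨n, hn⟩ := h
  ⟨n + 1, hn⟩

/-- A derivation of a polynomial ring is locally nilpotent as soon as it is nilpotent on the
variables. -/
theorem nilSubalgebra_eq_top {σ : Type*} {D : Derivation R (MvPolynomial σ R) (MvPolynomial σ R)}
    (h : ∀ i, X i ∈ D.nilSubalgebra_s11) : D.nilSubalgebra_s11 = ⊤ := by
  rw [eq_top_iff, ← MvPolynomial.adjoin_range_X, Algebra.adjoin_le_iff]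
  rintro _ ⟨i, rfl⟩
  exact h i

end Derivation

section vDer

variable (k : Type) [Field k]

theorem vDer_X_zero : vDer k (X 0) = 0 := by
  simp [vDer, mkDerivation_X]

theorem vDer_X_one : vDer k (X 1) = 0 := by
  simp [vDer, mkDerivation_X]

theorem vDer_X_two : vDer k (X 2) = 2 * X 1 * X 3 := by
  simp [vDer, mkDerivation_X]

theorem vDer_X_three : vDer k (X 3) = X 0 ^ 2 := by
  simp [vDer, mkDerivation_X]

theorem X_mem_nilSubalgebra_vDer (i : Fin 4) : X i ∈ (vDer k).nilSubalgebra_s11 := by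
  have h0 : X 0 ∈ (vDer k).nilSubalgebra_s11 := ⟨1, vDer_X_zero k⟩
  have h1 : X 1 ∈ (vDer k).nilSubalgebra_s11 := ⟨1, vDer_X_one k⟩
  have h3 : X 3 ∈ (vDer k).nilSubalgebra_s11 := by
    apply Derivation.mem_nilSubalgebra_of_apply_mem
    rw [vDer_X_three]
    exact pow_mem h0 2
  have h2 : X 2 ∈ (vDer k).nilSubalgebra_s11 := by
    apply Derivation.mem_nilSubalgebra_of_apply_mem
    rw [vDer_X_two]
    exact mul_mem (mul_mem (ofNat_mem _ 2) h1) h3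
  fin_cases i
  exacts [h0, h1, h2, h3]

end vDer

/-- The derivation `D` with `D x = D t = 0`, `D u = 2tv`, `D v = x²` kills the defining
relation `v²t - x²u - 1` of the threefold `V = {v²t - x²u = 1}` (hence descends to `V`),
is locally nilpotent, and has no fixed points on `V`: the ideal generated by `2tv`, `x²`
and `v²t - x²u - 1` is the unit ideal. -/
theorem vDer_locNilpotent_fixedPointFree (k : Type) [Field k] [CharZero k] :
    vDer k (X 3 ^ 2 * X 1 - X 0 ^ 2 * X 2 - 1) = 0 ∧
      (∀ p : MvPolynomial (Fin 4) k, ∃ n : ℕ, (⇑(vDer k))^[n] p = 0) ∧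
      Ideal.span {(2 * X 1 * X 3 : MvPolynomial (Fin 4) k), X 0 ^ 2,
        X 3 ^ 2 * X 1 - X 0 ^ 2 * X 2 - 1} = (⊤ : Ideal (MvPolynomial (Fin 4) k)) := by
  refine ⟨?_, fun p => ?_, ?_⟩
  · simp only [map_sub, Derivation.leibniz, Derivation.leibniz_pow, Derivation.map_one_eq_zero,
      vDer_X_zero, vDer_X_one, vDer_X_two, vDer_X_three, smul_eq_mul, nsmul_eq_mul]
    push_cast
    ring
  · rw [← Derivation.mem_nilSubalgebra,
      Derivation.nilSubalgebra_eq_top (X_mem_nilSubalgebra_vDer k)]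
    trivial
  · rw [Ideal.eq_top_iff_one, Ideal.mem_span_insert]
    have half : (C (1 / 2 : k) : MvPolynomial (Fin 4) k) * 2 = 1 := by
      rw [← map_ofNat C 2, ← C_mul]
      simp
    refine ⟨C (1 / 2) * X 3, _, Ideal.mem_span_pair.mpr ⟨-X 2, -1, rfl⟩, ?_⟩
    linear_combination (-(X 1 * X 3 ^ 2)) * half
end

section
/- Let m ≥ 2 and r, s ≥ 2 be integers and let q ∈ k[x] with q(0) = 1. Suppose g₁, g₂ ∈ k[x] satisfy g₁^r ≡ q and g₂^s ≡ q modulo x^m. Then in the polynomial ring k[x,y,t,w] one has the equality of ideals (x^m, (g₁·y + x^m·w)^r + (g₂·t + x^m·w)^s + x·q(x)) = (x^m, y^r + t^s + x); that is, the k[x]-automorphism of k[x][y,t,w] given by the matrix with rows (g₁, 0, x^m), (0, g₂, x^m), (h₁, h₂, h₃) maps the ideal (x^m, y^r + t^s + x·q(x)) onto the ideal (x^m, y^r + t^s + x). -/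
open MvPolynomial

theorem Ideal.span_pair_eq_of_dvd_sub_mul {R : Type*} [CommRing R] {n f g u : R}
    (hu : IsCoprime n u) (h : n ∣ f - u * g) : Ideal.span {n, f} = Ideal.span {n, g} := by
  obtain ⟨a, b, hab⟩ := hu
  obtain ⟨c, hc⟩ := h
  apply le_antisymm <;> rw [Ideal.span_le, Set.pair_subset_iff] <;>
    refine ⟨Ideal.subset_span (by simp), Ideal.mem_span_pair.2 ?_⟩
  · exact ⟨c, u, by linear_combination -hc⟩
  · exact ⟨a * g - b * c, b, by linear_combination g * hab + b * hc⟩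

theorem dvd_add_mul_pow_sub_mul_pow {R : Type*} [CommRing R] {n u g : R} {r : ℕ}
    (h : n ∣ u - g ^ r) (y w : R) : n ∣ (g * y + n * w) ^ r - u * y ^ r := by
  have h' : n ∣ (g * y + n * w) ^ r - (g * y) ^ r :=
    dvd_trans (by simp) (sub_dvd_pow_sub_pow (g * y + n * w) (g * y) r)
  have := dvd_sub h' (h.mul_right (y ^ r))
  rwa [show (g * y + n * w) ^ r - (g * y) ^ r - (u - g ^ r) * y ^ r =
    (g * y + n * w) ^ r - u * y ^ r by ring] at this

theorem Polynomial.isCoprime_X_of_eval_zero_eq_one {R : Type*} [CommRing R] {q : Polynomial R}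
    (hq : q.eval 0 = 1) : IsCoprime Polynomial.X q := by
  obtain ⟨p, hp⟩ := Polynomial.X_dvd_sub_C (p := q)
  rw [Polynomial.coeff_zero_eq_eval_zero, hq, Polynomial.C_1] at hp
  exact ⟨-p, 1, by linear_combination hp⟩

/-- In `k[x,y,t,w]` (variables `x = X 0`, `y = X 1`, `t = X 2`, `w = X 3`), if
`g₁^r ≡ q` and `g₂^s ≡ q` modulo `x^m`, then the substitution `y ↦ g₁ y + x^m w`,
`t ↦ g₂ t + x^m w` maps the ideal `(x^m, y^r + t^s + x·q(x))` onto `(x^m, y^r + t^s + x)`: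
`(x^m, (g₁ y + x^m w)^r + (g₂ t + x^m w)^s + x·q(x)) = (x^m, y^r + t^s + x)`. -/
theorem ideal_transport (k : Type) [Field k] [CharZero k] (m r s : ℕ)
    (hm : 2 ≤ m) (hr : 2 ≤ r) (hs : 2 ≤ s)
    (q g₁ g₂ : Polynomial k) (hq : q.eval 0 = 1)
    (h₁ : (Polynomial.X ^ m : Polynomial k) ∣ q - g₁ ^ r)
    (h₂ : (Polynomial.X ^ m : Polynomial k) ∣ q - g₂ ^ s) :
    Ideal.span {(X 0 : MvPolynomial (Fin 4) k) ^ m,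
        (Polynomial.aeval (X 0 : MvPolynomial (Fin 4) k) g₁ * X 1 + X 0 ^ m * X 3) ^ r +
          (Polynomial.aeval (X 0 : MvPolynomial (Fin 4) k) g₂ * X 2 + X 0 ^ m * X 3) ^ s +
          X 0 * Polynomial.aeval (X 0 : MvPolynomial (Fin 4) k) q} =
      Ideal.span {(X 0 : MvPolynomial (Fin 4) k) ^ m, X 1 ^ r + X 2 ^ s + X 0} := by
  have haeval : ∀ (p g : Polynomial k) (n : ℕ), Polynomial.X ^ m ∣ p - g ^ n →
      (X 0 : MvPolynomial (Fin 4) k) ^ m ∣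
        Polynomial.aeval (X 0) p - Polynomial.aeval (X 0) g ^ n := fun p g n h ↦ by
    simpa using map_dvd (Polynomial.aeval (X 0 : MvPolynomial (Fin 4) k)) h
  have hy := dvd_add_mul_pow_sub_mul_pow (haeval q g₁ r h₁) (X 1) (X 3)
  have ht := dvd_add_mul_pow_sub_mul_pow (haeval q g₂ s h₂) (X 2) (X 3)
  refine Ideal.span_pair_eq_of_dvd_sub_mul (u := Polynomial.aeval (X 0) q) ?_ ?_
  · simpa using (Polynomial.isCoprime_X_of_eval_zero_eq_one hq).pow_left (m := m) |>.map
      (Polynomial.aeval (X 0 : MvPolynomial (Fin 4) k)).toRingHom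
  · convert dvd_add hy ht using 1
    ring
end
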